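/- Let K be an imaginary quadratic field whose only roots of unity are ±1. Let 𝔞 and 𝔞′ be rank-1 K-lattices of conductors c and c′ respectively; set f = lcm(c, c′) and f′ = gcd(c, c′). Let Γ(𝔞, 𝔞′) = {γ ∈ GL₂(K) : det γ = ±1, γ₁₁ ∈ O_c, γ₂₂ ∈ O_{c′}, γ₁₂ ∈ c·𝔞·(f′·𝔞′)^{−1}, γ₂₁ ∈ c′·𝔞′·(f′·𝔞)^{−1}}. Then the number of orbits of Γ(𝔞, 𝔞′) acting on ℙ¹(K) by fractional linear transformations equals ∑_{ℓ ∣ f} h_ℓ · φ_u(f/ℓ) · ∑_{g ∣ ℓ} 2^{ω(ℓ/g)} · r_K(f′, g, f/ℓ). -/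

import Mathlib

open scoped Pointwise

noncomputable section

/-- The reduced totient function `φᵤ(n) = #((ℤ/nℤ)ˣ / {±1})`. -/
def phiU (n : ℕ) : ℕ := Nat.card ((ZMod n)ˣ ⧸ Subgroup.zpowers (-1 : (ZMod n)ˣ))

variable (K : Type) [Field K] [NumberField K]

/-- The underlying set of the order `ℤ + m·O_K` of conductor `m` in `K`. -/
def orderSet (m : ℕ) : Set K :=
  {x : K | ∃ (a : ℤ) (y : NumberField.RingOfIntegers K),
    x = (a : K) + (m : K) * algebraMap (NumberField.RingOfIntegers K) K y}

/-- The order `ℤ + m·O_K` of conductor `m`, as a subring of `K`. -/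
def orderSubring (m : ℕ) : Subring K where
  carrier := orderSet K m
  add_mem' := by
    rintro x y ⟨a, u, rfl⟩ ⟨b, v, rfl⟩
    exact ⟨a + b, u + v, by rw [map_add]; push_cast; ring⟩
  zero_mem' := ⟨0, 0, by simp⟩
  one_mem' := ⟨1, 0, by simp⟩
  neg_mem' := by
    rintro x ⟨a, u, rfl⟩
    exact ⟨-a, -u, by rw [map_neg]; push_cast; ring⟩
  mul_mem' := by
    rintro x y ⟨a, u, rfl⟩ ⟨b, v, rfl⟩
    refine ⟨a * b, a • v + b • u + (m : ℤ) • (u * v), ?_⟩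
    rw [map_add, map_add, map_zsmul, map_zsmul, map_zsmul, map_mul]
    rw [zsmul_eq_mul, zsmul_eq_mul, zsmul_eq_mul]
    push_cast
    ring

/-- `L` is a rank-1 `K`-lattice: a finitely generated `ℤ`-submodule of `K`
spanning `K` over `ℚ`. -/
def IsLat (L : Submodule ℤ K) : Prop :=
  L.FG ∧ Submodule.span ℚ (L : Set K) = ⊤

/-- The multiplier ring `R(L) = {α ∈ K : α·L ⊆ L}` of a lattice, as a `ℤ`-submodule. -/
def multLat (L : Submodule ℤ K) : Submodule ℤ K where
  carrier := {α : K | ∀ x ∈ L, α * x ∈ L}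
  add_mem' := by
    intro a b ha hb x hx
    rw [add_mul]; exact L.add_mem (ha x hx) (hb x hx)
  zero_mem' := by intro x hx; rw [zero_mul]; exact L.zero_mem
  smul_mem' := by
    intro n a ha x hx
    rw [smul_mul_assoc]; exact L.smul_mem n (ha x hx)

/-- `L` has conductor `c`, i.e. the multiplier ring of `L` is the order `ℤ + c·O_K`. -/
def HasCond (L : Submodule ℤ K) (c : ℕ) : Prop :=
  0 < c ∧ (multLat K L : Set K) = orderSet K c

/-- The inverse lattice `L⁻¹ = {x ∈ K : x·L ⊆ R(L)}`. -/
def invLat (L : Submodule ℤ K) : Submodule ℤ K where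
  carrier := {x : K | ∀ y ∈ L, x * y ∈ multLat K L}
  add_mem' := by
    intro a b ha hb y hy
    rw [add_mul]; exact (multLat K L).add_mem (ha y hy) (hb y hy)
  zero_mem' := by intro y hy; rw [zero_mul]; exact (multLat K L).zero_mem
  smul_mem' := by
    intro n a ha y hy
    rw [smul_mul_assoc]; exact (multLat K L).smul_mem n (ha y hy)

/-- The quotient group `L'/L`. -/
def quotLat (L L' : Submodule ℤ K) : Type :=
  L' ⧸ (L.comap L'.subtype)

instance (L L' : Submodule ℤ K) : AddCommGroup (quotLat K L L') :=
  inferInstanceAs (AddCommGroup (L' ⧸ (L.comap L'.subtype)))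

/-- The number of rank-1 `K`-lattices `L' ⊇ L` with `L'/L` cyclic of order `N` and `L'`
of conductor `b`; for `L` of conductor `a` this is the quantity `r_K(a, b, N)`. -/
def cnt (L : Submodule ℤ K) (b N : ℕ) : ℕ :=
  Nat.card {L' : Submodule ℤ K //
    L ≤ L' ∧ IsLat K L' ∧ IsAddCyclic (quotLat K L L') ∧
      Nat.card (quotLat K L L') = N ∧ HasCond K L' b}

/-- Two points of `ℙ¹(K)` are related if some `γ ∈ Γ(𝔞, 𝔞′)`, i.e. a matrix of
determinant `±1` with `γ₁₁ ∈ O_c`, `γ₂₂ ∈ O_{c′}`, `γ₁₂ ∈ c·𝔞·(f′·𝔞′)⁻¹`, and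
`γ₂₁ ∈ c′·𝔞′·(f′·𝔞)⁻¹`, carries one to the other by fractional linear transformation. -/
def gammaLatRel (𝔞 𝔞' : Submodule ℤ K) (c c' f' : ℕ)
    (x y : Projectivization K (Fin 2 → K)) : Prop :=
  ∃ γ : Matrix (Fin 2) (Fin 2) K,
    (γ.det = 1 ∨ γ.det = -1) ∧
    γ 0 0 ∈ orderSet K c ∧ γ 1 1 ∈ orderSet K c' ∧
    γ 0 1 ∈ ((c : K) • 𝔞) * invLat K ((f' : K) • 𝔞') ∧
    γ 1 0 ∈ ((c' : K) • 𝔞') * invLat K ((f' : K) • 𝔞) ∧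
    ∃ (v : Fin 2 → K) (hv : v ≠ 0) (hw : γ.mulVec v ≠ 0),
      x = Projectivization.mk K v hv ∧ y = Projectivization.mk K (γ.mulVec v) hw

section

set_option linter.unusedSectionVars false

variable {K}

/-- `y₁, y₂` is a `ℤ`-basis of `L`. -/
structure IsBas (y₁ y₂ : K) (L : Submodule ℤ K) : Prop where
  mem : ∀ x, x ∈ L ↔ ∃ a b : ℤ, x = a * y₁ + b * y₂
  ind : ∀ a b : ℤ, (a : K) * y₁ + b * y₂ = 0 → a = 0 ∧ b = 0

lemma IsBas.left_mem {y₁ y₂ : K} {L : Submodule ℤ K} (h : IsBas y₁ y₂ L) : y₁ ∈ L :=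
  (h.mem _).2 ⟨1, 0, by simp⟩

lemma IsBas.right_mem {y₁ y₂ : K} {L : Submodule ℤ K} (h : IsBas y₁ y₂ L) : y₂ ∈ L :=
  (h.mem _).2 ⟨0, 1, by simp⟩

lemma IsBas.left_ne {y₁ y₂ : K} {L : Submodule ℤ K} (h : IsBas y₁ y₂ L) : y₁ ≠ 0 := by
  rintro rfl
  simpa using h.ind 1 0

lemma IsBas.right_ne {y₁ y₂ : K} {L : Submodule ℤ K} (h : IsBas y₁ y₂ L) : y₂ ≠ 0 := by
  rintro rfl
  simpa using h.ind 0 1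

lemma IsBas.ext_coeff {y₁ y₂ : K} {L : Submodule ℤ K} (h : IsBas y₁ y₂ L) {a b a' b' : ℤ}
    (e : (a : K) * y₁ + b * y₂ = a' * y₁ + b' * y₂) : a = a' ∧ b = b' := by
  have := h.ind (a - a') (b - b') (by push_cast; linear_combination e)
  omega

lemma IsBas.le_iff {y₁ y₂ : K} {L : Submodule ℤ K} (h : IsBas y₁ y₂ L) {N : Submodule ℤ K} :
    L ≤ N ↔ y₁ ∈ N ∧ y₂ ∈ N := by
  refine ⟨fun H => ⟨H h.left_mem, H h.right_mem⟩, fun ⟨h1, h2⟩ x hx => ?_⟩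
  obtain ⟨a, b, rfl⟩ := (h.mem x).1 hx
  rw [← zsmul_eq_mul, ← zsmul_eq_mul]
  exact N.add_mem (N.smul_mem a h1) (N.smul_mem b h2)

lemma IsBas.smul {y₁ y₂ : K} {L : Submodule ℤ K} (h : IsBas y₁ y₂ L) {t : K} (ht : t ≠ 0) :
    IsBas (t * y₁) (t * y₂) (t • L) := by
  constructor
  · intro x
    rw [Submodule.mem_smul_pointwise_iff_exists]
    constructor
    · rintro ⟨z, hz, rfl⟩
      obtain ⟨a, b, rfl⟩ := (h.mem z).1 hz
      exact ⟨a, b, by simp only [smul_eq_mul]; ring⟩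
    · rintro ⟨a, b, rfl⟩
      exact ⟨_, (h.mem _).2 ⟨a, b, rfl⟩, by simp only [smul_eq_mul]; ring⟩
  · intro a b e
    apply h.ind
    have : t * ((a : K) * y₁ + b * y₂) = 0 := by linear_combination e
    simpa [ht] using this

/-- The lattice spanned by two elements. -/
def pairLat (y₁ y₂ : K) : Submodule ℤ K := Submodule.span ℤ {y₁, y₂}

lemma mem_pairLat {y₁ y₂ x : K} : x ∈ pairLat y₁ y₂ ↔ ∃ a b : ℤ, x = a * y₁ + b * y₂ := by
  simp only [pairLat, Submodule.mem_span_pair, zsmul_eq_mul, eq_comm]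

lemma IsBas.eq_pairLat {y₁ y₂ : K} {L : Submodule ℤ K} (h : IsBas y₁ y₂ L) :
    L = pairLat y₁ y₂ := by
  ext x; rw [h.mem, mem_pairLat]

section
variable [hK : Fact (Module.finrank ℚ K = 2)]

lemma IsLat.exists_isBas {L : Submodule ℤ K} (h : IsLat K L) : ∃ y₁ y₂, IsBas y₁ y₂ L := by
  obtain ⟨hfg, hsp⟩ := h
  have : Module.Finite ℤ L := Module.Finite.iff_fg.2 hfg
  let B := Module.Free.chooseBasis ℤ L
  have hli : LinearIndependent ℤ (fun i => (B i : K)) :=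
    B.linearIndependent.map' L.subtype (Submodule.ker_subtype L)
  have hli' : LinearIndependent ℚ (fun i => (B i : K)) :=
    (LinearIndependent.iff_fractionRing ℤ ℚ).1 hli
  have hspan : Submodule.span ℤ (Set.range fun i => (B i : K)) = L := by
    have := congrArg (Submodule.map L.subtype) B.span_eq
    rw [Submodule.map_span, ← Set.range_comp, Submodule.map_top, Submodule.range_subtype] at this
    exact this
  have htop : ⊤ ≤ Submodule.span ℚ (Set.range fun i => (B i : K)) := by
    rw [← Submodule.span_span_of_tower ℤ ℚ, hspan, hsp]
  let B' := Module.Basis.mk hli' htop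
  have hcard := Module.finrank_eq_card_basis B'
  rw [hK.out] at hcard
  let e := Fintype.equivFinOfCardEq hcard.symm
  refine ⟨B (e.symm 0), B (e.symm 1), ?_, ?_⟩
  · intro x
    constructor
    · intro hx
      have h1 := (B.reindex e).sum_repr ⟨x, hx⟩
      rw [Fin.sum_univ_two] at h1
      refine ⟨(B.reindex e).repr ⟨x, hx⟩ 0, (B.reindex e).repr ⟨x, hx⟩ 1, ?_⟩
      have h2 := congrArg (Subtype.val) h1
      simp only [Submodule.coe_add, Submodule.coe_smul, zsmul_eq_mul,
        Module.Basis.reindex_apply] at h2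
      exact h2.symm
    · rintro ⟨a, b, rfl⟩
      rw [← zsmul_eq_mul, ← zsmul_eq_mul]
      exact L.add_mem (L.smul_mem a (B _).2) (L.smul_mem b (B _).2)
  · intro a b hab
    have h1 : LinearIndependent ℤ (fun i : Fin 2 => (B (e.symm i) : K)) :=
      hli.comp _ e.symm.injective
    have h2 := (Fintype.linearIndependent_iff.1 h1) ![a, b] (by
      simpa [Fin.sum_univ_two, zsmul_eq_mul] using hab)
    exact ⟨by simpa using h2 0, by simpa using h2 1⟩

lemma IsBas.isLat {y₁ y₂ : K} {L : Submodule ℤ K} (h : IsBas y₁ y₂ L) : IsLat K L := by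
  have hL := h.eq_pairLat
  refine ⟨hL ▸ Submodule.fg_span (Set.toFinite _), ?_⟩
  have hli : LinearIndependent ℤ ![y₁, y₂] := by
    rw [LinearIndependent.pair_iff]
    intro a b hab
    exact h.ind a b (by simpa [zsmul_eq_mul] using hab)
  have hli' := (LinearIndependent.iff_fractionRing ℤ ℚ).1 hli
  have := hli'.span_eq_top_of_card_eq_finrank (by simp [hK.out])
  rw [eq_top_iff, ← this, Submodule.span_le]
  rintro _ ⟨i, rfl⟩
  apply Submodule.subset_span
  fin_cases i
  · exact h.left_mem
  · exact h.right_mem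

/-- A primitive binary quadratic relation between the elements of a basis. -/
structure IsForm (y₁ y₂ : K) (A B C : ℤ) : Prop where
  rel : (A : K) * y₂ ^ 2 + B * (y₁ * y₂) + C * y₁ ^ 2 = 0
  prim : ∃ p q r : ℤ, p * A + q * B + r * C = 1

lemma IsBas.exists_isForm {y₁ y₂ : K} {L : Submodule ℤ K} (_ : IsBas y₁ y₂ L) :
    ∃ A B C : ℤ, IsForm y₁ y₂ A B C := by
  have hdep : ¬ LinearIndependent ℤ ![y₂ ^ 2, y₁ * y₂, y₁ ^ 2] := by
    intro hli
    have hli' := (LinearIndependent.iff_fractionRing ℤ ℚ).1 hli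
    have := hli'.fintype_card_le_finrank
    rw [hK.out] at this
    simp at this
  rw [Fintype.not_linearIndependent_iff] at hdep
  obtain ⟨g, hg, i, hi⟩ := hdep
  simp only [Fin.sum_univ_three, zsmul_eq_mul] at hg
  have hg' : (g 0 : K) * y₂ ^ 2 + g 1 * (y₁ * y₂) + g 2 * y₁ ^ 2 = 0 := by simpa using hg
  set d : ℤ := GCDMonoid.gcd (g 0) (GCDMonoid.gcd (g 1) (g 2)) with hd
  have hd0 : d ≠ 0 := by
    intro h0
    rw [hd, gcd_eq_zero_iff, gcd_eq_zero_iff] at h0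
    fin_cases i <;> simp_all
  obtain ⟨A, hA⟩ : d ∣ g 0 := gcd_dvd_left _ _
  obtain ⟨B, hB⟩ : d ∣ g 1 := (gcd_dvd_right _ _).trans (gcd_dvd_left _ _)
  obtain ⟨C, hC⟩ : d ∣ g 2 := (gcd_dvd_right _ _).trans (gcd_dvd_right _ _)
  refine ⟨A, B, C, ?_, ?_⟩
  · have : (d : K) * ((A : K) * y₂ ^ 2 + B * (y₁ * y₂) + C * y₁ ^ 2) = 0 := by
      rw [← hg', hA, hB, hC]; push_cast; ring
    simpa [hd0] using this
  · obtain ⟨p, s, hps⟩ := exists_gcd_eq_mul_add_mul (g 0) (GCDMonoid.gcd (g 1) (g 2))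
    obtain ⟨q, r, hqr⟩ := exists_gcd_eq_mul_add_mul (g 1) (g 2)
    refine ⟨p, q * s, r * s, ?_⟩
    apply mul_left_cancel₀ hd0
    rw [← hd, hqr] at hps
    rw [mul_one]
    conv_rhs => rw [hps, hA, hB, hC]
    ring

lemma IsForm.A_ne {y₁ y₂ : K} {L : Submodule ℤ K} (h : IsBas y₁ y₂ L) {A B C : ℤ}
    (hf : IsForm y₁ y₂ A B C) : A ≠ 0 := by
  rintro rfl
  obtain ⟨p, q, r, h1⟩ := hf.prim
  have h2 := hf.rel
  have : y₁ * ((C : K) * y₁ + B * y₂) = 0 := by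
    push_cast at h2; linear_combination h2
  have h3 := h.ind C B (by simpa [h.left_ne] using this)
  simp [h3.1, h3.2] at h1

lemma IsForm.swap {y₁ y₂ : K} {A B C : ℤ} (hf : IsForm y₁ y₂ A B C) : IsForm y₂ y₁ C B A := by
  obtain ⟨p, q, r, h1⟩ := hf.prim
  exact ⟨by linear_combination hf.rel, r, q, p, by linear_combination h1⟩

lemma IsBas.swap {y₁ y₂ : K} {L : Submodule ℤ K} (h : IsBas y₁ y₂ L) : IsBas y₂ y₁ L := by
  refine ⟨fun x => ?_, fun a b e => (h.ind b a (by linear_combination e)).symm⟩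
  rw [h.mem]
  constructor <;> (rintro ⟨a, b, rfl⟩; exact ⟨b, a, by ring⟩)

/-- The multiplier ring of a lattice in terms of its form. -/
lemma IsForm.isBas_multLat {y₁ y₂ : K} {L : Submodule ℤ K} (h : IsBas y₁ y₂ L) {A B C : ℤ}
    (hf : IsForm y₁ y₂ A B C) : IsBas 1 (A * y₂ / y₁) (multLat K L) := by
  have h1 := h.left_ne
  have hrel := hf.rel
  constructor
  · intro α
    constructor
    · intro hα
      obtain ⟨a, b, e1⟩ := (h.mem _).1 (hα y₁ h.left_mem)
      obtain ⟨c, d, e2⟩ := (h.mem _).1 (hα y₂ h.right_mem)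
      obtain ⟨p, q, r, hp⟩ := hf.prim
      -- `b y₂² + (a - d) y₁ y₂ - c y₁² = 0`
      have e3 : (b : K) * y₂ ^ 2 + (a - d) * (y₁ * y₂) - c * y₁ ^ 2 = 0 := by
        linear_combination y₁ * e2 - y₂ * e1
      have e4 : y₁ * (((-c * A - b * C : ℤ) : K) * y₁ + (((a - d) * A - b * B : ℤ) : K) * y₂)
          = 0 := by
        push_cast; linear_combination A * e3 - b * hrel
      have e5 := h.ind _ _ ((mul_eq_zero.1 e4).resolve_left h1)
      refine ⟨a, p * b + q * (a - d) - r * c, ?_⟩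
      have hb : b = (p * b + q * (a - d) - r * c) * A := by
        linear_combination -b * hp - r * e5.1 - q * e5.2
      field_simp
      rw [e1]
      have hb' : (b : K) = ((p * b + q * (a - d) - r * c : ℤ) : K) * A := by exact_mod_cast hb
      push_cast at hb'
      push_cast
      linear_combination y₂ * hb'
    · rintro ⟨a, b, rfl⟩ x hx
      obtain ⟨u, v, rfl⟩ := (h.mem x).1 hx
      refine (h.mem _).2 ⟨a * u - b * v * C, a * v + b * u * A - b * v * B, ?_⟩
      field_simp
      push_cast
      linear_combination (b * v : K) * hrel
  · intro a b e
    have e' := h.ind a (b * A) (by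
      field_simp at e
      push_cast
      linear_combination e)
    have := hf.A_ne h
    simp_all

end

variable (K) in
/-- The order of conductor `m`, as a `ℤ`-submodule. -/
def ordLat (m : ℕ) : Submodule ℤ K := AddSubgroup.toIntSubmodule (orderSubring K m).toAddSubgroup

lemma mem_ordLat {m : ℕ} {x : K} : x ∈ ordLat K m ↔ x ∈ orderSet K m := Iff.rfl

lemma hasCond_iff {L : Submodule ℤ K} {c : ℕ} : HasCond K L c ↔ 0 < c ∧ multLat K L = ordLat K c :=
  ⟨fun h => ⟨h.1, SetLike.coe_injective h.2⟩, fun h => ⟨h.1, congrArg _ h.2⟩⟩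

lemma one_mem_ordLat (m : ℕ) : (1 : K) ∈ ordLat K m := (orderSubring K m).one_mem

lemma mul_mem_multLat {L : Submodule ℤ K} {x y : K} (hx : x ∈ multLat K L)
    (hy : y ∈ multLat K L) : x * y ∈ multLat K L := by
  intro z hz; rw [mul_assoc]; exact hx _ (hy _ hz)

section
variable [hK : Fact (Module.finrank ℚ K = 2)]

lemma isLat_of_exists_mul_mem {L : Submodule ℤ K} (hfg : L.FG)
    (h : ∀ x : K, ∃ n : ℤ, n ≠ 0 ∧ (n : K) * x ∈ L) : IsLat K L := by
  refine ⟨hfg, eq_top_iff.2 fun x _ => ?_⟩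
  obtain ⟨n, hn, hx⟩ := h x
  have : x = (n : ℚ)⁻¹ • ((n : K) * x) := by
    rw [Algebra.smul_def]
    have : (n : K) ≠ 0 := by exact_mod_cast hn
    simp
    field_simp
  rw [this]
  exact Submodule.smul_mem _ _ (Submodule.subset_span hx)

lemma IsLat.exists_mul_mem {L : Submodule ℤ K} (h : IsLat K L) (x : K) :
    ∃ n : ℤ, n ≠ 0 ∧ (n : K) * x ∈ L := by
  have hx : x ∈ Submodule.span ℚ (L : Set K) := h.2 ▸ Submodule.mem_top
  induction hx using Submodule.span_induction with
  | mem x hx => exact ⟨1, one_ne_zero, by simpa using hx⟩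
  | zero => exact ⟨1, one_ne_zero, by simp⟩
  | add x y _ _ hx hy =>
    obtain ⟨n, hn, h1⟩ := hx
    obtain ⟨m, hm, h2⟩ := hy
    refine ⟨n * m, mul_ne_zero hn hm, ?_⟩
    have : ((n * m : ℤ) : K) * (x + y) = m • ((n : K) * x) + n • ((m : K) * y) := by
      push_cast [zsmul_eq_mul]; ring
    rw [this]
    exact L.add_mem (L.smul_mem _ h1) (L.smul_mem _ h2)
  | smul a x _ hx =>
    obtain ⟨n, hn, h1⟩ := hx
    refine ⟨n * a.den, mul_ne_zero hn (by exact_mod_cast a.den_ne_zero), ?_⟩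
    have : ((n * a.den : ℤ) : K) * (a • x) = a.num • ((n : K) * x) := by
      have h3 : (a : K) * a.den = a.num := by exact_mod_cast Rat.mul_den_eq_num a
      rw [Algebra.smul_def, zsmul_eq_mul]
      push_cast
      simp only [eq_ratCast]
      linear_combination (n * x : K) * h3
    rw [this]
    exact L.smul_mem _ h1

lemma IsLat.exists_ne {L : Submodule ℤ K} (h : IsLat K L) : ∃ x ∈ L, x ≠ 0 := by
  obtain ⟨y₁, y₂, hb⟩ := h.exists_isBas
  exact ⟨y₁, hb.left_mem, hb.left_ne⟩

lemma IsLat.of_le {L L' : Submodule ℤ K} (h : IsLat K L) (hle : L ≤ L') (hfg : L'.FG) :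
    IsLat K L' :=
  ⟨hfg, eq_top_iff.2 (h.2 ▸ Submodule.span_mono hle)⟩

lemma IsLat.fg_of_le {L L' : Submodule ℤ K} (h : IsLat K L) (hle : L' ≤ L) : L'.FG := by
  have : Module.Finite ℤ L := Module.Finite.iff_fg.2 h.1
  have h1 : (L'.comap L.subtype).FG := IsNoetherian.noetherian _
  have h2 := h1.map L.subtype
  rwa [Submodule.map_comap_subtype, inf_eq_right.2 hle] at h2

lemma isLat_ordLat_one : IsLat K (ordLat K 1) := by
  have hmem : ∀ x : K, x ∈ ordLat K 1 ↔ ∃ y : NumberField.RingOfIntegers K, x = algebraMap _ K y := by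
    intro x
    rw [mem_ordLat]
    constructor
    · rintro ⟨a, y, rfl⟩
      exact ⟨a + y, by simp⟩
    · rintro ⟨y, rfl⟩
      exact ⟨0, y, by simp⟩
  apply isLat_of_exists_mul_mem
  · have h1 : (⊤ : Submodule ℤ (NumberField.RingOfIntegers K)).FG := Module.Finite.fg_top
    have h2 := h1.map (Algebra.linearMap (NumberField.RingOfIntegers K) K |>.restrictScalars ℤ)
    convert h2
    ext x
    rw [hmem]
    simp [eq_comm]
  · intro x
    have hx : IsAlgebraic ℤ x := by
      exact (IsFractionRing.isAlgebraic_iff ℤ ℚ K).2 (Algebra.IsAlgebraic.isAlgebraic x)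
    obtain ⟨y, hy, h⟩ := hx.exists_integral_multiple
    refine ⟨y, hy, (hmem _).2 ⟨⟨_, h⟩, ?_⟩⟩
    rw [← zsmul_eq_mul]; rfl

/-- `1, ω` is a basis of the maximal order and `ω² = sω + q`. -/
structure IsOmega (ω : K) (s q : ℤ) : Prop where
  rel : ω ^ 2 = s * ω + q
  mem : ∀ (m : ℕ) (x : K), x ∈ ordLat K m ↔ ∃ a b : ℤ, x = a + b * (m * ω)
  ind : ∀ a b : ℤ, (a : K) + b * ω = 0 → a = 0 ∧ b = 0

variable (K) in
lemma exists_isOmega : ∃ (ω : K) (s q : ℤ), IsOmega ω s q := by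
  obtain ⟨y₁, y₂, h⟩ := (isLat_ordLat_one (K := K)).exists_isBas
  obtain ⟨A, B, C, hf⟩ := h.exists_isForm
  have hm := hf.isBas_multLat h
  have hmul : multLat K (ordLat K 1) = ordLat K 1 := by
    ext x
    constructor
    · intro hx; simpa using hx 1 (one_mem_ordLat 1)
    · intro hx y hy; exact (orderSubring K 1).mul_mem hx hy
  rw [hmul] at hm
  set ω := (A : K) * y₂ / y₁
  have hmem : ∀ x : K, (∃ y : NumberField.RingOfIntegers K, x = algebraMap _ K y) ↔
      ∃ a b : ℤ, x = a + b * ω := by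
    intro x
    have := hm.mem x
    simp only [mul_one] at this
    rw [← this, mem_ordLat]
    constructor
    · rintro ⟨y, rfl⟩
      exact ⟨0, y, by simp⟩
    · rintro ⟨a, y, rfl⟩
      exact ⟨a + y, by simp⟩
  obtain ⟨q, s, hqs⟩ : ∃ q s : ℤ, ω ^ 2 = q + s * ω := by
    rw [← hmem]
    obtain ⟨y, hy⟩ := (hmem ω).2 ⟨0, 1, by simp⟩
    exact ⟨y ^ 2, by rw [hy, map_pow]⟩
  refine ⟨ω, s, q, by rw [hqs]; ring, ?_, ?_⟩
  · intro m x
    constructor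
    · rintro ⟨a, y, rfl⟩
      obtain ⟨u, v, huv⟩ := (hmem _).1 ⟨y, rfl⟩
      refine ⟨a + m * u, v, ?_⟩
      rw [huv]; push_cast; ring
    · rintro ⟨a, b, rfl⟩
      obtain ⟨y, hy⟩ := (hmem (b * ω)).2 ⟨0, b, by simp⟩
      refine ⟨a, y, ?_⟩
      rw [← hy]; ring
  · intro a b e
    exact hm.ind a b (by simpa using e)

lemma IsOmega.isBas_ordLat {ω : K} {s q : ℤ} (h : IsOmega ω s q) {m : ℕ} (hm : 0 < m) :
    IsBas 1 (m * ω) (ordLat K m) := by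
  refine ⟨fun x => by simpa using h.mem m x, fun a b e => ?_⟩
  have := h.ind a (b * m) (by push_cast; linear_combination e)
  simpa [hm.ne'] using this

lemma isLat_ordLat {m : ℕ} (hm : 0 < m) : IsLat K (ordLat K m) := by
  obtain ⟨ω, s, q, h⟩ := exists_isOmega K
  exact (h.isBas_ordLat hm).isLat

lemma ordLat_le_iff {m n : ℕ} (hm : 0 < m) : ordLat K m ≤ ordLat K n ↔ n ∣ m := by
  obtain ⟨ω, s, q, h⟩ := exists_isOmega K
  constructor
  · intro hle
    obtain ⟨a, b, e⟩ := (h.mem n _).1 (hle ((h.mem m (m * ω)).2 ⟨0, 1, by simp⟩))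
    have := (h.ind a (b * n - m) (by push_cast; linear_combination -e)).2
    have h1 : (n : ℤ) ∣ m := ⟨b, by linarith⟩
    exact_mod_cast h1
  · rintro ⟨k, rfl⟩ x hx
    obtain ⟨a, b, rfl⟩ := (h.mem _ _).1 hx
    exact (h.mem _ _).2 ⟨a, b * k, by push_cast; ring⟩

lemma ordLat_inj {m n : ℕ} (hm : 0 < m) (hn : 0 < n) (h : ordLat K m = ordLat K n) : m = n :=
  Nat.dvd_antisymm ((ordLat_le_iff hn).1 h.ge) ((ordLat_le_iff hm).1 h.le)

lemma HasCond.unique {L : Submodule ℤ K} {c d : ℕ} (h : HasCond K L c) (h' : HasCond K L d) :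
    c = d := by
  rw [hasCond_iff] at h h'
  exact ordLat_inj h.1 h'.1 (h.2 ▸ h'.2)

/-- The generator attached to the form is, up to sign and integers, `c·ω`. -/
lemma IsForm.eq_omega {y₁ y₂ : K} {L : Submodule ℤ K} (h : IsBas y₁ y₂ L) {A B C : ℤ}
    (hf : IsForm y₁ y₂ A B C) {ω : K} {s q : ℤ} (hω : IsOmega ω s q) {c : ℕ}
    (hc : HasCond K L c) :
    ∃ k j : ℤ, j * j = 1 ∧ (c : K) * ω = k + j * (A * y₂ / y₁) := by
  rw [hasCond_iff] at hc
  have h1 := hf.isBas_multLat h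
  rw [hc.2] at h1
  have h2 := hω.isBas_ordLat hc.1
  obtain ⟨k, j, e⟩ := (h1.mem _).1 h2.right_mem
  obtain ⟨k', j', e'⟩ := (h2.mem _).1 h1.right_mem
  have := (h2.ext_coeff (a := 0) (b := 1) (a' := k + j * k') (b' := j * j') (by
    push_cast
    linear_combination e + j * e')).2
  rcases Int.eq_one_or_neg_one_of_mul_eq_one this.symm with rfl | rfl
  · exact ⟨k, 1, rfl, by simpa using e⟩
  · exact ⟨k, -1, rfl, by simpa using e⟩

lemma IsLat.exists_hasCond {L : Submodule ℤ K} (h : IsLat K L) : ∃ c, HasCond K L c := by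
  obtain ⟨y₁, y₂, hb⟩ := h.exists_isBas
  obtain ⟨A, B, C, hf⟩ := hb.exists_isForm
  obtain ⟨ω, s, q, hω⟩ := exists_isOmega K
  have hm := hf.isBas_multLat hb
  have hmem : (A * y₂ / y₁ : K) ∈ ordLat K 1 := by
    have : IsIntegral ℤ (A * y₂ / y₁ : K) := by
      refine ⟨Polynomial.X ^ 2 + Polynomial.C B * Polynomial.X + Polynomial.C (A * C), ?_, ?_⟩
      · rw [add_assoc]
        exact Polynomial.monic_X_pow_add (by
          compute_degree!)
      · have h1 := hb.left_ne
        simp only [Polynomial.eval₂_add, Polynomial.eval₂_mul, Polynomial.eval₂_X_pow,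
          Polynomial.eval₂_C, Polynomial.eval₂_X]
        simp only [eq_intCast]
        push_cast
        field_simp
        linear_combination (A : K) * hf.rel
    exact ⟨0, ⟨_, this⟩, by simp; rfl⟩
  obtain ⟨k, j, e⟩ := (hω.mem _ _).1 hmem
  have hj : j ≠ 0 := by
    rintro rfl
    have := hm.ind (-k) 1 (by push_cast; linear_combination e)
    simp at this
  have hj' : 0 < j.natAbs := Int.natAbs_pos.2 hj
  refine ⟨j.natAbs, hasCond_iff.2 ⟨hj', ?_⟩⟩
  ext x
  rw [hm.mem, hω.mem, e]
  rcases Int.natAbs_eq j with h | h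
  · have h2 : (j.natAbs : K) = j := by
      have : ((j.natAbs : ℤ) : K) = j := by exact_mod_cast congrArg (Int.cast : ℤ → K) h.symm
      simpa using this
    rw [h2]
    constructor
    · rintro ⟨a, b, rfl⟩; exact ⟨a + b * k, b, by push_cast; ring⟩
    · rintro ⟨a, b, rfl⟩; exact ⟨a - b * k, b, by push_cast; ring⟩
  · have h2 : (j.natAbs : K) = -j := by
      have h' : (j.natAbs : ℤ) = -j := by omega
      have : ((j.natAbs : ℤ) : K) = ((-j : ℤ) : K) := by rw [h']
      simpa using this
    rw [h2]
    constructor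
    · rintro ⟨a, b, rfl⟩; exact ⟨a + b * k, -b, by push_cast; ring⟩
    · rintro ⟨a, b, rfl⟩; exact ⟨a + b * k, -b, by push_cast; ring⟩

end

lemma smul_lat_mul (t : K) (L L' : Submodule ℤ K) : (t • L) * L' = t • (L * L') := by
  rw [← Submodule.span_singleton_mul, ← Submodule.span_singleton_mul, mul_assoc]

lemma mul_smul_lat (t : K) (L L' : Submodule ℤ K) : L * (t • L') = t • (L * L') := by
  rw [mul_comm, smul_lat_mul, mul_comm]

lemma mem_smul_lat {t x : K} {L : Submodule ℤ K} : x ∈ t • L ↔ ∃ y ∈ L, t * y = x := by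
  rw [Submodule.mem_smul_pointwise_iff_exists]; rfl

lemma smul_lat_le {t : K} {L L' : Submodule ℤ K} : t • L ≤ L' ↔ ∀ y ∈ L, t * y ∈ L' := by
  constructor
  · intro h y hy; exact h (mem_smul_lat.2 ⟨y, hy, rfl⟩)
  · rintro h x hx
    obtain ⟨y, hy, rfl⟩ := mem_smul_lat.1 hx
    exact h y hy

lemma mul_mem_smul_lat {t x : K} {L : Submodule ℤ K} (ht : t ≠ 0) : t * x ∈ t • L ↔ x ∈ L := by
  rw [mem_smul_lat]
  constructor
  · rintro ⟨y, hy, e⟩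
    rwa [← mul_left_cancel₀ ht e]
  · intro h; exact ⟨x, h, rfl⟩

section
variable [hK : Fact (Module.finrank ℚ K = 2)]

lemma mul_mem_ordLat {m : ℕ} {x y : K} (hx : x ∈ ordLat K m) (hy : y ∈ ordLat K m) :
    x * y ∈ ordLat K m := (orderSubring K m).mul_mem hx hy

lemma ordLat_le {m n : ℕ} (h : n ∣ m) : ordLat K m ≤ ordLat K n := by
  obtain ⟨ω, s, q, hω⟩ := exists_isOmega K
  obtain ⟨k, rfl⟩ := h
  intro x hx
  obtain ⟨a, b, rfl⟩ := (hω.mem _ _).1 hx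
  exact (hω.mem _ _).2 ⟨a, b * k, by push_cast; ring⟩

lemma ordLat_mul (a b : ℕ) : ordLat K a * ordLat K b = ordLat K (a.gcd b) := by
  apply le_antisymm
  · rw [Submodule.mul_le]
    intro x hx y hy
    exact mul_mem_ordLat (ordLat_le (Nat.gcd_dvd_left a b) hx) (ordLat_le (Nat.gcd_dvd_right a b) hy)
  · obtain ⟨ω, s, q, hω⟩ := exists_isOmega K
    intro x hx
    obtain ⟨u, v, rfl⟩ := (hω.mem _ _).1 hx
    have hg : ((a.gcd b : ℕ) : K) = a * (a.gcdA b : ℤ) + b * (a.gcdB b : ℤ) := by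
      have := Nat.gcd_eq_gcd_ab a b
      exact_mod_cast congrArg (Int.cast : ℤ → K) this
    have : (u : K) + v * ((a.gcd b : ℕ) * ω) =
        (u + (v * a.gcdA b : ℤ) * (a * ω)) * 1 + 1 * ((0 : ℤ) + (v * a.gcdB b : ℤ) * (b * ω)) := by
      rw [hg]; push_cast; ring
    rw [this]
    exact Submodule.add_mem _
      (Submodule.mul_mem_mul ((hω.mem _ _).2 ⟨_, _, rfl⟩) (one_mem_ordLat b))
      (Submodule.mul_mem_mul (one_mem_ordLat a) ((hω.mem _ _).2 ⟨_, _, rfl⟩))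

lemma ordLat_mul_self (a : ℕ) : ordLat K a * ordLat K a = ordLat K a := by
  rw [ordLat_mul, Nat.gcd_self]

lemma ordLat_inf (a b : ℕ) : ordLat K a ⊓ ordLat K b = ordLat K (a.lcm b) := by
  apply le_antisymm
  · obtain ⟨ω, s, q, hω⟩ := exists_isOmega K
    rintro x ⟨h1, h2⟩
    obtain ⟨u, v, rfl⟩ := (hω.mem _ _).1 h1
    obtain ⟨u', v', e⟩ := (hω.mem _ _).1 h2
    have h3 := (hω.ind (u - u') (v * a - v' * b) (by push_cast; linear_combination e)).2
    have h4 : ((a.lcm b : ℕ) : ℤ) ∣ v * a := by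
      have := Int.coe_lcm_dvd (Dvd.intro_left v rfl : (a : ℤ) ∣ v * a)
        (Dvd.intro_left v' (by linarith) : (b : ℤ) ∣ v * a)
      rwa [Int.lcm_natCast_natCast] at this
    obtain ⟨k, hk⟩ := h4
    refine (hω.mem _ _).2 ⟨u, k, ?_⟩
    have hk' : (v : K) * a = ((a.lcm b : ℕ) : K) * k := by exact_mod_cast congrArg (Int.cast : ℤ → K) hk
    linear_combination ω * hk'
  · exact le_inf (ordLat_le (Nat.dvd_lcm_left a b)) (ordLat_le (Nat.dvd_lcm_right a b))

/-- `L` is a lattice of conductor `c`. -/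
structure IsLC (L : Submodule ℤ K) (c : ℕ) : Prop where
  lat : IsLat K L
  cond : HasCond K L c

lemma IsLat.exists_isLC {L : Submodule ℤ K} (h : IsLat K L) : ∃ c, IsLC L c :=
  let ⟨c, hc⟩ := h.exists_hasCond
  ⟨c, h, hc⟩

lemma IsLC.pos {L : Submodule ℤ K} {c : ℕ} (h : IsLC L c) : 0 < c := h.cond.1

lemma IsLC.unique {L : Submodule ℤ K} {c d : ℕ} (h : IsLC L c) (h' : IsLC L d) : c = d :=
  h.cond.unique h'.cond

lemma IsLC.multLat_eq {L : Submodule ℤ K} {c : ℕ} (h : IsLC L c) : multLat K L = ordLat K c :=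
  (hasCond_iff.1 h.cond).2

lemma IsLC.mul_mem {L : Submodule ℤ K} {c : ℕ} (h : IsLC L c) {α x : K} (hα : α ∈ ordLat K c)
    (hx : x ∈ L) : α * x ∈ L := by
  rw [← h.multLat_eq] at hα
  exact hα x hx

lemma IsLC.ord_mul {L : Submodule ℤ K} {c : ℕ} (h : IsLC L c) : ordLat K c * L = L := by
  apply le_antisymm
  · rw [Submodule.mul_le]
    intro x hx y hy
    exact h.mul_mem hx hy
  · intro x hx
    rw [← one_mul x]
    exact Submodule.mul_mem_mul (one_mem_ordLat c) hx

lemma isBas_invLat {y₁ y₂ : K} {L : Submodule ℤ K} (h : IsBas y₁ y₂ L) {A B C : ℤ}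
    (hf : IsForm y₁ y₂ A B C) : IsBas (A / y₁) (C / y₂) (invLat K L) := by
  have hR := hf.isBas_multLat h
  have h1 := h.left_ne
  have h2 := h.right_ne
  have hrel := hf.rel
  have hB : (B : K) = -(A * y₂ / y₁) - C * y₁ / y₂ := by
    field_simp; linear_combination hrel
  constructor
  · intro x
    constructor
    · intro hx
      obtain ⟨a, b, e1⟩ := (hR.mem _).1 (hx y₁ h.left_mem)
      obtain ⟨c, d, e2⟩ := (hR.mem _).1 (hx y₂ h.right_mem)
      obtain ⟨p, q, r, hp⟩ := hf.prim
      have hp' : (p : K) * A + q * B + r * C = 1 := by exact_mod_cast congrArg (Int.cast : ℤ → K) hp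
      have key : ∀ u v : ℤ, ((u : K) * 1 + v * (A * y₂ / y₁)) * (A / y₁)
          = ((u - v * B : ℤ) : K) * (A / y₁) + ((-v * A : ℤ) : K) * (C / y₂) := by
        intro u v; push_cast; rw [hB]; field_simp; ring
      have key' : ∀ u v : ℤ, ((u : K) * 1 + v * (A * y₂ / y₁)) * (C / y₂)
          = ((v * C : ℤ) : K) * (A / y₁) + ((u : ℤ) : K) * (C / y₂) := by
        intro u v; push_cast; field_simp; ring
      have hx' : x = p * ((x * y₁) * (A / y₁)) + q * (-((x * y₂) * (A / y₁)) - (x * y₁) * (C / y₂))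
          + r * ((x * y₂) * (C / y₂)) := by
        calc x = x * (p * A + q * B + r * C) := by rw [hp', mul_one]
          _ = _ := by
            rw [hB]
            field_simp
      rw [e1, e2, key, key, key', key'] at hx'
      refine ⟨p * (a - b * B) + q * (-(c - d * B) - b * C) + r * (d * C),
        p * (-b * A) + q * (d * A - a) + r * c, ?_⟩
      rw [hx']
      push_cast
      ring
    · rintro ⟨a, b, rfl⟩ y hy
      obtain ⟨u, v, rfl⟩ := (h.mem y).1 hy
      refine (hR.mem _).2 ⟨a * u * A - b * u * B + b * v * C, a * v - b * u, ?_⟩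
      push_cast
      rw [hB]
      field_simp
      ring
  · intro a b e
    have := h.ind (b * C) (a * A) (by push_cast; field_simp at e; linear_combination e)
    have hA := hf.A_ne h
    have hC := hf.swap.A_ne h.swap
    simp_all

lemma IsLat.mul_invLat {L : Submodule ℤ K} (hL : IsLat K L) : L * invLat K L = multLat K L := by
  obtain ⟨y₁, y₂, h⟩ := hL.exists_isBas
  obtain ⟨A, B, C, hf⟩ := h.exists_isForm
  have hJ := isBas_invLat h hf
  have h1 := h.left_ne
  have h2 := h.right_ne
  apply le_antisymm
  · rw [Submodule.mul_le]
    intro x hx y hy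
    rw [mul_comm]; exact hy x hx
  · have hone : (1 : K) ∈ L * invLat K L := by
      obtain ⟨p, q, r, hp⟩ := hf.prim
      have hp' : (p : K) * A + q * B + r * C = 1 := by exact_mod_cast congrArg (Int.cast : ℤ → K) hp
      have hB : (B : K) = -(A * y₂ / y₁) - C * y₁ / y₂ := by
        field_simp; linear_combination hf.rel
      have : (1 : K) = p • (y₁ * (A / y₁)) + q • (-(y₂ * (A / y₁)) - y₁ * (C / y₂))
          + r • (y₂ * (C / y₂)) := by
        simp only [zsmul_eq_mul]
        rw [← hp', hB]; field_simp
      rw [this]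
      have m11 := Submodule.mul_mem_mul h.left_mem hJ.left_mem
      have m12 := Submodule.mul_mem_mul h.left_mem hJ.right_mem
      have m21 := Submodule.mul_mem_mul h.right_mem hJ.left_mem
      have m22 := Submodule.mul_mem_mul h.right_mem hJ.right_mem
      exact add_mem (add_mem (Submodule.smul_mem _ _ m11)
        (Submodule.smul_mem _ _ (sub_mem (neg_mem m21) m12))) (Submodule.smul_mem _ _ m22)
    intro x hx
    have h3 : multLat K L * (L * invLat K L) ≤ L * invLat K L := by
      rw [← mul_assoc]
      refine mul_le_mul' ?_ le_rfl
      rw [Submodule.mul_le]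
      exact fun a ha b hb => ha b hb
    rw [← mul_one x]
    exact h3 (Submodule.mul_mem_mul hx hone)

lemma IsLC.mul_inv {L : Submodule ℤ K} {c : ℕ} (h : IsLC L c) : L * invLat K L = ordLat K c := by
  rw [h.lat.mul_invLat, h.multLat_eq]

lemma IsLC.ord_mul_inv {L : Submodule ℤ K} {c : ℕ} (h : IsLC L c) :
    ordLat K c * invLat K L = invLat K L := by
  apply le_antisymm
  · rw [Submodule.mul_le]
    intro x hx y hy z hz
    rw [mul_assoc]
    rw [← h.multLat_eq] at hx
    exact mul_mem_multLat hx (hy z hz)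
  · intro x hx
    rw [← one_mul x]
    exact Submodule.mul_mem_mul (one_mem_ordLat c) hx

lemma isLC_of_mul_eq {L J : Submodule ℤ K} {c : ℕ} (hL : IsLat K L) (hc : 0 < c)
    (h1 : L * J = ordLat K c) (h2 : ordLat K c * L = L) : IsLC L c := by
  refine ⟨hL, hasCond_iff.2 ⟨hc, le_antisymm ?_ ?_⟩⟩
  · intro x hx
    have h3 : multLat K L * (L * J) ≤ L * J := by
      rw [← mul_assoc]
      refine mul_le_mul' ?_ le_rfl
      rw [Submodule.mul_le]
      exact fun a ha b hb => ha b hb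
    rw [h1] at h3
    rw [← mul_one x]
    exact h3 (Submodule.mul_mem_mul hx (one_mem_ordLat c))
  · intro x hx y hy
    rw [← h2]
    exact Submodule.mul_mem_mul hx hy

lemma isLC_ordLat {c : ℕ} (hc : 0 < c) : IsLC (ordLat K c) c :=
  isLC_of_mul_eq (isLat_ordLat hc) hc (ordLat_mul_self c) (ordLat_mul_self c)

lemma IsLat.mul {L L' : Submodule ℤ K} (h : IsLat K L) (h' : IsLat K L') : IsLat K (L * L') := by
  apply isLat_of_exists_mul_mem (h.1.mul h'.1)
  intro x
  obtain ⟨y, hy, hy0⟩ := h.exists_ne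
  obtain ⟨n, hn, hx⟩ := h'.exists_mul_mem (x / y)
  refine ⟨n, hn, ?_⟩
  have : (n : K) * x = y * (n * (x / y)) := by field_simp
  rw [this]
  exact Submodule.mul_mem_mul hy hx

lemma IsLC.mul {L L' : Submodule ℤ K} {c c' : ℕ} (h : IsLC L c) (h' : IsLC L' c') :
    IsLC (L * L') (c.gcd c') := by
  refine isLC_of_mul_eq (J := invLat K L * invLat K L') (h.lat.mul h'.lat)
    (Nat.gcd_pos_of_pos_left _ h.pos) ?_ ?_
  · rw [mul_mul_mul_comm, h.mul_inv, h'.mul_inv, ordLat_mul]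
  · rw [← ordLat_mul, mul_mul_mul_comm, h.ord_mul, h'.ord_mul]

lemma IsLC.inv {L : Submodule ℤ K} {c : ℕ} (h : IsLC L c) : IsLC (invLat K L) c := by
  refine isLC_of_mul_eq (J := L) ?_ h.pos (by rw [mul_comm, h.mul_inv]) h.ord_mul_inv
  obtain ⟨y₁, y₂, hb⟩ := h.lat.exists_isBas
  obtain ⟨A, B, C, hf⟩ := hb.exists_isForm
  exact (isBas_invLat hb hf).isLat

lemma IsLC.eq_invLat {L J : Submodule ℤ K} {c : ℕ} (h : IsLC L c) (h1 : L * J = ordLat K c)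
    (h2 : ordLat K c * J = J) : J = invLat K L := by
  rw [← h2, ← h.mul_inv, mul_comm L, mul_assoc, h1, mul_comm, h.ord_mul_inv]

lemma IsLC.inv_inv {L : Submodule ℤ K} {c : ℕ} (h : IsLC L c) : invLat K (invLat K L) = L :=
  (h.inv.eq_invLat (by rw [mul_comm, h.mul_inv]) h.ord_mul).symm

lemma IsLC.smul {L : Submodule ℤ K} {c : ℕ} (h : IsLC L c) {t : K} (ht : t ≠ 0) :
    IsLC (t • L) c := by
  refine isLC_of_mul_eq (J := t⁻¹ • invLat K L) ?_ h.pos ?_ ?_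
  · obtain ⟨y₁, y₂, hb⟩ := h.lat.exists_isBas
    exact (hb.smul ht).isLat
  · rw [smul_lat_mul, mul_smul_lat, smul_smul, mul_inv_cancel₀ ht, one_smul, h.mul_inv]
  · rw [mul_smul_lat, h.ord_mul]

lemma IsLC.invLat_smul {L : Submodule ℤ K} {c : ℕ} (h : IsLC L c) {t : K} (ht : t ≠ 0) :
    invLat K (t • L) = t⁻¹ • invLat K L := by
  refine ((h.smul ht).eq_invLat ?_ ?_).symm
  · rw [smul_lat_mul, mul_smul_lat, smul_smul, mul_inv_cancel₀ ht, one_smul, h.mul_inv]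
  · rw [mul_smul_lat, h.ord_mul_inv]

lemma IsLC.ord_mul_cond {L : Submodule ℤ K} {c b : ℕ} (h : IsLC L c) (hb : 0 < b) (hbc : b ∣ c) :
    IsLC (ordLat K b * L) b := by
  have := (isLC_ordLat (K := K) hb).mul h
  rwa [Nat.gcd_eq_left hbc] at this

lemma IsLC.dvd_of_le {L : Submodule ℤ K} {c m : ℕ} (h : IsLC L c) (hm : 0 < m)
    (H : ordLat K m ≤ multLat K L) : c ∣ m := by
  rw [h.multLat_eq, ordLat_le_iff hm] at H
  exact H

end

section
variable [hK : Fact (Module.finrank ℚ K = 2)]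

lemma smul_ordLat_le {c n : ℕ} {g : ℕ} (h : c = n * g) : (n : K) • ordLat K g ≤ ordLat K c := by
  obtain ⟨ω, s, q, hω⟩ := exists_isOmega K
  rw [smul_lat_le]
  intro y hy
  obtain ⟨a, b, rfl⟩ := (hω.mem _ _).1 hy
  exact (hω.mem _ _).2 ⟨n * a, b, by rw [h]; push_cast; ring⟩

lemma mem_smul_ordLat {c n g : ℕ} (h : c = n * g) (hg : 0 < g) {w : K}
    (hw : ∀ z ∈ ordLat K g, w * z ∈ ordLat K c) : w ∈ (n : K) • ordLat K g := by
  obtain ⟨ω, s, q, hω⟩ := exists_isOmega K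
  have h1 := hw 1 (one_mem_ordLat g)
  rw [mul_one] at h1
  obtain ⟨a, b, rfl⟩ := (hω.mem _ _).1 h1
  obtain ⟨u, v, e⟩ := (hω.mem _ _).1 (hw (g * ω) ((hω.mem _ _).2 ⟨0, 1, by simp⟩))
  have h2 := (hω.ind (b * c * g * q - u) (a * g + b * c * g * s - v * c) (by
    push_cast; linear_combination e - (b * c * g : K) * hω.rel)).2
  have h3 : (g : ℤ) * (n * (v - b * g * s)) = g * a := by
    rw [h] at h2; push_cast at h2; linarith
  have h4 := mul_left_cancel₀ (by exact_mod_cast hg.ne') h3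
  rw [mem_smul_lat]
  refine ⟨_, (hω.mem _ _).2 ⟨v - b * g * s, b, rfl⟩, ?_⟩
  rw [← h4, h]; push_cast; ring

lemma IsLC.invLat_mul {L L' : Submodule ℤ K} {c c' : ℕ} (h : IsLC L c) (h' : IsLC L' c') :
    invLat K (L * L') = invLat K L * invLat K L' :=
  ((h.mul h').eq_invLat (by rw [mul_mul_mul_comm, h.mul_inv, h'.mul_inv, ordLat_mul])
    (h.inv.mul h'.inv).ord_mul).symm

lemma colon_iff {L L' : Submodule ℤ K} {c c' : ℕ} (h : IsLC L c) (h' : IsLC L' c') (x : K) :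
    (∀ y ∈ L', x * y ∈ L) ↔ x ∈ ((c / c.gcd c' : ℕ) : K) • (L * invLat K L') := by
  have hg : 0 < c.gcd c' := Nat.gcd_pos_of_pos_left _ h.pos
  have hc : c = (c / c.gcd c') * c.gcd c' := (Nat.div_mul_cancel (Nat.gcd_dvd_left c c')).symm
  set g := c.gcd c' with hgdef
  set n := c / g
  constructor
  · intro H
    have hZ : IsLC (L' * invLat K L) g := by
      rw [hgdef, Nat.gcd_comm]; exact h'.mul h.inv
    have hinv : invLat K (L' * invLat K L) = L * invLat K L' := by
      rw [h'.invLat_mul h.inv, h.inv_inv, mul_comm]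
    have hle : x • (L' * invLat K L) ≤ ordLat K c := by
      rw [← smul_lat_mul, ← h.mul_inv]
      exact mul_le_mul' (smul_lat_le.2 H) le_rfl
    have hle' : x • (L' * invLat K L) ≤ (n : K) • ordLat K g := by
      rw [smul_lat_le]
      intro z hz
      refine mem_smul_ordLat hc hg fun y hy => ?_
      rw [mul_assoc, mul_comm z]
      exact smul_lat_le.1 hle _ (hZ.mul_mem hy hz)
    have hx : x ∈ x • ordLat K g := mem_smul_lat.2 ⟨1, one_mem_ordLat g, mul_one x⟩
    rw [← hZ.mul_inv, ← smul_lat_mul] at hx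
    have := mul_le_mul' hle' le_rfl hx
    rwa [smul_lat_mul, hZ.ord_mul_inv, hinv] at this
  · intro H y hy
    obtain ⟨w, hw, rfl⟩ := mem_smul_lat.1 H
    have h1 : w * y ∈ ordLat K g * L := by
      have := Submodule.mul_mem_mul hw hy
      rwa [mul_assoc, mul_comm (invLat K L'), h'.mul_inv, ← h.ord_mul, mul_assoc, mul_comm L,
        ← mul_assoc, ordLat_mul] at this
    have h2 : (n : K) * (w * y) ∈ ((n : K) • ordLat K g) * L := by
      rw [smul_lat_mul]; exact mem_smul_lat.2 ⟨_, h1, rfl⟩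
    rw [mul_assoc, ← h.ord_mul]
    exact mul_le_mul' (smul_ordLat_le hc) le_rfl h2

/-- A primitive binary quadratic form represents an integer coprime to `n`. -/
lemma exists_form_isCoprime {A B C : ℤ} (h : ∃ p q r : ℤ, p * A + q * B + r * C = 1) {n : ℕ}
    (hn : n ≠ 0) : ∃ u w : ℤ, IsCoprime (A * u ^ 2 - B * (u * w) + C * w ^ 2) (n : ℤ) := by
  classical
  obtain ⟨a, b, c, habc⟩ := h
  let U : Finset ℕ := n.primeFactors.filter fun p : ℕ => (p : ℤ) ∣ A ∧ ¬ (p : ℤ) ∣ C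
  let W : Finset ℕ := n.primeFactors.filter fun p : ℕ => ¬ (p : ℤ) ∣ A
  have key : ∀ (S : Finset ℕ) (p : ℕ), S ⊆ n.primeFactors → p.Prime →
      ((p : ℤ) ∣ ∏ i ∈ S, (i : ℤ) ↔ p ∈ S) := by
    intro S p hS hp
    rw [(Nat.prime_iff_prime_int.1 hp).dvd_finsetProd_iff]
    constructor
    · rintro ⟨i, hi, hpi⟩
      rw [Int.natCast_dvd_natCast, Nat.prime_dvd_prime_iff_eq hp
        (Nat.prime_of_mem_primeFactors (hS hi))] at hpi
      rwa [hpi]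
    · intro h; exact ⟨p, h, dvd_rfl⟩
  refine ⟨∏ i ∈ U, (i : ℤ), ∏ i ∈ W, (i : ℤ), ?_⟩
  set u := ∏ i ∈ U, (i : ℤ)
  set w := ∏ i ∈ W, (i : ℤ)
  rw [Int.isCoprime_iff_gcd_eq_one]
  by_contra hne
  obtain ⟨p, hp, hpd⟩ := Nat.exists_prime_and_dvd hne
  have hpZ := Nat.prime_iff_prime_int.1 hp
  have h1 : (p : ℤ) ∣ A * u ^ 2 - B * (u * w) + C * w ^ 2 :=
    (Int.natCast_dvd_natCast.2 hpd).trans (Int.gcd_dvd_left ..)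
  have h2 : p ∣ n := Int.natCast_dvd_natCast.1
    ((Int.natCast_dvd_natCast.2 hpd).trans (Int.gcd_dvd_right ..))
  have hpn : p ∈ n.primeFactors := Nat.mem_primeFactors.2 ⟨hp, h2, hn⟩
  have hu : (p : ℤ) ∣ u ↔ ((p : ℤ) ∣ A ∧ ¬ (p : ℤ) ∣ C) := by
    rw [key U p (Finset.filter_subset _ _) hp]; simp [U, hpn, - Nat.mem_primeFactors]
  have hw : (p : ℤ) ∣ w ↔ ¬ (p : ℤ) ∣ A := by
    rw [key W p (Finset.filter_subset _ _) hp]; simp [W, hpn, - Nat.mem_primeFactors]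
  by_cases hA : (p : ℤ) ∣ A
  · have hw' : ¬ (p : ℤ) ∣ w := by tauto
    by_cases hC : (p : ℤ) ∣ C
    · have hu' : ¬ (p : ℤ) ∣ u := by tauto
      have h3 : (p : ℤ) ∣ B * (u * w) := by
        have : B * (u * w) = A * u ^ 2 + C * w ^ 2 - (A * u ^ 2 - B * (u * w) + C * w ^ 2) := by
          ring
        rw [this]
        exact dvd_sub (dvd_add (hA.mul_right _) (hC.mul_right _)) h1
      have hB : (p : ℤ) ∣ B := by
        rcases hpZ.dvd_or_dvd h3 with h | h
        · exact h
        · rcases hpZ.dvd_or_dvd h with h | h <;> contradiction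
      apply hpZ.not_dvd_one
      rw [← habc]
      exact dvd_add (dvd_add (hA.mul_left _) (hB.mul_left _)) (hC.mul_left _)
    · have hu' : (p : ℤ) ∣ u := by tauto
      have h3 : (p : ℤ) ∣ C * w ^ 2 := by
        have : C * w ^ 2 = (A * u ^ 2 - B * (u * w) + C * w ^ 2) - u * (A * u - B * w) := by ring
        rw [this]
        exact dvd_sub h1 (hu'.mul_right _)
      rcases hpZ.dvd_or_dvd h3 with h | h
      · contradiction
      · exact hw' (hpZ.dvd_of_dvd_pow h)
  · have hw' : (p : ℤ) ∣ w := by tauto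
    have hu' : ¬ (p : ℤ) ∣ u := by tauto
    have h3 : (p : ℤ) ∣ A * u ^ 2 := by
      have : A * u ^ 2 = (A * u ^ 2 - B * (u * w) + C * w ^ 2) - w * (C * w - B * u) := by ring
      rw [this]
      exact dvd_sub h1 (hw'.mul_right _)
    rcases hpZ.dvd_or_dvd h3 with h | h
    · contradiction
    · exact hu' (hpZ.dvd_of_dvd_pow h)

lemma IsLC.exists_le_sup {L : Submodule ℤ K} {c : ℕ} (h : IsLC L c) {n : ℕ} (hn : n ≠ 0) :
    ∃ x ∈ L, L ≤ x • ordLat K c ⊔ (n : K) • L := by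
  obtain ⟨y₁, y₂, hb⟩ := h.lat.exists_isBas
  obtain ⟨A, B, C, hf⟩ := hb.exists_isForm
  have hR := hf.isBas_multLat hb
  rw [h.multLat_eq] at hR
  have h1 := hb.left_ne
  obtain ⟨u, w, p, q, hpq⟩ := exists_form_isCoprime hf.prim hn
  have hpq' : (p : K) * (A * u ^ 2 - B * (u * w) + C * w ^ 2) + q * n = 1 := by
    exact_mod_cast congrArg (Int.cast : ℤ → K) hpq
  refine ⟨u * y₁ + w * y₂, (hb.mem _).2 ⟨u, w, rfl⟩, ?_⟩
  rw [hb.le_iff]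
  have hrel := hf.rel
  constructor
  · rw [Submodule.mem_sup]
    refine ⟨_, mem_smul_lat.2 ⟨_, (hR.mem _).2 ⟨p * (u * A - w * B), -p * w, rfl⟩, rfl⟩, _,
      mem_smul_lat.2 ⟨_, (hb.mem _).2 ⟨q, 0, rfl⟩, rfl⟩, ?_⟩
    push_cast
    field_simp
    linear_combination y₁ ^ 2 * hpq' - p * w ^ 2 * hrel
  · rw [Submodule.mem_sup]
    refine ⟨_, mem_smul_lat.2 ⟨_, (hR.mem _).2 ⟨p * (w * C), p * u, rfl⟩, rfl⟩, _,
      mem_smul_lat.2 ⟨_, (hb.mem _).2 ⟨0, q, rfl⟩, rfl⟩, ?_⟩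
    push_cast
    field_simp
    linear_combination y₁ * y₂ * hpq' + p * u * w * hrel

end

lemma smul_lat_mono (t : K) {L L' : Submodule ℤ K} (h : L ≤ L') : t • L ≤ t • L' :=
  smul_lat_le.2 fun _ hy => mem_smul_lat.2 ⟨_, h hy, rfl⟩

lemma natCast_smul_le (n : ℕ) (L : Submodule ℤ K) : (n : K) • L ≤ L :=
  smul_lat_le.2 fun y hy => by
    have := L.smul_mem (n : ℤ) hy
    rwa [zsmul_eq_mul, Int.cast_natCast] at this

lemma mul_sup_lat (L M N : Submodule ℤ K) : L * (M ⊔ N) = L * M ⊔ L * N := Submodule.mul_sup L M N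

section
variable [hK : Fact (Module.finrank ℚ K = 2)]

lemma IsLC.exists_lift {L : Submodule ℤ K} {g : ℕ} (h : IsLC L g) {n : ℕ} (hn : 0 < n) :
    ∃ L', IsLC L' (g * n) ∧ ordLat K g * L' = L := by
  obtain ⟨ω, s, q, hω⟩ := exists_isOmega K
  obtain ⟨x, hx, hle⟩ := h.exists_le_sup hn.ne'
  have hn0 : (n : K) ≠ 0 := by exact_mod_cast hn.ne'
  set L' := x • ordLat K (g * n) ⊔ (n : K) • L with hL'
  have hgn : g * n = n * g := mul_comm _ _
  have hLL : L' ≤ L := sup_le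
    (smul_lat_le.2 fun y hy => by rw [mul_comm]; exact h.mul_mem (ordLat_le (Dvd.intro _ rfl) hy) hx)
    (natCast_smul_le n L)
  have hlat : IsLat K L' := (h.smul hn0).lat.of_le le_sup_right (h.lat.fg_of_le hLL)
  have hmul : ordLat K g * L' = L := by
    apply le_antisymm
    · calc ordLat K g * L' ≤ ordLat K g * L := mul_le_mul' le_rfl hLL
        _ = L := h.ord_mul
    · rw [hL', mul_sup_lat, mul_smul_lat, mul_smul_lat, h.ord_mul, ordLat_mul,
        Nat.gcd_eq_left (Dvd.intro _ rfl)]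
      exact hle
  obtain ⟨d, hd⟩ := hlat.exists_isLC
  refine ⟨L', ?_, hmul⟩
  have h1 : d ∣ g * n := by
    apply hd.dvd_of_le (Nat.mul_pos h.pos hn)
    intro α hα y hy
    obtain ⟨y₁, h1, y₂, h2, rfl⟩ := Submodule.mem_sup.1 hy
    obtain ⟨z, hz, rfl⟩ := mem_smul_lat.1 h1
    obtain ⟨w, hw, rfl⟩ := mem_smul_lat.1 h2
    refine Submodule.mem_sup.2 ⟨x * (α * z), mem_smul_lat.2 ⟨_, mul_mem_ordLat hα hz, rfl⟩,
      n * (α * w), mem_smul_lat.2 ⟨_, h.mul_mem (ordLat_le (Dvd.intro _ rfl) hα) hw, rfl⟩, by ring⟩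
  have hgd : g ∣ d := by
    have := (isLC_ordLat (K := K) h.pos).mul hd
    rw [hmul] at this
    rw [h.unique this]
    exact Nat.gcd_dvd_right _ _
  have hxL : x ∈ L' := Submodule.mem_sup_left (mem_smul_lat.2 ⟨1, one_mem_ordLat _, mul_one x⟩)
  have h3 : (d : K) * ω * x ∈ L' := hd.mul_mem ((hω.mem _ _).2 ⟨0, 1, by simp⟩) hxL
  obtain ⟨y₁, hy1, y₂, hy2, e⟩ := Submodule.mem_sup.1 h3
  obtain ⟨z, hz, rfl⟩ := mem_smul_lat.1 hy1
  obtain ⟨k, l, rfl⟩ := (hω.mem _ _).1 hz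
  have hgω : (g : K) * ω ∈ ordLat K g := (hω.mem _ _).2 ⟨0, 1, by simp⟩
  have h4 : (d * ω - k) * x ∈ (n : K) • L := by
    have : (d * ω - k) * x = n * (l * ((g * ω) * x)) + y₂ := by
      rw [sub_mul, ← e]; push_cast; ring
    rw [this]
    refine add_mem (mem_smul_lat.2 ⟨_, ?_, rfl⟩) hy2
    rw [← zsmul_eq_mul]
    exact L.smul_mem _ (h.mul_mem hgω hx)
  have h5 : (n : K)⁻¹ * (d * ω - k) ∈ multLat K L := by
    intro y hy
    obtain ⟨y₁, h1, y₂, h2, rfl⟩ := Submodule.mem_sup.1 (hle hy)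
    obtain ⟨z, hz, rfl⟩ := mem_smul_lat.1 h1
    obtain ⟨w, hw, rfl⟩ := mem_smul_lat.1 h2
    obtain ⟨v, hv, e'⟩ := mem_smul_lat.1 h4
    have : (n : K)⁻¹ * (d * ω - k) * (x * z + n * w) = z * v + (d * ω - k) * w := by
      have : (n : K)⁻¹ * (d * ω - k) * (x * z + n * w) =
        (n : K)⁻¹ * (((d * ω - k) * x) * z) + (n : K)⁻¹ * n * ((d * ω - k) * w) := by ring
      rw [this, ← e', inv_mul_cancel₀ hn0]; field_simp
    rw [this]
    refine add_mem (h.mul_mem hz hv) (h.mul_mem ?_ hw)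
    obtain ⟨m, rfl⟩ := hgd
    exact (hω.mem _ _).2 ⟨-k, m, by push_cast; ring⟩
  rw [h.multLat_eq] at h5
  obtain ⟨a, b, e'⟩ := (hω.mem _ _).1 h5
  have h6 := (hω.ind (k + n * a) (n * b * g - d) (by
    push_cast; field_simp at e'; linear_combination -e')).2
  have h7 : g * n ∣ d := Int.natCast_dvd_natCast.1 ⟨b, by push_cast; linarith⟩
  rwa [Nat.dvd_antisymm h1 h7] at hd

lemma smul_ord_mul_le {L : Submodule ℤ K} {b g n : ℕ} (hb : b = n * g) :
    (n : K) • (ordLat K g * L) ≤ ordLat K b * L := by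
  rw [← smul_lat_mul]
  exact mul_le_mul' (smul_ordLat_le hb) le_rfl

lemma ord_mul_inf_aux {𝔟 𝔠 : Submodule ℤ K} {g n n' : ℕ} (h : IsLC 𝔟 (n * g))
    (h' : IsLC 𝔠 (n' * g)) (hn : n.Coprime n') (e : ordLat K g * 𝔟 = ordLat K g * 𝔠) :
    ordLat K (n * g) * (𝔟 ⊓ 𝔠) = 𝔟 := by
  have hg := isLC_ordLat (K := K) (Nat.pos_of_mul_pos_left h.pos)
  set L := ordLat K g * 𝔟
  have h1 : (n : K) • L ≤ 𝔟 := (smul_ord_mul_le rfl).trans h.ord_mul.le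
  have h2 : (n' : K) • L ≤ 𝔠 := by rw [e]; exact (smul_ord_mul_le rfl).trans h'.ord_mul.le
  have le1 : ∀ M : Submodule ℤ K, M ≤ ordLat K g * M := fun M x hx => by
    rw [← one_mul x]; exact Submodule.mul_mem_mul (one_mem_ordLat g) hx
  have h3 : (n' : K) • 𝔟 ≤ 𝔟 ⊓ 𝔠 :=
    le_inf (natCast_smul_le _ _) ((smul_lat_mono _ (le1 𝔟)).trans h2)
  have h4 : (n : K) • 𝔠 ≤ 𝔟 ⊓ 𝔠 :=
    le_inf ((smul_lat_mono _ ((le1 𝔠).trans e.ge)).trans h1) (natCast_smul_le _ _)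
  have hpq : (n : K) * (n.gcdA n' : ℤ) + n' * (n.gcdB n' : ℤ) = 1 := by
    have := Nat.gcd_eq_gcd_ab n n'
    rw [hn] at this
    exact_mod_cast congrArg (Int.cast : ℤ → K) this.symm
  have split : ∀ (M : Submodule ℤ K) (x : K), (n : K) * x ∈ M → (n' : K) * x ∈ M → x ∈ M := by
    intro M x hx hx'
    have := M.add_mem (M.smul_mem (n.gcdA n') hx) (M.smul_mem (n.gcdB n') hx')
    rw [zsmul_eq_mul, zsmul_eq_mul] at this
    convert this using 1
    linear_combination -x * hpq
  have h5 : L ≤ ordLat K g * (𝔟 ⊓ 𝔠) := by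
    intro x hx
    apply split
    · have : (n : K) * x ∈ (n : K) • L := mem_smul_lat.2 ⟨_, hx, rfl⟩
      rw [e, ← mul_smul_lat] at this
      exact mul_le_mul' le_rfl h4 this
    · have : (n' : K) * x ∈ (n' : K) • L := mem_smul_lat.2 ⟨_, hx, rfl⟩
      rw [← mul_smul_lat] at this
      exact mul_le_mul' le_rfl h3 this
  apply le_antisymm
  · calc ordLat K (n * g) * (𝔟 ⊓ 𝔠) ≤ ordLat K (n * g) * 𝔟 := mul_le_mul' le_rfl inf_le_left
      _ = 𝔟 := h.ord_mul
  · intro x hx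
    apply split
    · have : (n : K) * x ∈ (n : K) • (ordLat K g * (𝔟 ⊓ 𝔠)) :=
        mem_smul_lat.2 ⟨_, h5 (le1 _ hx), rfl⟩
      exact smul_ord_mul_le rfl this
    · rw [← one_mul ((n' : K) * x)]
      exact Submodule.mul_mem_mul (one_mem_ordLat _) (h3 (mem_smul_lat.2 ⟨_, hx, rfl⟩))

lemma gcd_parts {b b' : ℕ} (hb : 0 < b) : ∃ n n', n.Coprime n' ∧ b = n * b.gcd b' ∧
    b' = n' * b.gcd b' :=
  ⟨b / b.gcd b', b' / b.gcd b', Nat.coprime_div_gcd_div_gcd (Nat.gcd_pos_of_pos_left _ hb),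
    (Nat.div_mul_cancel (Nat.gcd_dvd_left _ _)).symm,
    (Nat.div_mul_cancel (Nat.gcd_dvd_right _ _)).symm⟩

lemma IsLC.ord_mul_inf {𝔟 𝔠 : Submodule ℤ K} {b b' : ℕ} (h : IsLC 𝔟 b)
    (h' : IsLC 𝔠 b') (e : ordLat K (b.gcd b') * 𝔟 = ordLat K (b.gcd b') * 𝔠) :
    ordLat K b * (𝔟 ⊓ 𝔠) = 𝔟 := by
  obtain ⟨n, n', hn, e1, e2⟩ := gcd_parts (b' := b') h.pos
  have := ord_mul_inf_aux (e1 ▸ h) (e2 ▸ h') hn e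
  rwa [← e1] at this

lemma IsLC.inf {𝔟 𝔠 : Submodule ℤ K} {b b' : ℕ} (h : IsLC 𝔟 b)
    (h' : IsLC 𝔠 b') (e : ordLat K (b.gcd b') * 𝔟 = ordLat K (b.gcd b') * 𝔠) :
    IsLC (𝔟 ⊓ 𝔠) (b.lcm b') := by
  have h1 := h.ord_mul_inf h' e
  have h2 := h'.ord_mul_inf h (by rw [Nat.gcd_comm, e])
  rw [inf_comm] at h2
  have hlat : IsLat K (𝔟 ⊓ 𝔠) := by
    apply isLat_of_exists_mul_mem (h.lat.fg_of_le inf_le_left)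
    intro x
    obtain ⟨n, hn, hx⟩ := h.lat.exists_mul_mem x
    obtain ⟨m, hm, hy⟩ := h'.lat.exists_mul_mem x
    refine ⟨m * n, mul_ne_zero hm hn, ?_, ?_⟩
    · have := 𝔟.smul_mem m hx
      rw [zsmul_eq_mul] at this
      push_cast; rwa [mul_assoc]
    · have := 𝔠.smul_mem n hy
      rw [zsmul_eq_mul] at this
      push_cast; rwa [mul_comm (m : K), mul_assoc]
  obtain ⟨d, hd⟩ := hlat.exists_isLC
  have d1 : d ∣ b.lcm b' := by
    apply hd.dvd_of_le (Nat.lcm_pos h.pos h'.pos)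
    rw [← ordLat_inf]
    rintro α ⟨ha, ha'⟩ x ⟨hx, hx'⟩
    exact ⟨h.mul_mem ha hx, h'.mul_mem ha' hx'⟩
  have d2 : b ∣ d := by
    have := (isLC_ordLat (K := K) h.pos).mul hd
    rw [h1] at this
    rw [h.unique this]; exact Nat.gcd_dvd_right _ _
  have d3 : b' ∣ d := by
    have := (isLC_ordLat (K := K) h'.pos).mul hd
    rw [h2] at this
    rw [h'.unique this]; exact Nat.gcd_dvd_right _ _
  rwa [Nat.dvd_antisymm d1 (Nat.lcm_dvd d2 d3)] at hd

lemma IsLC.inf_ord_mul {L : Submodule ℤ K} {b b' : ℕ} (h : IsLC L (b.lcm b')) :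
    ordLat K b * L ⊓ ordLat K b' * L = L := by
  apply le_antisymm
  · rintro x ⟨hx, hx'⟩
    have h1 : x • invLat K L ≤ ordLat K (b.lcm b') := by
      rw [← ordLat_inf, smul_lat_le]
      intro y hy
      constructor
      · have := Submodule.mul_mem_mul hx hy
        rwa [mul_assoc, h.mul_inv, ordLat_mul, Nat.gcd_eq_left (Nat.dvd_lcm_left b b')] at this
      · have := Submodule.mul_mem_mul hx' hy
        rwa [mul_assoc, h.mul_inv, ordLat_mul, Nat.gcd_eq_left (Nat.dvd_lcm_right b b')] at this
    have hx : x ∈ x • ordLat K (b.lcm b') := mem_smul_lat.2 ⟨1, one_mem_ordLat _, mul_one x⟩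
    rw [← h.mul_inv, mul_comm, ← smul_lat_mul] at hx
    have := mul_le_mul' h1 (le_refl L) hx
    rwa [h.ord_mul] at this
  · refine le_inf ?_ ?_ <;>
    · intro x hx
      rw [← one_mul x]; exact Submodule.mul_mem_mul (one_mem_ordLat _) hx

end

/-- A correspondence between two sets that matches two relations, one of which is an equivalence,
identifies the quotients. -/
lemma nonempty_quot_equiv {X A : Type*} {r : X → X → Prop} {s : A → A → Prop} (hs : Equivalence s)
    (R : X → A → Prop) (hl : ∀ x, ∃ a, R x a) (hr : ∀ a, ∃ x, R x a)
    (H : ∀ x y a a', R x a → R y a' → (r x y ↔ s a a')) : Nonempty (Quot r ≃ Quot s) := by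
  choose F hF using hl
  let φ : Quot r → Quot s := Quot.lift (fun x => Quot.mk s (F x)) fun x y h =>
    Quot.sound ((H x y _ _ (hF x) (hF y)).1 h)
  refine ⟨Equiv.ofBijective φ ⟨?_, ?_⟩⟩
  · rintro ⟨x⟩ ⟨y⟩ h
    exact Quot.sound ((H x y _ _ (hF x) (hF y)).2 ((hs.quot_mk_eq_iff _ _).1 h))
  · rintro ⟨a⟩
    obtain ⟨x, hx⟩ := hr a
    refine ⟨Quot.mk r x, Quot.sound ?_⟩
    exact (H x x _ _ (hF x) hx).1 ((H x x _ _ hx hx).2 (hs.refl a))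

section
variable [hK : Fact (Module.finrank ℚ K = 2)]

/-- Homothety of lattices of conductor `ℓ`. -/
def Homothetic (ℓ : ℕ) (L L' : {L : Submodule ℤ K // IsLC L ℓ}) : Prop :=
  ∃ t : K, t ≠ 0 ∧ L'.1 = t • L.1

lemma homothetic_equivalence (ℓ : ℕ) : Equivalence (Homothetic (K := K) ℓ) where
  refl L := ⟨1, one_ne_zero, (one_smul _ _).symm⟩
  symm := by
    rintro L L' ⟨t, ht, e⟩
    exact ⟨t⁻¹, inv_ne_zero ht, by rw [e, smul_smul, inv_mul_cancel₀ ht, one_smul]⟩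
  trans := by
    rintro L L' L'' ⟨t, ht, e⟩ ⟨t', ht', e'⟩
    exact ⟨t' * t, mul_ne_zero ht' ht, by rw [e', e, smul_smul]⟩

/-- Homothety classes of lattices of conductor `ℓ`. -/
def LatClass (K : Type) [Field K] [NumberField K] [Fact (Module.finrank ℚ K = 2)] (ℓ : ℕ) : Type :=
  Quot (Homothetic (K := K) ℓ)

open FractionalIdeal in
lemma nonempty_latClass_equiv {ℓ : ℕ} (hℓ : 0 < ℓ) (R : Type*) [CommRing R] [IsDomain R]
    [Algebra R K] [IsFractionRing R K]
    (hR : ∀ x : K, (∃ r : R, algebraMap R K r = x) ↔ x ∈ ordLat K ℓ) :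
    Nonempty (LatClass K ℓ ≃ ClassGroup R) := by
  have hsm : ∀ (r : R) {L : Submodule ℤ K}, IsLC L ℓ → ∀ {x}, x ∈ L → r • x ∈ L := by
    intro r L hL x hx
    rw [Algebra.smul_def]
    exact hL.mul_mem ((hR _).1 ⟨r, rfl⟩) hx
  let toR : ∀ L : Submodule ℤ K, IsLC L ℓ → Submodule R K := fun L hL =>
    { carrier := L, add_mem' := L.add_mem, zero_mem' := L.zero_mem,
      smul_mem' := fun r x hx => hsm r hL hx }
  have hmul : ∀ L (hL : IsLC L ℓ), toR L hL * toR (invLat K L) hL.inv = 1 := by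
    intro L hL
    apply le_antisymm
    · rw [Submodule.mul_le]
      intro x hx y hy
      rw [Submodule.mem_one]
      apply (hR _).2
      rw [← hL.mul_inv]
      exact Submodule.mul_mem_mul hx hy
    · rw [Submodule.one_le]
      have : (1 : K) ∈ L * invLat K L := by rw [hL.mul_inv]; exact one_mem_ordLat ℓ
      refine Submodule.mul_induction_on this ?_ ?_
      · intro x hx y hy; exact Submodule.mul_mem_mul hx hy
      · intro x y hx hy; exact add_mem hx hy
  have hlat : ∀ I J : FractionalIdeal (nonZeroDivisors R) K, I * J = 1 →
      IsLC ((I : Submodule R K).restrictScalars ℤ) ℓ := by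
    intro I J hIJ
    set L : Submodule ℤ K := (I : Submodule R K).restrictScalars ℤ with hL
    have hmem : ∀ x, x ∈ L ↔ x ∈ I := fun x => Iff.rfl
    have hord : ∀ (I : FractionalIdeal (nonZeroDivisors R) K) {α x : K}, α ∈ ordLat K ℓ → x ∈ I → α * x ∈ I := by
      intro I α x hα hx
      obtain ⟨r, rfl⟩ := (hR _).2 hα
      rw [← Algebra.smul_def]
      exact (I : Submodule R K).smul_mem r hx
    have hI0 : ∃ x ∈ I, x ≠ 0 := by
      by_contra! hne
      have : I = 0 := FractionalIdeal.eq_zero_iff.2 hne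
      rw [this, zero_mul] at hIJ
      exact zero_ne_one hIJ
    obtain ⟨x, hx, hx0⟩ := hI0
    have hJ0 : ∃ x ∈ J, x ≠ 0 := by
      by_contra! hne
      have : J = 0 := FractionalIdeal.eq_zero_iff.2 hne
      rw [this, mul_zero] at hIJ
      exact zero_ne_one hIJ
    obtain ⟨y, hy, hy0⟩ := hJ0
    have hone : ∀ u, u ∈ I → ∀ v, v ∈ J → u * v ∈ ordLat K ℓ := by
      intro u hu v hv
      have := FractionalIdeal.mul_mem_mul hu hv
      rw [hIJ, FractionalIdeal.mem_one_iff] at this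
      exact (hR _).1 this
    have hlt : IsLat K L := by
      refine ((isLC_ordLat (K := K) hℓ).smul hx0).lat.of_le ?_
        (((isLC_ordLat (K := K) hℓ).smul (inv_ne_zero hy0)).lat.fg_of_le ?_)
      · rw [smul_lat_le]
        intro z hz
        rw [mul_comm]; exact hord I hz hx
      · intro z hz
        exact mem_smul_lat.2 ⟨z * y, hone z hz y hy, by field_simp⟩
    refine isLC_of_mul_eq (J := (J : Submodule R K).restrictScalars ℤ) hlt hℓ ?_ ?_
    · apply le_antisymm
      · rw [Submodule.mul_le]
        intro u hu v hv
        exact hone u hu v hv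
      · have h1 : (1 : K) ∈ L * (J : Submodule R K).restrictScalars ℤ := by
          have : (1 : K) ∈ I * J := by rw [hIJ]; exact FractionalIdeal.one_mem_one _
          refine FractionalIdeal.mul_induction_on this ?_ ?_
          · intro u hu v hv; exact Submodule.mul_mem_mul hu hv
          · intro u v hu hv; exact add_mem hu hv
        intro α hα
        have h2 : ordLat K ℓ * (L * (J : Submodule R K).restrictScalars ℤ) ≤
            L * (J : Submodule R K).restrictScalars ℤ := by
          rw [← mul_assoc]
          refine mul_le_mul' ?_ le_rfl
          rw [Submodule.mul_le]
          exact fun a ha b hb => hord I ha hb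
        rw [← mul_one α]
        exact h2 (Submodule.mul_mem_mul hα h1)
    · apply le_antisymm
      · rw [Submodule.mul_le]
        exact fun a ha b hb => hord I ha hb
      · intro u hu
        rw [← one_mul u]; exact Submodule.mul_mem_mul (one_mem_ordLat ℓ) hu
  obtain ⟨e⟩ := nonempty_quot_equiv (r := Homothetic (K := K) ℓ)
    (s := (QuotientGroup.leftRel (toPrincipalIdeal R K).range).r)
    (QuotientGroup.leftRel (toPrincipalIdeal R K).range).iseqv
    (fun L I => ∀ x : K, x ∈ L.1 ↔ x ∈ (I : FractionalIdeal (nonZeroDivisors R) K))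
    (by
      rintro ⟨L, hL⟩
      let U : (Submodule R K)ˣ := ⟨toR L hL, toR (invLat K L) hL.inv, hmul L hL, by
        rw [mul_comm]; exact hmul L hL⟩
      exact ⟨unitsMulEquivSubmodule.symm U, fun x => Iff.rfl⟩)
    (by
      intro I
      exact ⟨⟨_, hlat I.1 I.2 I.3⟩, fun x => Iff.rfl⟩)
    (by
      rintro ⟨L, hL⟩ ⟨L', hL'⟩ I I' h h'
      rw [QuotientGroup.leftRel_apply]
      dsimp only at h h'
      have key : ∀ t : K, L' = t • L ↔ spanSingleton _ t * I.1 = I'.1 := by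
        intro t
        constructor
        · rintro rfl
          ext x
          rw [FractionalIdeal.mem_singleton_mul, ← h', mem_smul_lat]
          constructor
          · rintro ⟨y, hy, rfl⟩; exact ⟨y, (h y).2 hy, rfl⟩
          · rintro ⟨y, hy, rfl⟩; exact ⟨y, (h y).1 hy, rfl⟩
        · intro e
          ext x
          rw [h', ← e, FractionalIdeal.mem_singleton_mul, mem_smul_lat]
          constructor
          · rintro ⟨y, hy, rfl⟩; exact ⟨y, (h y).2 hy, rfl⟩
          · rintro ⟨y, hy, rfl⟩; exact ⟨y, (h y).1 hy, rfl⟩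
      constructor
      · rintro ⟨t, ht, e⟩
        refine ⟨Units.mk0 t ht, ?_⟩
        rw [eq_inv_mul_iff_mul_eq]
        apply Units.ext
        rw [Units.val_mul, coe_toPrincipalIdeal, mul_comm]
        exact (key t).1 e
      · rintro ⟨t, e⟩
        refine ⟨t, t.ne_zero, (key t).2 ?_⟩
        rw [eq_inv_mul_iff_mul_eq] at e
        rw [← e, Units.val_mul, coe_toPrincipalIdeal, mul_comm])
  exact ⟨e.trans (ClassGroup.equiv K).symm.toEquiv⟩

lemma isFractionRing_orderSubring {ℓ : ℕ} (hℓ : 0 < ℓ) : IsFractionRing (orderSubring K ℓ) K := by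
  apply IsFractionRing.of_field
  intro z
  obtain ⟨n, hn, h⟩ := (isLat_ordLat (K := K) hℓ).exists_mul_mem z
  refine ⟨⟨_, h⟩, (n : orderSubring K ℓ), ?_⟩
  rw [map_intCast]
  change z = (n * z) / n
  have : (n : K) ≠ 0 := by exact_mod_cast hn
  field_simp

lemma card_classGroup {ℓ : ℕ} (hℓ : 0 < ℓ) :
    Nat.card (ClassGroup (orderSubring K ℓ)) = Nat.card (LatClass K ℓ) := by
  have := isFractionRing_orderSubring (K := K) hℓ
  obtain ⟨e⟩ := nonempty_latClass_equiv (K := K) hℓ (orderSubring K ℓ) (fun x => by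
    constructor
    · rintro ⟨r, rfl⟩; exact r.2
    · intro hx; exact ⟨⟨x, hx⟩, rfl⟩)
  exact (Nat.card_congr e).symm

lemma finite_latClass_one : Finite (LatClass K 1) := by
  obtain ⟨e⟩ := nonempty_latClass_equiv (K := K) one_pos (NumberField.RingOfIntegers K) (fun x => by
    rw [mem_ordLat]
    constructor
    · rintro ⟨r, rfl⟩; exact ⟨0, r, by simp⟩
    · rintro ⟨a, y, rfl⟩; exact ⟨a + y, by simp⟩)
  exact Finite.of_equiv _ e.symm

lemma IsLat.finite_between {L : Submodule ℤ K} (h : IsLat K L) {n : ℕ} (hn : n ≠ 0) :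
    Finite {L' : Submodule ℤ K // (n : K) • L ≤ L' ∧ L' ≤ L} := by
  obtain ⟨y₁, y₂, hb⟩ := h.exists_isBas
  let φ : {L' : Submodule ℤ K // (n : K) • L ≤ L' ∧ L' ≤ L} → Set (Fin n × Fin n) := fun L' =>
    {p | ((p.1 : ℕ) : K) * y₁ + ((p.2 : ℕ) : K) * y₂ ∈ L'.1}
  have key : ∀ L₁ L₂ : {L' : Submodule ℤ K // (n : K) • L ≤ L' ∧ L' ≤ L}, φ L₁ = φ L₂ →
      L₁.1 ≤ L₂.1 := by
    intro L₁ L₂ e x hx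
    obtain ⟨a, b, rfl⟩ := (hb.mem x).1 (L₁.2.2 hx)
    have hn' : (n : ℤ) ≠ 0 := by exact_mod_cast hn
    have ha := Int.emod_nonneg a hn'
    have hb' := Int.emod_nonneg b hn'
    have ha2 := Int.emod_lt_of_pos a (by omega : (0 : ℤ) < n)
    have hb2 := Int.emod_lt_of_pos b (by omega : (0 : ℤ) < n)
    have hz : (n : K) * (((a / n : ℤ) : K) * y₁ + ((b / n : ℤ) : K) * y₂) ∈ (n : K) • L :=
      mem_smul_lat.2 ⟨_, (hb.mem _).2 ⟨_, _, rfl⟩, rfl⟩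
    have hsplit : (a : K) * y₁ + b * y₂ =
        (((a % n : ℤ) : K) * y₁ + ((b % n : ℤ) : K) * y₂) +
          (n : K) * (((a / n : ℤ) : K) * y₁ + ((b / n : ℤ) : K) * y₂) := by
      have h1 : (a : K) = ((a % n : ℤ) : K) + n * ((a / n : ℤ) : K) := by
        exact_mod_cast congrArg (Int.cast : ℤ → K) (Int.emod_add_mul_ediv a n).symm
      have h2 : (b : K) = ((b % n : ℤ) : K) + n * ((b / n : ℤ) : K) := by
        exact_mod_cast congrArg (Int.cast : ℤ → K) (Int.emod_add_mul_ediv b n).symm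
      rw [h1, h2]; ring
    rw [hsplit] at hx ⊢
    refine add_mem ?_ (L₂.2.1 hz)
    have hx' := (Submodule.add_mem_iff_left _ (L₁.2.1 hz)).1 hx
    let p : Fin n × Fin n := (⟨(a % n).toNat, by omega⟩, ⟨(b % n).toNat, by omega⟩)
    have hc1 : (((a % n).toNat : ℕ) : K) = ((a % n : ℤ) : K) := by
      exact_mod_cast congrArg (Int.cast : ℤ → K) (Int.toNat_of_nonneg ha)
    have hc2 : (((b % n).toNat : ℕ) : K) = ((b % n : ℤ) : K) := by
      exact_mod_cast congrArg (Int.cast : ℤ → K) (Int.toNat_of_nonneg hb')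
    have hp : p ∈ φ L₁ := by
      change (((a % n).toNat : ℕ) : K) * y₁ + (((b % n).toNat : ℕ) : K) * y₂ ∈ L₁.1
      rw [hc1, hc2]; exact hx'
    rw [e] at hp
    change (((a % n).toNat : ℕ) : K) * y₁ + (((b % n).toNat : ℕ) : K) * y₂ ∈ L₂.1 at hp
    rwa [hc1, hc2] at hp
  exact Finite.of_injective φ fun L₁ L₂ e =>
    Subtype.ext (le_antisymm (key _ _ e) (key _ _ e.symm))

lemma finite_latClass {ℓ : ℕ} (hℓ : 0 < ℓ) : Finite (LatClass K ℓ) := by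
  have := finite_latClass_one (K := K)
  let Y := Σ C : LatClass K 1, {L' : Submodule ℤ K // (ℓ : K) • C.out.1 ≤ L' ∧ L' ≤ C.out.1}
  have : ∀ C : LatClass K 1,
      Finite {L' : Submodule ℤ K // (ℓ : K) • C.out.1 ≤ L' ∧ L' ≤ C.out.1} := fun C =>
    C.out.2.lat.finite_between hℓ.ne'
  have hex : ∀ C : LatClass K ℓ, ∃ (y : Y) (h : IsLC y.2.1 ℓ), Quot.mk _ ⟨y.2.1, h⟩ = C := by
    rintro ⟨L, hL⟩
    have h1 := hL.ord_mul_cond one_pos (one_dvd _)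
    let C : LatClass K 1 := Quot.mk _ ⟨_, h1⟩
    have h2 : Homothetic 1 ⟨_, h1⟩ C.out :=
      ((homothetic_equivalence 1).quot_mk_eq_iff _ _).1 (Quot.out_eq C).symm
    obtain ⟨t, ht, e⟩ := h2
    dsimp only at e
    refine ⟨⟨C, t • L, ?_, ?_⟩, hL.smul ht, ?_⟩
    · rw [e, smul_smul, mul_comm, ← smul_smul]
      exact smul_lat_mono t ((smul_ord_mul_le (by simp)).trans hL.ord_mul.le)
    · rw [e]
      apply smul_lat_mono
      intro x hx
      rw [← one_mul x]; exact Submodule.mul_mem_mul (one_mem_ordLat _) hx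
    · exact Quot.sound ⟨t⁻¹, inv_ne_zero ht, by
        rw [smul_smul, inv_mul_cancel₀ ht, one_smul]⟩
  choose F hF hF' using hex
  refine Finite.of_injective F fun C C' e => ?_
  rw [← hF' C, ← hF' C']
  congr 1
  exact Subtype.ext (congrArg (fun y : Y => y.2.1) e)

end

lemma smul_lat_inf {t : K} (ht : t ≠ 0) (L L' : Submodule ℤ K) :
    t • (L ⊓ L') = t • L ⊓ t • L' := by
  ext x
  have : x = t * (t⁻¹ * x) := by field_simp
  rw [this, Submodule.mem_inf, mul_mem_smul_lat ht, mul_mem_smul_lat ht, mul_mem_smul_lat ht,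
    Submodule.mem_inf]

section
variable [hK : Fact (Module.finrank ℚ K = 2)]

/-- Pairs of lattices of conductors `b`, `b'` with product `L`. -/
def PairLat (b b' : ℕ) (L : Submodule ℤ K) : Type :=
  {p : Submodule ℤ K × Submodule ℤ K // IsLC p.1 b ∧ IsLC p.2 b' ∧ p.1 * p.2 = L}

/-- The relation of differing by the antidiagonal action of `Kˣ`. -/
def PairRel (b b' : ℕ) (L : Submodule ℤ K) (p q : PairLat b b' L) : Prop :=
  ∃ t : K, t ≠ 0 ∧ q.1.1 = t • p.1.1 ∧ q.1.2 = t⁻¹ • p.1.2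

lemma pairRel_equivalence (b b' : ℕ) (L : Submodule ℤ K) : Equivalence (PairRel b b' L) where
  refl p := ⟨1, one_ne_zero, by simp, by simp⟩
  symm := by
    rintro p q ⟨t, ht, e, e'⟩
    exact ⟨t⁻¹, inv_ne_zero ht, by rw [e, smul_smul, inv_mul_cancel₀ ht, one_smul],
      by rw [e', smul_smul, inv_mul_cancel₀ (inv_ne_zero ht), one_smul]⟩
  trans := by
    rintro p q r ⟨t, ht, e, e'⟩ ⟨t', ht', f, f'⟩
    exact ⟨t' * t, mul_ne_zero ht' ht, by rw [f, e, smul_smul],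
      by rw [f', e', smul_smul, mul_inv]⟩

lemma nonempty_pairLat_quot_equiv {b b' : ℕ} (hb : 0 < b) (hb' : 0 < b') {L : Submodule ℤ K}
    (hL : IsLC L (b.gcd b')) :
    Nonempty (Quot (PairRel b b' L) ≃ LatClass K (b.lcm b')) := by
  obtain ⟨n, n', hn, e1, e2⟩ := gcd_parts (b' := b') hb
  set g := b.gcd b' with hg
  obtain ⟨M, hM, hML⟩ := hL.exists_lift (n := n') (Nat.pos_of_mul_pos_right (e2 ▸ hb'))
  rw [mul_comm, ← e2] at hM
  have hQ : ∀ p : PairLat b b' L, ordLat K g * p.1.1 = ordLat K g * (M * invLat K p.1.2) := by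
    rintro ⟨⟨p, p'⟩, h, h', e⟩
    dsimp only at *
    rw [← mul_assoc, hML, ← e, mul_assoc, h'.mul_inv, hg, ← ordLat_mul, mul_comm p, mul_assoc,
      mul_comm, mul_assoc, mul_comm p, h.ord_mul]
  have hP : ∀ p : PairLat b b' L, IsLC (M * invLat K p.1.2) b' := fun p => by
    have := hM.mul p.2.2.1.inv
    rwa [Nat.gcd_self] at this
  obtain ⟨e⟩ := nonempty_quot_equiv (r := Homothetic (K := K) (b.lcm b')) (s := PairRel b b' L)
    (pairRel_equivalence b b' L)
    (fun 𝔩 p => p.1.1 = ordLat K b * 𝔩.1 ∧ p.1.2 = invLat K (ordLat K b' * 𝔩.1) * M)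
    (by
      rintro ⟨𝔩, h⟩
      have h1 := h.ord_mul_cond hb (Nat.dvd_lcm_left b b')
      have h2 := h.ord_mul_cond hb' (Nat.dvd_lcm_right b b')
      refine ⟨⟨(ordLat K b * 𝔩, invLat K (ordLat K b' * 𝔩) * M), h1, ?_, ?_⟩, rfl, rfl⟩
      · have := h2.inv.mul hM
        rwa [Nat.gcd_self] at this
      · have : 𝔩 * invLat K (ordLat K b' * 𝔩) = ordLat K b' := by
          rw [(isLC_ordLat hb').invLat_mul h, mul_left_comm, h.mul_inv,
            ← (isLC_ordLat hb').eq_invLat (ordLat_mul_self b') (ordLat_mul_self b'), ordLat_mul,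
            Nat.gcd_eq_left (Nat.dvd_lcm_right b b')]
        rw [← mul_assoc, mul_assoc (ordLat K b), this, ordLat_mul, ← hg, hML])
    (by
      intro p
      have h := p.2.1
      have h' := p.2.2.1
      refine ⟨⟨_, h.inf (hP p) (hQ p)⟩, (h.ord_mul_inf (hP p) (hQ p)).symm, ?_⟩
      change p.1.2 = invLat K (ordLat K b' * (p.1.1 ⊓ (M * invLat K p.1.2))) * M
      rw [inf_comm, (hP p).ord_mul_inf h (by rw [Nat.gcd_comm]; exact (hQ p).symm),
        hM.invLat_mul h'.inv, h'.inv_inv, mul_right_comm, mul_comm _ M, hM.mul_inv, h'.ord_mul])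
    (by
      rintro ⟨𝔩, h⟩ ⟨𝔪, h'⟩ p q ⟨ha, hb1⟩ ⟨hc, hd⟩
      have h2 := h.ord_mul_cond hb' (Nat.dvd_lcm_right b b')
      have h2' := h'.ord_mul_cond hb' (Nat.dvd_lcm_right b b')
      dsimp only at ha hb1 hc hd
      constructor
      · rintro ⟨t, ht, e⟩
        dsimp only at e
        refine ⟨t, ht, ?_, ?_⟩
        · rw [hc, ha, e, mul_smul_lat]
        · rw [hd, hb1, e, mul_smul_lat, h2.invLat_smul ht, smul_lat_mul]
      · rintro ⟨t, ht, e, e'⟩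
        refine ⟨t, ht, ?_⟩
        have back : ∀ (𝔩 : Submodule ℤ K), IsLC 𝔩 (b.lcm b') → ∀ p' : Submodule ℤ K, 
            p' = invLat K (ordLat K b' * 𝔩) * M → ordLat K b' * 𝔩 = M * invLat K p' := by
          rintro 𝔩 h _ rfl
          have h2 := h.ord_mul_cond hb' (Nat.dvd_lcm_right b b')
          rw [h2.inv.invLat_mul hM, h2.inv_inv, mul_left_comm, hM.mul_inv, mul_comm, mul_assoc,
            ordLat_mul_self, mul_comm]
        dsimp only
        rw [← h'.inf_ord_mul, ← h.inf_ord_mul, smul_lat_inf ht, ← hc, ← ha, back _ h _ hb1,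
          back _ h' _ hd, e, e', p.2.2.1.invLat_smul (inv_ne_zero ht), _root_.inv_inv, mul_smul_lat])
  exact ⟨e.symm⟩

end

/-- The determinant of two vectors of `K²`. -/
def dt (u w : Fin 2 → K) : K := u 0 * w 1 - u 1 * w 0

lemma dt_add_right (u w w' : Fin 2 → K) : dt u (w + w') = dt u w + dt u w' := by
  simp only [dt, Pi.add_apply]; ring

lemma dt_smul_right (u w : Fin 2 → K) (t : K) : dt u (t • w) = t * dt u w := by
  simp only [dt, Pi.smul_apply, smul_eq_mul]; ring

lemma dt_add_left (u w w' : Fin 2 → K) : dt (w + w') u = dt w u + dt w' u := by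
  simp only [dt, Pi.add_apply]; ring

lemma dt_smul_left (u w : Fin 2 → K) (t : K) : dt (t • w) u = t * dt w u := by
  simp only [dt, Pi.smul_apply, smul_eq_mul]; ring

lemma dt_self (u : Fin 2 → K) : dt u u = 0 := by simp only [dt]; ring

lemma dt_swap (u w : Fin 2 → K) : dt u w = -dt w u := by simp only [dt]; ring

lemma dt_zero_left (w : Fin 2 → K) : dt 0 w = 0 := by simp [dt]

lemma dt_mulVec (γ : Matrix (Fin 2) (Fin 2) K) (u w : Fin 2 → K) :
    dt (γ.mulVec u) (γ.mulVec w) = γ.det * dt u w := by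
  simp only [dt, Matrix.mulVec, dotProduct, Fin.sum_univ_two, Matrix.det_fin_two]; ring

/-- Cramer's rule. -/
lemma cramer (v m u : Fin 2 → K) : dt v m • u = dt u m • v + dt v u • m := by
  ext i; fin_cases i <;> simp [dt] <;> ring

lemma vec_ext {v m u u' : Fin 2 → K} (hD : dt v m ≠ 0) (h1 : dt v u = dt v u')
    (h2 : dt u m = dt u' m) : u = u' := by
  have := cramer v m u
  rw [h1, h2, ← cramer] at this
  exact smul_right_injective _ hD this

lemma exists_dt_ne {v : Fin 2 → K} (hv : v ≠ 0) : ∃ u, dt v u ≠ 0 := by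
  by_contra! h
  apply hv
  have h0 := h ![0, 1]
  have h1 := h ![1, 0]
  simp [dt] at h0 h1
  ext i; fin_cases i <;> simp [h0, h1]

lemma eq_smul_of_dt_eq_zero {v u : Fin 2 → K} (hv : v ≠ 0) (h : dt v u = 0) : ∃ z : K, u = z • v := by
  obtain ⟨m, hm⟩ := exists_dt_ne hv
  refine ⟨(dt v m)⁻¹ * dt u m, ?_⟩
  have := cramer v m u
  rw [h, zero_smul, add_zero] at this
  rw [mul_smul, ← this, smul_smul, inv_mul_cancel₀ hm, one_smul]

lemma exists_matrix {v m : Fin 2 → K} (hD : dt v m ≠ 0) (v' m' : Fin 2 → K) :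
    ∃ γ : Matrix (Fin 2) (Fin 2) K, γ.mulVec v = v' ∧ γ.mulVec m = m' ∧
      γ.det * dt v m = dt v' m' := by
  let γ : Matrix (Fin 2) (Fin 2) K :=
    !![(m 1 * v' 0 - v 1 * m' 0) / dt v m, (-m 0 * v' 0 + v 0 * m' 0) / dt v m;
      (m 1 * v' 1 - v 1 * m' 1) / dt v m, (-m 0 * v' 1 + v 0 * m' 1) / dt v m]
  have h1 : γ.mulVec v = v' := by
    ext i; fin_cases i <;> simp [γ, Matrix.mulVec, dotProduct, Fin.sum_univ_two] <;> field_simp <;>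
      simp only [dt] <;> ring
  have h2 : γ.mulVec m = m' := by
    ext i; fin_cases i <;> simp [γ, Matrix.mulVec, dotProduct, Fin.sum_univ_two] <;> field_simp <;>
      simp only [dt] <;> ring
  exact ⟨γ, h1, h2, by rw [← dt_mulVec, h1, h2]⟩

/-- `M` is the set of `z v + a m₁ + b m₂` with `z ∈ 𝔟` and `a, b ∈ ℤ`, and the image of `M`
under `dt v` is the lattice `𝔟'` with basis `dt v m₁, dt v m₂`. -/
structure IsDec (M : Submodule ℤ (Fin 2 → K)) (v m₁ m₂ : Fin 2 → K) (𝔟 𝔟' : Submodule ℤ K) :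
    Prop where
  mem : ∀ u, u ∈ M ↔ ∃ z ∈ 𝔟, ∃ a b : ℤ, u = z • v + (a : K) • m₁ + (b : K) • m₂
  bas : IsBas (dt v m₁) (dt v m₂) 𝔟'

section IsDec

variable {M : Submodule ℤ (Fin 2 → K)} {v m₁ m₂ : Fin 2 → K} {𝔟 𝔟' : Submodule ℤ K}

lemma IsDec.ne (h : IsDec M v m₁ m₂ 𝔟 𝔟') : v ≠ 0 := by
  rintro rfl
  exact h.bas.left_ne (dt_zero_left _)

lemma IsDec.mem_left (h : IsDec M v m₁ m₂ 𝔟 𝔟') (z : K) : z ∈ 𝔟 ↔ z • v ∈ M := by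
  rw [h.mem]
  constructor
  · intro hz; exact ⟨z, hz, 0, 0, by simp⟩
  · rintro ⟨z', hz', a, b, e⟩
    have h1 := congrArg (dt v) e
    simp only [dt_add_right, dt_smul_right, dt_self, mul_zero, zero_add] at h1
    obtain ⟨rfl, rfl⟩ := h.bas.ind a b h1.symm
    simp only [Int.cast_zero, zero_smul, add_zero] at e
    rwa [smul_left_injective K h.ne e]

lemma IsDec.fst_mem (h : IsDec M v m₁ m₂ 𝔟 𝔟') : m₁ ∈ M := (h.mem _).2 ⟨0, 𝔟.zero_mem, 1, 0, by simp⟩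

lemma IsDec.snd_mem (h : IsDec M v m₁ m₂ 𝔟 𝔟') : m₂ ∈ M := (h.mem _).2 ⟨0, 𝔟.zero_mem, 0, 1, by simp⟩

lemma IsDec.mem_right (h : IsDec M v m₁ m₂ 𝔟 𝔟') (y : K) : y ∈ 𝔟' ↔ ∃ m ∈ M, dt v m = y := by
  rw [h.bas.mem]
  constructor
  · rintro ⟨a, b, rfl⟩
    exact ⟨(a : K) • m₁ + (b : K) • m₂, (h.mem _).2 ⟨0, 𝔟.zero_mem, a, b, by simp⟩, by
      simp only [dt_add_right, dt_smul_right]⟩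
  · rintro ⟨m, hm, rfl⟩
    obtain ⟨z, hz, a, b, rfl⟩ := (h.mem _).1 hm
    exact ⟨a, b, by simp only [dt_add_right, dt_smul_right, dt_self, mul_zero, zero_add]⟩

lemma intCast_smul_mem {u : Fin 2 → K} (a : ℤ) (hu : u ∈ M) : (a : K) • u ∈ M := by
  rw [Int.cast_smul_eq_zsmul]; exact M.smul_mem a hu

lemma isDec_of (hv : v ≠ 0) (h1 : m₁ ∈ M) (h2 : m₂ ∈ M) (hl : ∀ z, z ∈ 𝔟 ↔ z • v ∈ M)
    (hr : ∀ m ∈ M, dt v m ∈ 𝔟') (hb : IsBas (dt v m₁) (dt v m₂) 𝔟') : IsDec M v m₁ m₂ 𝔟 𝔟' := by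
  refine ⟨fun u => ⟨fun hu => ?_, ?_⟩, hb⟩
  · obtain ⟨a, b, e⟩ := (hb.mem _).1 (hr u hu)
    have h0 : dt v (u - ((a : K) • m₁ + (b : K) • m₂)) = 0 := by
      rw [sub_eq_add_neg, ← neg_one_smul K]
      simp only [dt_add_right, dt_smul_right, e]; ring
    obtain ⟨z, hz⟩ := eq_smul_of_dt_eq_zero hv h0
    refine ⟨z, (hl z).2 ?_, a, b, ?_⟩
    · rw [← hz]
      exact sub_mem hu (add_mem (intCast_smul_mem a h1) (intCast_smul_mem b h2))
    · rw [add_assoc, ← hz]; abel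
  · rintro ⟨z, hz, a, b, rfl⟩
    exact add_mem (add_mem ((hl z).1 hz) (intCast_smul_mem a h1)) (intCast_smul_mem b h2)

lemma IsDec.change (h : IsDec M v m₁ m₂ 𝔟 𝔟') {n₁ n₂ : Fin 2 → K} (h1 : n₁ ∈ M) (h2 : n₂ ∈ M)
    (hb : IsBas (dt v n₁) (dt v n₂) 𝔟') : IsDec M v n₁ n₂ 𝔟 𝔟' :=
  isDec_of h.ne h1 h2 h.mem_left (fun m hm => (h.mem_right _).2 ⟨m, hm, rfl⟩) hb

lemma IsDec.smul (h : IsDec M v m₁ m₂ 𝔟 𝔟') {t : K} (ht : t ≠ 0) :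
    IsDec M (t • v) m₁ m₂ (t⁻¹ • 𝔟) (t • 𝔟') := by
  refine isDec_of (smul_ne_zero ht h.ne) h.fst_mem h.snd_mem ?_ ?_ ?_
  · intro z
    have : z = t⁻¹ * (t * z) := by field_simp
    rw [this, mul_mem_smul_lat (inv_ne_zero ht), h.mem_left, smul_smul, ← this, mul_comm]
  · intro m hm
    rw [dt_smul_left, mul_mem_smul_lat ht, h.mem_right]
    exact ⟨m, hm, rfl⟩
  · rw [dt_smul_left, dt_smul_left]
    exact h.bas.smul ht

lemma neg_smul_lat (L : Submodule ℤ K) : (-1 : K) • L = L := by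
  ext x
  have : x = (-1) * (-x) := by ring
  rw [this, mul_mem_smul_lat (by simp)]
  simp

lemma sign_smul_lat {d : K} (hd : d = 1 ∨ d = -1) (L : Submodule ℤ K) : d • L = L := by
  rcases hd with rfl | rfl
  · exact one_smul _ _
  · exact neg_smul_lat L

lemma IsDec.map (h : IsDec M v m₁ m₂ 𝔟 𝔟') {M' : Submodule ℤ (Fin 2 → K)}
    {γ : Matrix (Fin 2) (Fin 2) K} (hd : γ.det = 1 ∨ γ.det = -1)
    (hM : ∀ u, u ∈ M ↔ γ.mulVec u ∈ M') :
    IsDec M' (γ.mulVec v) (γ.mulVec m₁) (γ.mulVec m₂) 𝔟 𝔟' := by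
  have hd0 : γ.det ≠ 0 := by rcases hd with h | h <;> rw [h] <;> simp
  constructor
  · intro u
    obtain ⟨w, rfl⟩ : ∃ w, γ.mulVec w = u := ⟨γ⁻¹.mulVec u, by
      rw [Matrix.mulVec_mulVec, Matrix.mul_nonsing_inv _ (isUnit_iff_ne_zero.2 hd0),
        Matrix.one_mulVec]⟩
    rw [← hM, h.mem]
    have key : ∀ (z : K) (a b : ℤ), γ.mulVec (z • v + (a : K) • m₁ + (b : K) • m₂) =
        z • γ.mulVec v + (a : K) • γ.mulVec m₁ + (b : K) • γ.mulVec m₂ := by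
      intro z a b
      rw [Matrix.mulVec_add, Matrix.mulVec_add, Matrix.mulVec_smul, Matrix.mulVec_smul,
        Matrix.mulVec_smul]
    constructor
    · rintro ⟨z, hz, a, b, rfl⟩; exact ⟨z, hz, a, b, key z a b⟩
    · rintro ⟨z, hz, a, b, e⟩
      refine ⟨z, hz, a, b, ?_⟩
      rw [← key] at e
      have := congrArg (γ⁻¹.mulVec) e
      rwa [Matrix.mulVec_mulVec, Matrix.mulVec_mulVec,
        Matrix.nonsing_inv_mul _ (isUnit_iff_ne_zero.2 hd0), Matrix.one_mulVec,
        Matrix.one_mulVec] at this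
  · rw [dt_mulVec, dt_mulVec, ← sign_smul_lat hd 𝔟']
    exact h.bas.smul hd0

lemma mem_mul_iff_of_isBas {y₁ y₂ : K} (hb : IsBas y₁ y₂ 𝔟') (x : K) :
    x ∈ 𝔟 * 𝔟' ↔ ∃ z₁ ∈ 𝔟, ∃ z₂ ∈ 𝔟, x = z₁ * y₁ + z₂ * y₂ := by
  constructor
  · intro hx
    refine Submodule.mul_induction_on hx ?_ ?_
    · intro z hz y hy
      obtain ⟨a, b, rfl⟩ := (hb.mem y).1 hy
      refine ⟨a • z, 𝔟.smul_mem a hz, b • z, 𝔟.smul_mem b hz, ?_⟩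
      rw [zsmul_eq_mul, zsmul_eq_mul]; ring
    · rintro _ _ ⟨z₁, h1, z₂, h2, rfl⟩ ⟨z₁', h1', z₂', h2', rfl⟩
      exact ⟨z₁ + z₁', add_mem h1 h1', z₂ + z₂', add_mem h2 h2', by ring⟩
  · rintro ⟨z₁, h1, z₂, h2, rfl⟩
    exact add_mem (Submodule.mul_mem_mul h1 hb.left_mem) (Submodule.mul_mem_mul h2 hb.right_mem)

lemma IsBas.exists_det {y₁ y₂ : K} (h : IsBas y₁ y₂ 𝔟') {a b c d : ℤ}
    (h' : IsBas (a * y₁ + b * y₂) (c * y₁ + d * y₂) 𝔟') :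
    a * d - b * c = 1 ∨ a * d - b * c = -1 := by
  obtain ⟨p, q, e1⟩ := (h'.mem _).1 h.left_mem
  obtain ⟨r, s, e2⟩ := (h'.mem _).1 h.right_mem
  have f1 := h.ext_coeff (a := 1) (b := 0) (a' := p * a + q * c) (b' := p * b + q * d) (by
    push_cast; linear_combination e1)
  have f2 := h.ext_coeff (a := 0) (b := 1) (a' := r * a + s * c) (b' := r * b + s * d) (by
    push_cast; linear_combination e2)
  have : (a * d - b * c) * (p * s - q * r) = 1 := by
    have : (a * d - b * c) * (p * s - q * r) =
      (p * a + q * c) * (r * b + s * d) - (p * b + q * d) * (r * a + s * c) := by ring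
    rw [this, ← f1.1, ← f1.2, ← f2.1, ← f2.2]; ring
  exact Int.eq_one_or_neg_one_of_mul_eq_one this

lemma IsDec.exists_sign (h : IsDec M v m₁ m₂ 𝔟 𝔟') {n₁ n₂ : Fin 2 → K}
    (h' : IsDec M v n₁ n₂ 𝔟 𝔟') :
    ∃ σ : K, (σ = 1 ∨ σ = -1) ∧ dt n₁ n₂ - σ * dt m₁ m₂ ∈ 𝔟 * 𝔟' := by
  obtain ⟨z, hz, a, b, rfl⟩ := (h.mem _).1 h'.fst_mem
  obtain ⟨w, hw, c, d, rfl⟩ := (h.mem _).1 h'.snd_mem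
  have hb := h'.bas
  simp only [dt_add_right, dt_smul_right, dt_self, mul_zero, zero_add] at hb
  refine ⟨((a * d - b * c : ℤ) : K), ?_, ?_⟩
  · rcases h.bas.exists_det hb with e | e <;> rw [e] <;> simp
  · rw [mem_mul_iff_of_isBas h.bas]
    refine ⟨c • z - a • w, sub_mem (𝔟.smul_mem _ hz) (𝔟.smul_mem _ hw), d • z - b • w,
      sub_mem (𝔟.smul_mem _ hz) (𝔟.smul_mem _ hw), ?_⟩
    simp only [dt_add_right, dt_smul_right, dt_add_left, dt_smul_left, dt_self, zsmul_eq_mul,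
      dt_swap m₁ v, dt_swap m₂ v, dt_swap m₂ m₁]
    push_cast; ring

lemma IsDec.exists_adjust (h : IsDec M v m₁ m₂ 𝔟 𝔟') {δ : K} (hδ : δ ∈ 𝔟 * 𝔟') :
    ∃ n₁ n₂, IsDec M v n₁ n₂ 𝔟 𝔟' ∧ dt v n₁ = dt v m₁ ∧ dt v n₂ = dt v m₂ ∧
      dt n₁ n₂ = dt m₁ m₂ + δ := by
  obtain ⟨z₁, h1, z₂, h2, rfl⟩ := (mem_mul_iff_of_isBas h.bas _).1 hδ
  have e1 : dt v (z₂ • v + m₁) = dt v m₁ := by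
    simp only [dt_add_right, dt_smul_right, dt_self]; ring
  have e2 : dt v ((-z₁) • v + m₂) = dt v m₂ := by
    simp only [dt_add_right, dt_smul_right, dt_self]; ring
  refine ⟨z₂ • v + m₁, (-z₁) • v + m₂, h.change ?_ ?_ ?_, e1, e2, ?_⟩
  · exact add_mem ((h.mem_left _).1 h2) h.fst_mem
  · exact add_mem ((h.mem_left _).1 (neg_mem h1)) h.snd_mem
  · rw [e1, e2]; exact h.bas
  · simp only [dt_add_right, dt_smul_right, dt_add_left, dt_smul_left, dt_self, dt_swap m₁ v]
    ring

lemma IsDec.exists_of_isBas (h : IsDec M v m₁ m₂ 𝔟 𝔟') {y₁ y₂ : K} (hb : IsBas y₁ y₂ 𝔟') :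
    ∃ n₁ n₂, IsDec M v n₁ n₂ 𝔟 𝔟' ∧ dt v n₁ = y₁ ∧ dt v n₂ = y₂ := by
  obtain ⟨n₁, h1, rfl⟩ := (h.mem_right _).1 hb.left_mem
  obtain ⟨n₂, h2, rfl⟩ := (h.mem_right _).1 hb.right_mem
  exact ⟨n₁, n₂, h.change h1 h2 hb, rfl, rfl⟩

end IsDec

section IsDec

variable {M : Submodule ℤ (Fin 2 → K)} {v m₁ m₂ : Fin 2 → K} {𝔟 𝔟' : Submodule ℤ K}

lemma IsDec.smul_mem_iff (h : IsDec M v m₁ m₂ 𝔟 𝔟') {α : K} (hα : ∀ z ∈ 𝔟, α * z ∈ 𝔟)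
    {a b c d : ℤ} (e1 : α * dt v m₁ = a * dt v m₁ + b * dt v m₂)
    (e2 : α * dt v m₂ = c * dt v m₁ + d * dt v m₂) :
    (∀ m ∈ M, α • m ∈ M) ↔ b * dt m₁ m₂ / dt v m₁ ∈ 𝔟 ∧ c * dt m₁ m₂ / dt v m₂ ∈ 𝔟 := by
  have h1 := h.bas.left_ne
  have h2 := h.bas.right_ne
  have f1 : α • m₁ = (b * dt m₁ m₂ / dt v m₁) • v + (a : K) • m₁ + (b : K) • m₂ := by
    refine vec_ext h1 ?_ ?_ <;>
    simp only [dt_add_right, dt_smul_right, dt_add_left, dt_smul_left, dt_self, dt_swap m₂ m₁]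
    · rw [e1]; ring
    · field_simp; ring
  have f2 : α • m₂ = (-(c * dt m₁ m₂ / dt v m₂)) • v + (c : K) • m₁ + (d : K) • m₂ := by
    refine vec_ext h2 ?_ ?_ <;>
    simp only [dt_add_right, dt_smul_right, dt_add_left, dt_smul_left, dt_self]
    · rw [e2]; ring
    · field_simp; ring
  constructor
  · intro H
    constructor
    · rw [h.mem_left]
      have := H _ h.fst_mem
      rw [f1, add_assoc, add_mem_cancel_right] at this
      · exact this
      · exact add_mem (intCast_smul_mem a h.fst_mem) (intCast_smul_mem b h.snd_mem)
    · rw [← neg_mem_iff, h.mem_left]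
      have := H _ h.snd_mem
      rw [f2, add_assoc, add_mem_cancel_right] at this
      · exact this
      · exact add_mem (intCast_smul_mem c h.fst_mem) (intCast_smul_mem d h.snd_mem)
  · rintro ⟨H1, H2⟩ m hm
    have g1 : α • m₁ ∈ M := by
      rw [f1, h.mem]; exact ⟨_, H1, a, b, rfl⟩
    have g2 : α • m₂ ∈ M := by
      rw [f2, h.mem]; exact ⟨_, neg_mem H2, c, d, rfl⟩
    obtain ⟨z, hz, p, q, rfl⟩ := (h.mem _).1 hm
    rw [smul_add, smul_add, smul_smul, smul_comm α, smul_comm α]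
    exact add_mem (add_mem ((h.mem_left _).1 (hα z hz)) (intCast_smul_mem p g1))
      (intCast_smul_mem q g2)

section
variable [hK : Fact (Module.finrank ℚ K = 2)]

lemma IsDec.mem_ordLat_lcm (h : IsDec M v m₁ m₂ 𝔟 𝔟') {b b' : ℕ} (hb : IsLC 𝔟 b)
    (hb' : IsLC 𝔟' b') {α : K} (H : ∀ m ∈ M, α • m ∈ M) : α ∈ ordLat K (b.lcm b') := by
  rw [← ordLat_inf, ← hb.multLat_eq, ← hb'.multLat_eq]
  constructor
  · intro z hz
    rw [h.mem_left, mul_smul]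
    exact H _ ((h.mem_left z).1 hz)
  · intro y hy
    obtain ⟨m, hm, rfl⟩ := (h.mem_right _).1 hy
    exact (h.mem_right _).2 ⟨_, H m hm, dt_smul_right _ _ _⟩

lemma IsDec.ord_smul_mem_iff (h : IsDec M v m₁ m₂ 𝔟 𝔟') {b b' : ℕ} (hb : IsLC 𝔟 b)
    (hb' : IsLC 𝔟' b') {ω : K} {s q : ℤ} (hω : IsOmega ω s q) (k y : ℤ) :
    (∀ m ∈ M, ((k : K) + y * ((b.lcm b' : ℕ) * ω)) • m ∈ M) ↔ y * dt m₁ m₂ ∈ 𝔟 * 𝔟' := by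
  obtain ⟨A, B, C, hf⟩ := h.bas.exists_isForm
  obtain ⟨k₀, j, hj, e⟩ := hf.eq_omega h.bas hω hb'.cond
  have hl : b.lcm b' = b / b.gcd b' * b' := by
    rw [Nat.lcm, Nat.div_mul_right_comm (Nat.gcd_dvd_left b b')]
  have hn : ((b / b.gcd b' : ℕ) : K) ≠ 0 := by
    have := Nat.div_pos (Nat.le_of_dvd hb.pos (Nat.gcd_dvd_left b b'))
      (Nat.gcd_pos_of_pos_left b' hb.pos)
    exact_mod_cast this.ne'
  set n := b / b.gcd b' with hndef
  have h1 := h.bas.left_ne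
  have h2 := h.bas.right_ne
  have hα : (k : K) + y * ((b.lcm b' : ℕ) * ω) ∈ ordLat K b :=
    ordLat_le (Nat.dvd_lcm_left b b') ((hω.mem _ _).2 ⟨k, y, rfl⟩)
  have eα : (k : K) + y * ((b.lcm b' : ℕ) * ω) =
      (k + y * n * k₀ : ℤ) + (y * n * j : ℤ) * (A * dt v m₂ / dt v m₁) := by
    rw [hl]; push_cast
    linear_combination (y * n : K) * e
  have hrel := hf.rel
  rw [h.smul_mem_iff (a := k + y * n * k₀) (b := y * n * j * A) (c := -(y * n * j) * C)
    (d := k + y * n * k₀ - y * n * j * B) (fun z hz => hb.mul_mem hα hz)]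
  rotate_left
  · rw [eα]; push_cast; field_simp
  · rw [eα]; push_cast; field_simp; linear_combination (y * n * j : K) * hrel
  have hJ := isBas_invLat h.bas hf
  have key := colon_iff hb hb'.inv ((y * n * j : K) * dt m₁ m₂)
  rw [hb'.inv_inv, ← hndef] at key
  have e3 : (y * n * j : K) * dt m₁ m₂ = n * (j * (y * dt m₁ m₂)) := by ring
  have hj' : ∀ x : K, (j : K) * x ∈ 𝔟 * 𝔟' ↔ x ∈ 𝔟 * 𝔟' := by
    intro x
    rw [← zsmul_eq_mul]
    refine ⟨fun hx => ?_, fun hx => Submodule.smul_mem _ _ hx⟩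
    have := Submodule.smul_mem _ j hx
    rwa [smul_smul, hj, one_smul] at this
  rw [← hj', ← mul_mem_smul_lat (L := 𝔟 * 𝔟') hn, ← e3, ← key]
  constructor
  · rintro ⟨H1, H2⟩ w hw
    obtain ⟨p, q, rfl⟩ := (hJ.mem _).1 hw
    have := add_mem (𝔟.smul_mem p H1) (𝔟.smul_mem (-q) H2)
    convert this using 1
    rw [zsmul_eq_mul, zsmul_eq_mul]
    push_cast
    ring
  · intro H
    constructor
    · convert H _ hJ.left_mem using 1
      push_cast; ring
    · convert neg_mem (H _ hJ.right_mem) using 1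
      push_cast; ring

lemma IsOmega.intCast_mul_mem {ω : K} {s q : ℤ} (hω : IsOmega ω s q) (f : ℕ) (k z : ℤ) :
    (k : K) + z * ω ∈ ordLat K f ↔ (f : ℤ) ∣ z := by
  rw [hω.mem]
  constructor
  · rintro ⟨a, b, e⟩
    have := hω.ind (k - a) (z - b * f) (by push_cast; linear_combination e)
    exact ⟨b, by linarith [this.2]⟩
  · rintro ⟨b, rfl⟩
    exact ⟨k, b, by push_cast; ring⟩

/-- The multiplier ring of `M` is the order of conductor `f`. -/
def IsMult (M : Submodule ℤ (Fin 2 → K)) (f : ℕ) : Prop :=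
  ∀ α : K, (∀ m ∈ M, α • m ∈ M) ↔ α ∈ ordLat K f

/-- `ε` has order `N` modulo `L`. -/
def IsOrd (L : Submodule ℤ K) (ε : K) (N : ℕ) : Prop :=
  ∀ y : ℤ, (y : K) * ε ∈ L ↔ (N : ℤ) ∣ y

lemma IsDec.exists_isOrd (h : IsDec M v m₁ m₂ 𝔟 𝔟') {b b' f : ℕ} (hb : IsLC 𝔟 b)
    (hb' : IsLC 𝔟' b') (hM : IsMult M f) (hf : 0 < f) :
    ∃ N, b.lcm b' * N = f ∧ IsOrd (𝔟 * 𝔟') (dt m₁ m₂) N := by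
  obtain ⟨ω, s, q, hω⟩ := exists_isOmega K
  have hle : ordLat K f ≤ ordLat K (b.lcm b') := fun α hα =>
    h.mem_ordLat_lcm hb hb' ((hM α).2 hα)
  obtain ⟨N, rfl⟩ := (ordLat_le_iff hf).1 hle
  refine ⟨N, rfl, fun y => ?_⟩
  have h0 := h.ord_smul_mem_iff hb hb' hω 0 y
  rw [← h0, hM]
  have e : ((0 : ℤ) : K) + y * ((b.lcm b' : ℕ) * ω) = ((0 : ℤ) : K) + (b.lcm b' * y : ℤ) * ω := by
    push_cast; ring
  rw [e, hω.intCast_mul_mem]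
  push_cast
  have hl : (b.lcm b' : ℤ) ≠ 0 := by
    rintro h0
    simp only [Int.natCast_eq_zero] at h0
    simp [h0] at hf
  rw [mul_dvd_mul_iff_left hl]

lemma IsDec.isMult (h : IsDec M v m₁ m₂ 𝔟 𝔟') {b b' N : ℕ} (hb : IsLC 𝔟 b)
    (hb' : IsLC 𝔟' b') (hN : IsOrd (𝔟 * 𝔟') (dt m₁ m₂) N) : IsMult M (b.lcm b' * N) := by
  obtain ⟨ω, s, q, hω⟩ := exists_isOmega K
  intro α
  constructor
  · intro H
    obtain ⟨k, y, rfl⟩ := (hω.mem _ _).1 (h.mem_ordLat_lcm hb hb' H)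
    rw [h.ord_smul_mem_iff hb hb' hω, hN] at H
    obtain ⟨z, rfl⟩ := H
    exact (hω.mem _ _).2 ⟨k, z, by push_cast; ring⟩
  · intro H
    obtain ⟨k, y, rfl⟩ := (hω.mem _ _).1 H
    have e : (k : K) + y * ((b.lcm b' * N : ℕ) * ω) = k + (y * N : ℤ) * ((b.lcm b' : ℕ) * ω) := by
      push_cast; ring
    rw [e, h.ord_smul_mem_iff hb hb' hω, hN]
    exact ⟨y, mul_comm _ _⟩

end

end IsDec

/-- A full lattice in `K²`. -/
structure IsLatTwo (M : Submodule ℤ (Fin 2 → K)) : Prop where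
  fg : M.FG
  full : ∀ u, ∃ n : ℤ, n ≠ 0 ∧ (n : K) • u ∈ M

lemma fg_comap_of_injective {V W : Type*} [AddCommGroup V] [AddCommGroup W] {M : Submodule ℤ W}
    (hM : M.FG) (φ : V →ₗ[ℤ] W) (hφ : Function.Injective φ) : (M.comap φ).FG := by
  have : Module.Finite ℤ M := Module.Finite.iff_fg.2 hM
  have h1 : (((M.comap φ).map φ).comap M.subtype).FG := IsNoetherian.noetherian _
  have h2 := h1.map M.subtype
  rw [Submodule.map_comap_subtype, inf_eq_right.2 (Submodule.map_comap_le _ _)] at h2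
  exact Submodule.fg_of_fg_map_injective φ hφ h2

lemma IsLatTwo.exists_isDec {M : Submodule ℤ (Fin 2 → K)} (hM : IsLatTwo M) {v : Fin 2 → K}
    (hv : v ≠ 0) [hK : Fact (Module.finrank ℚ K = 2)] :
    ∃ m₁ m₂ 𝔟 𝔟' b b', IsDec M v m₁ m₂ 𝔟 𝔟' ∧ IsLC 𝔟 b ∧ IsLC 𝔟' b' := by
  let φ : K →ₗ[ℤ] (Fin 2 → K) :=
    { toFun := fun z => z • v
      map_add' := fun x y => add_smul x y v
      map_smul' := fun n x => smul_assoc n x v }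
  let ψ : (Fin 2 → K) →ₗ[ℤ] K :=
    { toFun := fun m => dt v m
      map_add' := dt_add_right v
      map_smul' := fun n x => by
        rw [← Int.cast_smul_eq_zsmul K, dt_smul_right, RingHom.id_apply, zsmul_eq_mul] }
  have h1 : IsLat K (M.comap φ) := by
    refine isLat_of_exists_mul_mem (fg_comap_of_injective hM.fg φ (smul_left_injective K hv))
      fun x => ?_
    obtain ⟨n, hn, h⟩ := hM.full (x • v)
    exact ⟨n, hn, by rw [Submodule.mem_comap]; change ((n : K) * x) • v ∈ M; rwa [mul_smul]⟩
  have h2 : IsLat K (M.map ψ) := by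
    refine isLat_of_exists_mul_mem (hM.fg.map ψ) fun x => ?_
    obtain ⟨u, hu⟩ := exists_dt_ne hv
    obtain ⟨n, hn, h⟩ := hM.full ((x / dt v u) • u)
    refine ⟨n, hn, Submodule.mem_map.2 ⟨_, h, ?_⟩⟩
    change dt v _ = _
    rw [dt_smul_right, dt_smul_right, div_mul_cancel₀ _ hu]
  obtain ⟨b, hb⟩ := h1.exists_isLC
  obtain ⟨b', hb'⟩ := h2.exists_isLC
  obtain ⟨y₁, y₂, hy⟩ := h2.exists_isBas
  obtain ⟨m₁, hm₁, rfl⟩ := Submodule.mem_map.1 hy.left_mem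
  obtain ⟨m₂, hm₂, rfl⟩ := Submodule.mem_map.1 hy.right_mem
  exact ⟨m₁, m₂, _, _, b, b', isDec_of hv hm₁ hm₂ (fun z => Iff.rfl)
    (fun m hm => Submodule.mem_map_of_mem hm) hy, hb, hb'⟩

/-- The `ℤ`-span of the determinants of pairs of vectors of `M`. -/
def dtSpan (M : Submodule ℤ (Fin 2 → K)) : Submodule ℤ K :=
  Submodule.span ℤ {x | ∃ m ∈ M, ∃ m' ∈ M, dt m m' = x}

lemma dt_mem_dtSpan {M : Submodule ℤ (Fin 2 → K)} {m m' : Fin 2 → K} (h : m ∈ M) (h' : m' ∈ M) :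
    dt m m' ∈ dtSpan M := Submodule.subset_span ⟨m, h, m', h', rfl⟩

lemma IsDec.dtSpan_eq {M : Submodule ℤ (Fin 2 → K)} {v m₁ m₂ : Fin 2 → K} {𝔟 𝔟' : Submodule ℤ K}
    (h : IsDec M v m₁ m₂ 𝔟 𝔟') : dtSpan M = 𝔟 * 𝔟' ⊔ Submodule.span ℤ {dt m₁ m₂} := by
  apply le_antisymm
  · refine Submodule.span_le.2 ?_
    rintro _ ⟨m, hm, m', hm', rfl⟩
    obtain ⟨z, hz, a, b, rfl⟩ := (h.mem _).1 hm
    obtain ⟨w, hw, c, d, rfl⟩ := (h.mem _).1 hm'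
    refine Submodule.mem_sup.2 ⟨z * (c * dt v m₁ + d * dt v m₂) - w * (a * dt v m₁ + b * dt v m₂),
      ?_, (a * d - b * c) • dt m₁ m₂, Submodule.smul_mem _ _ (Submodule.mem_span_singleton_self _),
      ?_⟩
    · exact sub_mem (Submodule.mul_mem_mul hz ((h.bas.mem _).2 ⟨c, d, rfl⟩))
        (Submodule.mul_mem_mul hw ((h.bas.mem _).2 ⟨a, b, rfl⟩))
    · simp only [dt_add_right, dt_smul_right, dt_add_left, dt_smul_left, dt_self, zsmul_eq_mul,
        dt_swap m₁ v, dt_swap m₂ v, dt_swap m₂ m₁]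
      push_cast; ring
  · refine sup_le ?_ ?_
    · rw [Submodule.mul_le]
      intro z hz y hy
      obtain ⟨m, hm, rfl⟩ := (h.mem_right _).1 hy
      rw [← dt_smul_left]
      exact dt_mem_dtSpan ((h.mem_left _).1 hz) hm
    · rw [Submodule.span_singleton_le_iff_mem]
      exact dt_mem_dtSpan h.fst_mem h.snd_mem

lemma mem_of_isCoprime {M : Submodule ℤ (Fin 2 → K)} {a b : ℕ} (hab : a.Coprime b)
    {x : Fin 2 → K} (h1 : (a : K) • x ∈ M) (h2 : (b : K) • x ∈ M) : x ∈ M := by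
  obtain ⟨p, q, e⟩ := Nat.isCoprime_iff_coprime.2 hab
  have : x = (p : K) • (a : K) • x + (q : K) • (b : K) • x := by
    rw [smul_smul, smul_smul, ← add_smul]
    have : (p : K) * a + q * b = 1 := by exact_mod_cast e
    rw [this, one_smul]
  rw [this]
  exact add_mem (intCast_smul_mem p h1) (intCast_smul_mem q h2)

section
variable [hK : Fact (Module.finrank ℚ K = 2)]

lemma exists_primitive {M : Submodule ℤ (Fin 2 → K)} (hM : IsLatTwo M) {f : ℕ} (hf : 0 < f)
    (hm : IsMult M f) {ω : K} {s q : ℤ} (hω : IsOmega ω s q) (S : Finset ℕ)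
    (hS : ∀ p ∈ S, p.Prime ∧ p ∣ f) :
    ∃ v ∈ M, v ≠ 0 ∧ ∀ p ∈ S, ((f / p : ℕ) * ω) • v ∉ M := by
  have hfω : ∀ m ∈ M, ((f : K) * ω) • m ∈ M := by
    rw [hm]; exact (hω.mem _ _).2 ⟨0, 1, by simp⟩
  have hpf : ∀ p, p ∣ f → ∀ m ∈ M, (p : K) • (((f / p : ℕ) : K) * ω) • m ∈ M := by
    intro p hp m hmM
    have : (p : K) * ((f / p : ℕ) * ω) = f * ω := by
      rw [← mul_assoc, ← Nat.cast_mul, Nat.mul_div_cancel' hp]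
    rw [smul_smul, this]
    exact hfω m hmM
  induction S using Finset.induction_on with
  | empty =>
    obtain ⟨n, hn, h⟩ := hM.full ![1, 0]
    exact ⟨_, h, smul_ne_zero (by exact_mod_cast hn) (fun e => by simpa using congrFun e 0),
      by simp⟩
  | insert p S hpS ih =>
    obtain ⟨v, hv, hv0, hvS⟩ := ih fun q hq => hS q (Finset.mem_insert_of_mem hq)
    obtain ⟨hp, hpd⟩ := hS p (Finset.mem_insert_self _ _)
    obtain ⟨w, hw, hwp⟩ : ∃ w ∈ M, (((f / p : ℕ) : K) * ω) • w ∉ M := by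
      by_contra! H
      have := (hm _).1 H
      have h1 := (hω.intCast_mul_mem f 0 ((f / p : ℕ) : ℤ)).1 (by
        rw [Int.cast_natCast, Int.cast_zero, zero_add]; exact this)
      have h2 := Nat.le_of_dvd (Nat.div_pos (Nat.le_of_dvd hf hpd) hp.pos)
        (Int.natCast_dvd_natCast.1 h1)
      exact absurd h2 (not_le.2 (Nat.div_lt_self hf hp.one_lt))
    have hsm : ∀ (n : ℕ) (x : Fin 2 → K), x ∈ M → (n : K) • x ∈ M := by
      intro n x hx
      exact_mod_cast intCast_smul_mem (n : ℤ) hx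
    have key : ∀ q ∈ insert p S,
        ((f / q : ℕ) * ω) • ((p : K) • v + ((∏ x ∈ S, x : ℕ) : K) • w) ∉ M := by
      intro q hq
      rw [smul_add, smul_comm _ (p : K), smul_comm _ ((∏ x ∈ S, x : ℕ) : K)]
      rcases Finset.mem_insert.1 hq with rfl | hqS
      · rw [add_mem_cancel_left (hpf q hpd v hv)]
        intro H
        refine hwp (mem_of_isCoprime ?_ (hpf q hpd w hw) H)
        refine Nat.Coprime.prod_right fun x hx => ?_
        refine (Nat.coprime_primes hp (hS x (Finset.mem_insert_of_mem hx)).1).2 ?_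
        rintro rfl; exact hpS hx
      · have hq' := hS q hq
        rw [add_mem_cancel_right]
        · intro H
          refine hvS q hqS (mem_of_isCoprime ?_ (hpf q hq'.2 v hv) H)
          refine (Nat.coprime_primes hq'.1 hp).2 ?_
          rintro rfl; exact hpS hqS
        · rw [← Finset.mul_prod_erase S (fun x => x) hqS, mul_comm, Nat.cast_mul, mul_smul]
          exact hsm _ _ (hpf q hq'.2 w hw)
    refine ⟨(p : K) • v + ((∏ x ∈ S, x : ℕ) : K) • w, add_mem (hsm _ _ hv) (hsm _ _ hw), ?_, key⟩
    intro e
    refine key p (Finset.mem_insert_self _ _) ?_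
    rw [e, smul_zero]
    exact M.zero_mem

lemma IsLatTwo.exists_isDec_top {M : Submodule ℤ (Fin 2 → K)} (hM : IsLatTwo M) {f : ℕ}
    (hf : 0 < f) (hm : IsMult M f) :
    ∃ v m₁ m₂ 𝔟 𝔟' b', IsDec M v m₁ m₂ 𝔟 𝔟' ∧ IsLC 𝔟 f ∧ IsLC 𝔟' b' ∧ b' ∣ f ∧
      dt m₁ m₂ = 0 := by
  obtain ⟨ω, s, q, hω⟩ := exists_isOmega K
  obtain ⟨v, hv, hv0, hvp⟩ := exists_primitive hM hf hm hω f.primeFactors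
    fun p hp => ⟨Nat.prime_of_mem_primeFactors hp, Nat.dvd_of_mem_primeFactors hp⟩
  obtain ⟨m₁, m₂, 𝔟, 𝔟', b, b', h, hb, hb'⟩ := hM.exists_isDec hv0
  obtain ⟨N, hN, hord⟩ := h.exists_isOrd hb hb' hm hf
  obtain rfl : b = f := by
    have hbf : b ∣ f := (Nat.dvd_lcm_left b b').trans ⟨N, hN.symm⟩
    by_contra hne
    obtain ⟨k, rfl⟩ := hbf
    have hk : k ≠ 1 := by rintro rfl; simp at hne
    obtain ⟨p, hp, j, rfl⟩ := Nat.exists_prime_and_dvd hk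
    refine hvp p (Nat.mem_primeFactors.2 ⟨hp, ⟨b * j, by ring⟩, hf.ne'⟩) ?_
    have e : b * (p * j) / p = j * b := by
      rw [show b * (p * j) = (j * b) * p by ring, Nat.mul_div_cancel _ hp.pos]
    rw [e, ← h.mem_left]
    have h1 : (1 : K) ∈ 𝔟 := by rw [h.mem_left, one_smul]; exact hv
    have := hb.mul_mem ((hω.mem b _).2 ⟨0, j, rfl⟩) h1
    rw [mul_one] at this
    convert this using 1
    push_cast; ring
  have hN1 : N = 1 := by
    have h1 : b ≤ b.lcm b' := Nat.le_of_dvd (Nat.lcm_pos hb.pos hb'.pos) (Nat.dvd_lcm_left _ _)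
    have h2 : 0 < N := Nat.pos_of_ne_zero (by rintro rfl; simp at hN; omega)
    nlinarith
  subst hN1
  have hε : dt m₁ m₂ ∈ 𝔟 * 𝔟' := by
    have := (hord 1).2 (by simp)
    simpa using this
  obtain ⟨n₁, n₂, h', -, -, e⟩ := h.exists_adjust (neg_mem hε)
  exact ⟨v, n₁, n₂, 𝔟, 𝔟', b', h', hb, hb', by rw [mul_one] at hN; rw [← hN]; exact Nat.dvd_lcm_right _ _,
    by rw [e]; ring⟩

lemma exists_steinitz {𝔟 𝔟' : Submodule ℤ K} {f b' : ℕ} (hb : IsLC 𝔟 f) (hb' : IsLC 𝔟' b')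
    (hd : b' ∣ f) : ∃ s ∈ invLat K 𝔟, ∃ p₀ ∈ 𝔟, ∃ q₀ ∈ 𝔟', ∃ t : K, (∀ y ∈ 𝔟', t * y ∈ ordLat K f) ∧
      p₀ * s + q₀ * t = 1 := by
  obtain ⟨y₁, y₂, hy⟩ := hb'.lat.exists_isBas
  obtain ⟨n₁, hn₁, h1⟩ := (isLat_ordLat hb.pos).exists_mul_mem y₁
  obtain ⟨n₂, hn₂, h2⟩ := (isLat_ordLat hb.pos).exists_mul_mem y₂
  have ht0 : ((n₁ * n₂ : ℤ) : K) ≠ 0 := by exact_mod_cast mul_ne_zero hn₁ hn₂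
  have ht : ∀ y ∈ 𝔟', ((n₁ * n₂ : ℤ) : K) * y ∈ ordLat K f := by
    intro y hy'
    obtain ⟨a, b, rfl⟩ := (hy.mem _).1 hy'
    have := add_mem (Submodule.smul_mem _ (n₂ * a) h1) (Submodule.smul_mem _ (n₁ * b) h2)
    convert this using 1
    rw [zsmul_eq_mul, zsmul_eq_mul]; push_cast; ring
  set t : K := ((n₁ * n₂ : ℤ) : K) with htdef
  obtain ⟨m, hm0, hm⟩ := (hb'.smul ht0).lat.exists_mul_mem 1
  have hm' : ((m.natAbs : ℕ) : K) ∈ t • 𝔟' := by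
    rw [mul_one] at hm
    rcases Int.natAbs_eq m with e | e
    · rw [e] at hm; simpa using hm
    · rw [e] at hm; simpa using hm
  obtain ⟨y, hy', ey⟩ := mem_smul_lat.1 hm'
  obtain ⟨s, hs, hle⟩ := hb.inv.exists_le_sup (Int.natAbs_ne_zero.2 hm0)
  have h1 : (1 : K) ∈ s • 𝔟 ⊔ ((m.natAbs : ℕ) : K) • ordLat K f := by
    have h2 : 𝔟 * invLat K 𝔟 ≤ s • 𝔟 ⊔ ((m.natAbs : ℕ) : K) • ordLat K f := by
      refine (mul_le_mul' le_rfl hle).trans ?_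
      rw [← Submodule.add_eq_sup, mul_add, mul_smul_lat, mul_smul_lat, hb.mul_inv, mul_comm 𝔟,
        hb.ord_mul, Submodule.add_eq_sup]
    rw [hb.mul_inv] at h2
    exact h2 (one_mem_ordLat _)
  obtain ⟨x₁, hx₁, x₂, hx₂, e⟩ := Submodule.mem_sup.1 h1
  obtain ⟨p₀, hp₀, rfl⟩ := mem_smul_lat.1 hx₁
  obtain ⟨κ, hκ, rfl⟩ := mem_smul_lat.1 hx₂
  refine ⟨s, hs, p₀, hp₀, κ * y, hb'.mul_mem (ordLat_le hd hκ) hy', t, ht, ?_⟩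
  rw [← ey] at e
  linear_combination e

/-- A full lattice of `K²` with multiplier ring the order of conductor `f` is determined, up to
`SL₂(K)`, by `f` and the span of its determinants. -/
lemma IsLatTwo.exists_split {M : Submodule ℤ (Fin 2 → K)} (hM : IsLatTwo M) {f : ℕ}
    (hf : 0 < f) (hm : IsMult M f) :
    ∃ v w : Fin 2 → K, dt v w = 1 ∧
      ∀ u, u ∈ M ↔ ∃ α ∈ ordLat K f, ∃ κ ∈ dtSpan M, u = α • v + κ • w := by
  obtain ⟨v, m₁, m₂, 𝔟, 𝔟', b', h, hb, hb', hd, hε⟩ := hM.exists_isDec_top hf hm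
  have hΔ : dtSpan M = 𝔟 * 𝔟' := by
    rw [h.dtSpan_eq, hε, Submodule.span_singleton_eq_bot.2 rfl, sup_bot_eq]
  have h1 := h.bas.left_ne
  set w : Fin 2 → K := (dt v m₁)⁻¹ • m₁ with hw
  have e1 : m₁ = dt v m₁ • w := by rw [hw, smul_smul, mul_inv_cancel₀ h1, one_smul]
  have e2 : m₂ = dt v m₂ • w := by
    refine vec_ext h1 ?_ ?_
    · rw [dt_smul_right, hw, dt_smul_right, inv_mul_cancel₀ h1, mul_one]
    · rw [dt_smul_left, hw, dt_smul_left, dt_self, dt_swap, hε]; ring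
  have hvw : dt v w = 1 := by rw [hw, dt_smul_right, inv_mul_cancel₀ h1]
  have hmem : ∀ u, u ∈ M ↔ ∃ z ∈ 𝔟, ∃ y ∈ 𝔟', u = z • v + y • w := by
    intro u
    rw [h.mem]
    constructor
    · rintro ⟨z, hz, a, b, rfl⟩
      refine ⟨z, hz, _, (h.bas.mem _).2 ⟨a, b, rfl⟩, ?_⟩
      rw [add_smul, mul_smul, mul_smul, ← e1, ← e2, add_assoc]
    · rintro ⟨z, hz, y, hy, rfl⟩
      obtain ⟨a, b, rfl⟩ := (h.bas.mem _).1 hy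
      refine ⟨z, hz, a, b, ?_⟩
      rw [add_smul, mul_smul, mul_smul, ← e1, ← e2, add_assoc]
  obtain ⟨s, hs, p₀, hp₀, q₀, hq₀, t, ht, e⟩ := exists_steinitz hb hb' hd
  have hκt : ∀ κ ∈ 𝔟 * 𝔟', t * κ ∈ 𝔟 := by
    intro κ hκ
    have : 𝔟 * 𝔟' ≤ 𝔟 * (t⁻¹ • ordLat K f) ∨ t = 0 := by
      rcases eq_or_ne t 0 with h0 | h0
      · exact Or.inr h0
      · refine Or.inl (mul_le_mul' le_rfl fun y hy => ?_)
        rw [mem_smul_lat]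
        exact ⟨_, ht y hy, inv_mul_cancel_left₀ h0 y⟩
    rcases eq_or_ne t 0 with h0 | h0
    · rw [h0, zero_mul]; exact 𝔟.zero_mem
    · have := this.resolve_right h0 hκ
      rw [mul_smul_lat, mul_comm 𝔟, hb.ord_mul, mem_smul_lat] at this
      obtain ⟨y, hy, rfl⟩ := this
      rwa [mul_inv_cancel_left₀ h0]
  have hκs : ∀ κ ∈ 𝔟 * 𝔟', κ * s ∈ 𝔟' := by
    intro κ hκ
    have := Submodule.mul_mem_mul hκ hs
    rw [mul_right_comm, hb.mul_inv] at this
    have h2 := mul_le_mul' (ordLat_le (K := K) hd) (le_refl 𝔟') this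
    rwa [hb'.ord_mul] at h2
  refine ⟨p₀ • v + q₀ • w, (-t) • v + s • w, ?_, fun u => ?_⟩
  · simp only [dt_add_right, dt_smul_right, dt_add_left, dt_smul_left, dt_self, dt_swap w v, hvw]
    linear_combination e
  rw [hΔ, hmem]
  constructor
  · rintro ⟨z, hz, y, hy, rfl⟩
    refine ⟨z * s + t * y, add_mem ?_ (ht y hy), y * p₀ - z * q₀, sub_mem ?_ ?_, ?_⟩
    · rw [← hb.mul_inv]; exact Submodule.mul_mem_mul hz hs
    · rw [mul_comm y]; exact Submodule.mul_mem_mul hp₀ hy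
    · exact Submodule.mul_mem_mul hz hq₀
    · ext i
      simp only [Pi.add_apply, Pi.smul_apply, smul_eq_mul]
      linear_combination (-(z * v i + y * w i)) * e
  · rintro ⟨α, hα, κ, hκ, rfl⟩
    refine ⟨α * p₀ - t * κ, sub_mem (hb.mul_mem hα hp₀) (hκt κ hκ), α * q₀ + κ * s,
      add_mem (hb'.mul_mem (ordLat_le hd hα) hq₀) (hκs κ hκ), ?_⟩
    ext i
    simp only [Pi.add_apply, Pi.smul_apply, smul_eq_mul]
    ring

end

section IsDec

variable {M : Submodule ℤ (Fin 2 → K)} {v m₁ m₂ : Fin 2 → K} {𝔟 𝔟' : Submodule ℤ K}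

lemma IsDec.isLatTwo [hK : Fact (Module.finrank ℚ K = 2)] (h : IsDec M v m₁ m₂ 𝔟 𝔟') (hl : IsLat K 𝔟) (hl' : IsLat K 𝔟') :
    IsLatTwo M := by
  let φ : K →ₗ[ℤ] (Fin 2 → K) :=
    { toFun := fun z => z • v
      map_add' := fun x y => add_smul x y v
      map_smul' := fun n x => smul_assoc n x v }
  have e : M = 𝔟.map φ ⊔ Submodule.span ℤ {m₁, m₂} := by
    apply le_antisymm
    · intro u hu
      obtain ⟨z, hz, a, b, rfl⟩ := (h.mem u).1 hu
      rw [add_assoc]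
      refine Submodule.add_mem_sup (Submodule.mem_map_of_mem (f := φ) hz) ?_
      rw [Int.cast_smul_eq_zsmul, Int.cast_smul_eq_zsmul, Submodule.mem_span_pair]
      exact ⟨a, b, rfl⟩
    · refine sup_le (Submodule.map_le_iff_le_comap.2 fun z hz => (h.mem_left z).1 hz) ?_
      rw [Submodule.span_le]
      rintro _ (rfl | rfl)
      exacts [h.fst_mem, h.snd_mem]
  constructor
  · rw [e]
    exact (hl.1.map φ).sup (Submodule.fg_span (Set.toFinite _))
  · intro u
    obtain ⟨n, hn, h1⟩ := hl'.exists_mul_mem (dt v u)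
    obtain ⟨a, b, e1⟩ := (h.bas.mem _).1 h1
    have h0 : dt v ((n : K) • u - ((a : K) • m₁ + (b : K) • m₂)) = 0 := by
      rw [sub_eq_add_neg, ← neg_one_smul K]
      simp only [dt_add_right, dt_smul_right, e1]; ring
    obtain ⟨z, hz⟩ := eq_smul_of_dt_eq_zero h.ne h0
    obtain ⟨n', hn', h2⟩ := hl.exists_mul_mem z
    refine ⟨n' * n, mul_ne_zero hn' hn, (h.mem _).2 ⟨_, h2, n' * a, n' * b, ?_⟩⟩
    rw [sub_eq_iff_eq_add] at hz
    rw [Int.cast_mul, mul_smul, hz]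
    push_cast
    simp only [smul_add, mul_smul, add_assoc]

end IsDec

/-- The lattice of all `z v + a m₁ + b m₂` with `z ∈ 𝔟` and `a, b ∈ ℤ`. -/
def decLat (v m₁ m₂ : Fin 2 → K) (𝔟 : Submodule ℤ K) : Submodule ℤ (Fin 2 → K) where
  carrier := {u | ∃ z ∈ 𝔟, ∃ a b : ℤ, u = z • v + (a : K) • m₁ + (b : K) • m₂}
  add_mem' := by
    rintro _ _ ⟨z, hz, a, b, rfl⟩ ⟨w, hw, c, d, rfl⟩
    refine ⟨z + w, add_mem hz hw, a + c, b + d, ?_⟩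
    push_cast
    simp only [add_smul]; abel
  zero_mem' := ⟨0, 𝔟.zero_mem, 0, 0, by simp⟩
  smul_mem' := by
    rintro n _ ⟨z, hz, a, b, rfl⟩
    refine ⟨n • z, 𝔟.smul_mem n hz, n * a, n * b, ?_⟩
    push_cast
    simp only [smul_add, mul_smul, smul_assoc, Int.cast_smul_eq_zsmul]

/-- The direct sum of two lattices of `K`, as a lattice of `K²`. -/
def dsum (𝔞 𝔞' : Submodule ℤ K) : Submodule ℤ (Fin 2 → K) where
  carrier := {u | u 0 ∈ 𝔞 ∧ u 1 ∈ 𝔞'}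
  add_mem' := fun h h' => ⟨add_mem h.1 h'.1, add_mem h.2 h'.2⟩
  zero_mem' := ⟨𝔞.zero_mem, 𝔞'.zero_mem⟩
  smul_mem' := fun n _ h => ⟨𝔞.smul_mem n h.1, 𝔞'.smul_mem n h.2⟩

lemma isDec_dsum {𝔞 𝔞' : Submodule ℤ K} {y₁ y₂ : K} (hb : IsBas y₁ y₂ 𝔞') :
    IsDec (dsum 𝔞 𝔞') ![1, 0] ![0, y₁] ![0, y₂] 𝔞 𝔞' := by
  refine isDec_of (fun e => by simpa using congrFun e 0) ⟨?_, ?_⟩ ⟨?_, ?_⟩ ?_ ?_ ?_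
  · exact 𝔞.zero_mem
  · exact hb.left_mem
  · exact 𝔞.zero_mem
  · exact hb.right_mem
  · intro z
    change _ ↔ (z • ![(1 : K), 0]) 0 ∈ 𝔞 ∧ (z • ![(1 : K), 0]) 1 ∈ 𝔞'
    simp
  · rintro m ⟨h1, h2⟩
    simpa [dt] using h2
  · simpa [dt] using hb

lemma exists_isDec_of_isBas (𝔟 : Submodule ℤ K) {𝔟' : Submodule ℤ K} {y₁ y₂ : K}
    (hb : IsBas y₁ y₂ 𝔟') (ε : K) :
    ∃ M v m₁ m₂, IsDec M v m₁ m₂ 𝔟 𝔟' ∧ dt m₁ m₂ = ε := by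
  refine ⟨decLat ![1, 0] ![ε / y₂, y₁] ![0, y₂] 𝔟, ![1, 0], ![ε / y₂, y₁], ![0, y₂],
    ⟨fun u => Iff.rfl, ?_⟩, ?_⟩
  · simpa [dt] using hb
  · have := hb.right_ne
    simp [dt, this]

section
variable [hK : Fact (Module.finrank ℚ K = 2)]

lemma mem_gamma_iff {𝔞 𝔞' : Submodule ℤ K} {c c' : ℕ} (h : IsLC 𝔞 c) (h' : IsLC 𝔞' c')
    (γ : Matrix (Fin 2) (Fin 2) K) :
    (γ 0 0 ∈ orderSet K c ∧ γ 1 1 ∈ orderSet K c' ∧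
      γ 0 1 ∈ ((c : K) • 𝔞) * invLat K ((c.gcd c' : K) • 𝔞') ∧
      γ 1 0 ∈ ((c' : K) • 𝔞') * invLat K ((c.gcd c' : K) • 𝔞)) ↔
    ∀ u ∈ dsum 𝔞 𝔞', γ.mulVec u ∈ dsum 𝔞 𝔞' := by
  have hg : (c.gcd c' : K) ≠ 0 := by exact_mod_cast (Nat.gcd_pos_of_pos_left c' h.pos).ne'
  have e1 : ((c : K) • 𝔞) * invLat K ((c.gcd c' : K) • 𝔞') =
      ((c / c.gcd c' : ℕ) : K) • (𝔞 * invLat K 𝔞') := by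
    rw [h'.invLat_smul hg, smul_lat_mul, mul_smul_lat, smul_smul,
      Nat.cast_div (Nat.gcd_dvd_left c c') hg, div_eq_mul_inv]
  have e2 : ((c' : K) • 𝔞') * invLat K ((c.gcd c' : K) • 𝔞) =
      ((c' / c'.gcd c : ℕ) : K) • (𝔞' * invLat K 𝔞) := by
    rw [Nat.gcd_comm] at hg ⊢
    rw [h.invLat_smul hg, smul_lat_mul, mul_smul_lat, smul_smul,
      Nat.cast_div (Nat.gcd_dvd_left c' c) hg, div_eq_mul_inv]
  rw [e1, e2, ← colon_iff h h', ← colon_iff h' h, ← h.cond.2, ← h'.cond.2]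
  have hmv : ∀ u, γ.mulVec u ∈ dsum 𝔞 𝔞' ↔
      γ 0 0 * u 0 + γ 0 1 * u 1 ∈ 𝔞 ∧ γ 1 0 * u 0 + γ 1 1 * u 1 ∈ 𝔞' := by
    intro u
    change γ.mulVec u 0 ∈ 𝔞 ∧ γ.mulVec u 1 ∈ 𝔞' ↔ _
    simp [Matrix.mulVec, dotProduct, Fin.sum_univ_two]
  simp only [hmv]
  constructor
  · rintro ⟨h00, h11, h01, h10⟩ u ⟨hu0, hu1⟩
    exact ⟨add_mem (h00 _ hu0) (h01 _ hu1), add_mem (h10 _ hu0) (h11 _ hu1)⟩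
  · intro H
    have H0 : ∀ x ∈ 𝔞, γ 0 0 * x ∈ 𝔞 ∧ γ 1 0 * x ∈ 𝔞' := by
      intro x hx
      simpa using H ![x, 0] ⟨hx, 𝔞'.zero_mem⟩
    have H1 : ∀ x ∈ 𝔞', γ 0 1 * x ∈ 𝔞 ∧ γ 1 1 * x ∈ 𝔞' := by
      intro x hx
      simpa using H ![0, x] ⟨𝔞.zero_mem, hx⟩
    exact ⟨fun x hx => (H0 x hx).1, fun x hx => (H1 x hx).2, fun x hx => (H1 x hx).1,
      fun x hx => (H0 x hx).2⟩

lemma gammaLatRel_iff {𝔞 𝔞' : Submodule ℤ K} {c c' : ℕ} (h : IsLC 𝔞 c) (h' : IsLC 𝔞' c')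
    (x y : Projectivization K (Fin 2 → K)) :
    gammaLatRel K 𝔞 𝔞' c c' (c.gcd c') x y ↔ ∃ γ : Matrix (Fin 2) (Fin 2) K,
      (γ.det = 1 ∨ γ.det = -1) ∧ (∀ u ∈ dsum 𝔞 𝔞', γ.mulVec u ∈ dsum 𝔞 𝔞') ∧
      ∃ (v : Fin 2 → K) (hv : v ≠ 0) (hw : γ.mulVec v ≠ 0),
        x = Projectivization.mk K v hv ∧ y = Projectivization.mk K (γ.mulVec v) hw := by
  simp only [← mem_gamma_iff h h', gammaLatRel, and_assoc]

lemma exists_quadratic {x : K} (hx : x ∈ ordLat K 1) : ∃ S P : ℤ, x ^ 2 = S * x - P := by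
  obtain ⟨ω, s, q, hω⟩ := exists_isOmega K
  obtain ⟨a, b, rfl⟩ := (hω.mem _ _).1 hx
  refine ⟨2 * a + b * s, a ^ 2 + a * b * s - b ^ 2 * q, ?_⟩
  push_cast
  linear_combination (b ^ 2 : K) * hω.rel

/-- A matrix of determinant `±1` mapping the lattice into itself maps it onto itself. -/
lemma mem_dsum_iff_mulVec {𝔞 𝔞' : Submodule ℤ K} {c c' : ℕ} (h : IsLC 𝔞 c) (h' : IsLC 𝔞' c')
    {γ : Matrix (Fin 2) (Fin 2) K} (hd : γ.det = 1 ∨ γ.det = -1)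
    (hγ : ∀ u ∈ dsum 𝔞 𝔞', γ.mulVec u ∈ dsum 𝔞 𝔞') (u : Fin 2 → K) :
    u ∈ dsum 𝔞 𝔞' ↔ γ.mulVec u ∈ dsum 𝔞 𝔞' := by
  refine ⟨hγ u, fun hu => ?_⟩
  have htr : γ 0 0 + γ 1 1 ∈ ordLat K 1 := by
    have := (mem_gamma_iff h h' γ).2 hγ
    exact add_mem (ordLat_le (one_dvd c) this.1) (ordLat_le (one_dvd c') this.2.1)
  obtain ⟨S, P, hSP⟩ := exists_quadratic htr
  obtain ⟨d, hdd, e⟩ : ∃ d : ℤ, d * d = 1 ∧ γ.det = d := by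
    rcases hd with e | e
    · exact ⟨1, by norm_num, by simp [e]⟩
    · exact ⟨-1, by norm_num, by simp [e]⟩
  have hdd' : (d : K) * d = 1 := by exact_mod_cast hdd
  have CH : ∀ u, γ.mulVec (γ.mulVec u) = (γ 0 0 + γ 1 1) • γ.mulVec u - (d : K) • u := by
    intro u
    rw [← e]
    ext i
    fin_cases i <;>
      simp [Matrix.mulVec, dotProduct, Fin.sum_univ_two, Matrix.det_fin_two] <;> ring
  have hu1 := hγ _ hu
  have hu2 := hγ _ hu1
  have hu3 := hγ _ hu2
  have : u = -(γ.mulVec (γ.mulVec (γ.mulVec (γ.mulVec u))) +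
      ((2 * d + P : ℤ) : K) • γ.mulVec (γ.mulVec u)
      - (S : K) • γ.mulVec (γ.mulVec (γ.mulVec u)) - ((S * d : ℤ) : K) • γ.mulVec u) := by
    have c1 := CH u
    have c2 := CH (γ.mulVec u)
    have c3 := CH (γ.mulVec (γ.mulVec u))
    set w := γ.mulVec u
    set w1 := γ.mulVec w
    set w2 := γ.mulVec w1
    set w3 := γ.mulVec w2
    ext i
    have d1 := congrFun c1 i
    have d2 := congrFun c2 i
    have d3 := congrFun c3 i
    simp only [Pi.sub_apply, Pi.smul_apply, smul_eq_mul, Pi.neg_apply, Pi.add_apply] at d1 d2 d3 ⊢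
    push_cast
    linear_combination d3 + (γ 0 0 + γ 1 1 - S : K) * d2 + w1 i * hSP + (d : K) * d1 - u i * hdd'
  rw [this]
  exact neg_mem (sub_mem (sub_mem (add_mem hu3 (intCast_smul_mem _ hu1)) (intCast_smul_mem _ hu2))
    (intCast_smul_mem _ hu))

end

/-- The invariants `(𝔟, 𝔟', ε)` of a line with respect to a lattice of `K²` whose determinants
span `Δ` and whose multiplier ring has conductor `f`. -/
def OrbData (Δ : Submodule ℤ K) (f : ℕ) : Type :=
  {p : (Submodule ℤ K × Submodule ℤ K) × K // ∃ b b' N, IsLC p.1.1 b ∧ IsLC p.1.2 b' ∧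
    b.lcm b' * N = f ∧ IsOrd (p.1.1 * p.1.2) p.2 N ∧
      Δ = p.1.1 * p.1.2 ⊔ Submodule.span ℤ {p.2}}

/-- Rescaling `(𝔟, 𝔟', ε)` to `(t 𝔟, t⁻¹ 𝔟', ±ε)`. -/
def OrbRel (Δ : Submodule ℤ K) (f : ℕ) (p q : OrbData Δ f) : Prop :=
  ∃ t : K, t ≠ 0 ∧ ∃ σ : K, (σ = 1 ∨ σ = -1) ∧ q.1.1.1 = t • p.1.1.1 ∧ q.1.1.2 = t⁻¹ • p.1.1.2 ∧
    q.1.2 - σ * p.1.2 ∈ p.1.1.1 * p.1.1.2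

lemma smul_mul_inv_smul {t : K} (ht : t ≠ 0) (L L' : Submodule ℤ K) :
    (t • L) * (t⁻¹ • L') = L * L' := by
  rw [smul_lat_mul, mul_smul_lat, smul_smul, mul_inv_cancel₀ ht, one_smul]

lemma sign_mul_mem {σ x : K} (hσ : σ = 1 ∨ σ = -1) {L : Submodule ℤ K} (hx : x ∈ L) :
    σ * x ∈ L := by
  rcases hσ with rfl | rfl
  · rwa [one_mul]
  · simpa using hx

lemma mul_self_of_sign {σ : K} (hσ : σ = 1 ∨ σ = -1) : σ * σ = 1 := by
  rcases hσ with rfl | rfl <;> simp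

lemma orbRel_equivalence (Δ : Submodule ℤ K) (f : ℕ) : Equivalence (OrbRel Δ f) where
  refl p := ⟨1, one_ne_zero, 1, Or.inl rfl, by simp, by simp, by simp⟩
  symm := by
    rintro p q ⟨t, ht, σ, hσ, e1, e2, h⟩
    refine ⟨t⁻¹, inv_ne_zero ht, σ, hσ, ?_, ?_, ?_⟩
    · rw [e1, smul_smul, inv_mul_cancel₀ ht, one_smul]
    · rw [e2, smul_smul, inv_inv, mul_inv_cancel₀ ht, one_smul]
    · rw [e1, e2, smul_mul_inv_smul ht]
      have := neg_mem (sign_mul_mem hσ h)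
      convert this using 1
      linear_combination (-p.1.2) * mul_self_of_sign hσ
  trans := by
    rintro p q r ⟨t, ht, σ, hσ, e1, e2, h⟩ ⟨t', ht', σ', hσ', e1', e2', h'⟩
    refine ⟨t' * t, mul_ne_zero ht' ht, σ' * σ, ?_, ?_, ?_, ?_⟩
    · rcases hσ with rfl | rfl <;> rcases hσ' with rfl | rfl <;> simp
    · rw [e1', e1, smul_smul]
    · rw [e2', e2, smul_smul, mul_inv]
    · rw [e1, e2, smul_mul_inv_smul ht] at h'
      have := add_mem h' (sign_mul_mem hσ' h)
      convert this using 1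
      ring

section
variable [hK : Fact (Module.finrank ℚ K = 2)]

lemma isDec_dsum_props {𝔞 𝔞' : Submodule ℤ K} {c c' : ℕ} (h : IsLC 𝔞 c) (h' : IsLC 𝔞' c') :
    IsLatTwo (dsum 𝔞 𝔞') ∧ IsMult (dsum 𝔞 𝔞') (c.lcm c') ∧ dtSpan (dsum 𝔞 𝔞') = 𝔞 * 𝔞' := by
  obtain ⟨y₁, y₂, hb⟩ := h'.lat.exists_isBas
  have hD := isDec_dsum (𝔞 := 𝔞) hb
  have e0 : dt ![(0 : K), y₁] ![0, y₂] = 0 := by simp [dt]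
  refine ⟨hD.isLatTwo h.lat h'.lat, ?_, ?_⟩
  · have := hD.isMult h h' (N := 1) (by intro y; rw [e0]; simp)
    rwa [mul_one] at this
  · rw [hD.dtSpan_eq, e0, Submodule.span_singleton_eq_bot.2 rfl, sup_bot_eq]

lemma exists_mulVec_mem_iff {M M' : Submodule ℤ (Fin 2 → K)} (hM : IsLatTwo M) (hM' : IsLatTwo M')
    {f : ℕ} (hf : 0 < f) (hm : IsMult M f) (hm' : IsMult M' f) (hΔ : dtSpan M = dtSpan M') :
    ∃ γ : Matrix (Fin 2) (Fin 2) K, γ.det = 1 ∧ ∀ u, u ∈ M ↔ γ.mulVec u ∈ M' := by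
  obtain ⟨v, w, hvw, h⟩ := hM.exists_split hf hm
  obtain ⟨v', w', hvw', h'⟩ := hM'.exists_split hf hm'
  obtain ⟨γ, rfl, rfl, hγ⟩ := exists_matrix (m := w) (by rw [hvw]; exact one_ne_zero) v' w'
  rw [hvw, hvw', mul_one] at hγ
  refine ⟨γ, hγ, fun u => ?_⟩
  have key : ∀ α κ : K, γ.mulVec (α • v + κ • w) = α • γ.mulVec v + κ • γ.mulVec w := by
    intro α κ
    rw [Matrix.mulVec_add, Matrix.mulVec_smul, Matrix.mulVec_smul]
  rw [h, h', hΔ]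
  constructor
  · rintro ⟨α, hα, κ, hκ, rfl⟩
    exact ⟨α, hα, κ, hκ, key α κ⟩
  · rintro ⟨α, hα, κ, hκ, e⟩
    rw [← key] at e
    exact ⟨α, hα, κ, hκ, Matrix.mulVec_injective_of_det_ne_zero (by rw [hγ]; exact one_ne_zero) e⟩

lemma IsDec.lat_eq {M : Submodule ℤ (Fin 2 → K)} {v m₁ m₂ n₁ n₂ : Fin 2 → K}
    {𝔟 𝔟' 𝔠 𝔠' : Submodule ℤ K} (h : IsDec M v m₁ m₂ 𝔟 𝔟') (h' : IsDec M v n₁ n₂ 𝔠 𝔠') :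
    𝔟 = 𝔠 ∧ 𝔟' = 𝔠' := by
  constructor
  · ext z; rw [h.mem_left, h'.mem_left]
  · ext z; rw [h.mem_right, h'.mem_right]

lemma IsDec.exists_matrix_map {M : Submodule ℤ (Fin 2 → K)} {v m₁ m₂ w n₁ n₂ : Fin 2 → K}
    {𝔟 𝔟' : Submodule ℤ K} (h : IsDec M v m₁ m₂ 𝔟 𝔟') (h' : IsDec M w n₁ n₂ 𝔟 𝔟') {σ : K}
    (hσ : σ = 1 ∨ σ = -1) (hε : dt n₁ n₂ - σ * dt m₁ m₂ ∈ 𝔟 * 𝔟') :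
    ∃ γ : Matrix (Fin 2) (Fin 2) K, (γ.det = 1 ∨ γ.det = -1) ∧ γ.mulVec v = w ∧
      ∀ u ∈ M, γ.mulVec u ∈ M := by
  have h1 := h.bas.left_ne
  obtain ⟨k₁, k₂, hk, e1, e2⟩ := h'.exists_of_isBas h.bas
  obtain ⟨τ, hτ, hτε⟩ := h'.exists_sign hk
  have hd : τ * σ = 1 ∨ τ * σ = -1 := by
    rcases hσ with rfl | rfl <;> rcases hτ with rfl | rfl <;> simp
  set d := τ * σ with hddef
  have hδ : d * dt m₁ m₂ - dt k₁ k₂ ∈ 𝔟 * 𝔟' := by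
    have := neg_mem (add_mem hτε (sign_mul_mem hτ hε))
    convert this using 1
    rw [hddef]; ring
  obtain ⟨l₁, l₂, hl, f1, f2, f3⟩ := hk.exists_adjust hδ
  rw [e1] at f1
  rw [e2] at f2
  rw [add_sub_cancel] at f3
  have hdd := mul_self_of_sign hd
  obtain ⟨γ, g1, g2, g3⟩ := exists_matrix h1 w (d • l₁)
  have hdet : γ.det = d := by
    rw [dt_smul_right, f1] at g3
    exact mul_right_cancel₀ h1 g3
  have g4 : γ.mulVec m₂ = d • l₂ := by
    have hne : dt w l₁ ≠ 0 := by rw [f1]; exact h1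
    refine vec_ext hne ?_ ?_
    · rw [← g1, dt_mulVec, hdet, g1, dt_smul_right, f2]
    · have : l₁ = d • γ.mulVec m₁ := by rw [g2, smul_smul, hdd, one_smul]
      rw [dt_smul_left, dt_swap l₂, f3]
      rw [this, dt_smul_right, dt_mulVec, hdet, dt_swap m₂]
      ring
  refine ⟨γ, by rw [hdet]; exact hd, g1, fun u hu => ?_⟩
  obtain ⟨z, hz, a, b, rfl⟩ := (h.mem _).1 hu
  rw [Matrix.mulVec_add, Matrix.mulVec_add, Matrix.mulVec_smul, Matrix.mulVec_smul,
    Matrix.mulVec_smul, g1, g2, g4]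
  have hs : ∀ x ∈ M, d • x ∈ M := by
    intro x hx
    rcases hd with e | e <;> rw [e]
    · rwa [one_smul]
    · simpa using hx
  exact add_mem (add_mem ((hl.mem_left _).1 hz) (intCast_smul_mem a (hs _ hl.fst_mem)))
    (intCast_smul_mem b (hs _ hl.snd_mem))

lemma nonempty_quot_gammaLatRel {𝔞 𝔞' : Submodule ℤ K} {c c' : ℕ} (h𝔞 : IsLC 𝔞 c)
    (h𝔞' : IsLC 𝔞' c') :
    Nonempty (Quot (gammaLatRel K 𝔞 𝔞' c c' (c.gcd c')) ≃
      Quot (OrbRel (𝔞 * 𝔞') (c.lcm c'))) := by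
  obtain ⟨hM, hm, hΔ⟩ := isDec_dsum_props h𝔞 h𝔞'
  have hf : 0 < c.lcm c' := Nat.lcm_pos h𝔞.pos h𝔞'.pos
  refine nonempty_quot_equiv (orbRel_equivalence _ _)
    (fun x a => ∃ (v m₁ m₂ : Fin 2 → K) (hv : v ≠ 0), x = Projectivization.mk K v hv ∧
      IsDec (dsum 𝔞 𝔞') v m₁ m₂ a.1.1.1 a.1.1.2 ∧ dt m₁ m₂ = a.1.2) ?_ ?_ ?_
  · intro x
    induction x using Projectivization.ind with
    | h v hv =>
      obtain ⟨m₁, m₂, 𝔟, 𝔟', b, b', h, hb, hb'⟩ := hM.exists_isDec hv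
      obtain ⟨N, hN, hord⟩ := h.exists_isOrd hb hb' hm hf
      exact ⟨⟨((𝔟, 𝔟'), dt m₁ m₂), b, b', N, hb, hb', hN, hord, by rw [← hΔ, h.dtSpan_eq]⟩,
        v, m₁, m₂, hv, rfl, h, rfl⟩
  · rintro ⟨⟨⟨𝔟, 𝔟'⟩, ε⟩, b, b', N, hb, hb', hN, hord, hΔ'⟩
    obtain ⟨y₁, y₂, hy⟩ := hb'.lat.exists_isBas
    obtain ⟨M, v, m₁, m₂, h, rfl⟩ := exists_isDec_of_isBas 𝔟 hy ε
    have hm' := h.isMult hb hb' hord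
    rw [hN] at hm'
    obtain ⟨γ, hγ, hγM⟩ := exists_mulVec_mem_iff (h.isLatTwo hb.lat hb'.lat) hM hf hm' hm
      (by rw [hΔ, hΔ', h.dtSpan_eq])
    have h' := h.map (Or.inl hγ) hγM
    exact ⟨_, _, _, _, h'.ne, rfl, h', by rw [dt_mulVec, hγ, one_mul]⟩
  · rintro _ _ ⟨⟨⟨𝔟, 𝔟'⟩, ε⟩, hp⟩ ⟨⟨⟨𝔠, 𝔠'⟩, η⟩, hq⟩ ⟨v, m₁, m₂, hv, rfl, h, e⟩
      ⟨w, n₁, n₂, hw, rfl, h', e'⟩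
    dsimp only at h e h' e'
    rw [gammaLatRel_iff h𝔞 h𝔞']
    constructor
    · rintro ⟨γ, hd, hγ, v₀, hv₀, hw₀, e1, e2⟩
      obtain ⟨a, rfl⟩ := (Projectivization.mk_eq_mk_iff' _ _ _ _ _).1 e1
      obtain ⟨a', e3⟩ := (Projectivization.mk_eq_mk_iff' _ _ _ _ _).1 e2.symm
      have ha : a ≠ 0 := by rintro rfl; simp at hv
      have ha' : a' ≠ 0 := by rintro rfl; rw [zero_smul] at e3; exact hw₀ e3.symm
      have h1 := h.map hd (mem_dsum_iff_mulVec h𝔞 h𝔞' hd hγ)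
      have h2 := h'.smul (mul_ne_zero ha ha')
      have e4 : γ.mulVec (a • v₀) = (a * a') • w := by
        rw [Matrix.mulVec_smul, ← e3, smul_smul]
      rw [e4] at h1
      obtain ⟨e5, e6⟩ := h1.lat_eq h2
      obtain ⟨σ, hσ, hε⟩ := h1.exists_sign (e5 ▸ e6 ▸ h2)
      refine ⟨a * a', mul_ne_zero ha ha', σ * γ.det, ?_, ?_, ?_, ?_⟩
      · rcases hσ with rfl | rfl <;> rcases hd with hd | hd <;> simp [hd]
      · change 𝔠 = (a * a') • 𝔟
        rw [e5, smul_smul, mul_inv_cancel₀ (mul_ne_zero ha ha'), one_smul]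
      · change 𝔠' = (a * a')⁻¹ • 𝔟'
        rw [e6, smul_smul, inv_mul_cancel₀ (mul_ne_zero ha ha'), one_smul]
      · rw [dt_mulVec, e, e', ← mul_assoc] at hε
        exact hε
    · rintro ⟨t, ht, σ, hσ, e1, e2, hε⟩
      dsimp only at e1 e2 hε
      have h2 := h'.smul ht
      rw [e1, e2, smul_smul, smul_smul, inv_mul_cancel₀ ht, mul_inv_cancel₀ ht, one_smul,
        one_smul] at h2
      rw [← e, ← e'] at hε
      obtain ⟨γ, hd, hγv, hγ⟩ := h.exists_matrix_map h2 hσ hε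
      refine ⟨γ, hd, hγ, v, hv, by rw [hγv]; exact h2.ne, rfl, ?_⟩
      rw [Projectivization.mk_eq_mk_iff']
      exact ⟨t⁻¹, by rw [hγv, smul_smul, inv_mul_cancel₀ ht, one_smul]⟩

end

/-- `ε` generates `Δ` modulo `L` and has order `N` modulo `L`. -/
def IsGen (Δ L : Submodule ℤ K) (N : ℕ) (ε : K) : Prop :=
  IsOrd L ε N ∧ Δ = L ⊔ Submodule.span ℤ {ε}

lemma IsGen.mem_iff {Δ L : Submodule ℤ K} {N : ℕ} {ε : K} (h : IsGen Δ L N ε) (x : K) :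
    x ∈ Δ ↔ ∃ k : ℤ, x - k * ε ∈ L := by
  rw [h.2, Submodule.mem_sup]
  constructor
  · rintro ⟨l, hl, y, hy, rfl⟩
    obtain ⟨k, rfl⟩ := Submodule.mem_span_singleton.1 hy
    exact ⟨k, by rw [zsmul_eq_mul, add_sub_cancel_right]; exact hl⟩
  · rintro ⟨k, hk⟩
    exact ⟨_, hk, k • ε, Submodule.smul_mem _ _ (Submodule.mem_span_singleton_self _), by
      rw [zsmul_eq_mul]; ring⟩

lemma isGen_of {Δ L : Submodule ℤ K} {N : ℕ} {ε : K} (h : IsOrd L ε N)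
    (hm : ∀ x, x ∈ Δ ↔ ∃ k : ℤ, x - k * ε ∈ L) : IsGen Δ L N ε := by
  refine ⟨h, le_antisymm (fun x hx => ?_) (sup_le (fun x hx => ?_) ?_)⟩
  · obtain ⟨k, hk⟩ := (hm x).1 hx
    refine Submodule.mem_sup.2 ⟨_, hk, k • ε,
      Submodule.smul_mem _ _ (Submodule.mem_span_singleton_self _), by rw [zsmul_eq_mul]; ring⟩
  · exact (hm x).2 ⟨0, by simpa using hx⟩
  · rw [Submodule.span_singleton_le_iff_mem, hm]
    exact ⟨1, by simp⟩

lemma IsGen.le {Δ L : Submodule ℤ K} {N : ℕ} {ε : K} (h : IsGen Δ L N ε) : L ≤ Δ :=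
  h.2 ▸ le_sup_left

lemma IsGen.mem {Δ L : Submodule ℤ K} {N : ℕ} {ε : K} (h : IsGen Δ L N ε) : ε ∈ Δ :=
  (h.mem_iff ε).2 ⟨1, by simp⟩

lemma IsGen.natCast_smul_le {Δ L : Submodule ℤ K} {N : ℕ} {ε : K} (h : IsGen Δ L N ε) :
    (N : K) • Δ ≤ L := by
  rw [smul_lat_le]
  intro x hx
  obtain ⟨k, hk⟩ := (h.mem_iff x).1 hx
  have h1 := L.smul_mem (N : ℤ) hk
  have h2 := (h.1 (N * k)).2 ⟨k, rfl⟩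
  convert add_mem h1 h2 using 1
  rw [zsmul_eq_mul]; push_cast; ring

lemma isGen_smul_iff {Δ L : Submodule ℤ K} {N : ℕ} {ε t : K} (ht : t ≠ 0) :
    IsGen (t • Δ) (t • L) N (t * ε) ↔ IsGen Δ L N ε := by
  have e : ∀ y : ℤ, (y : K) * (t * ε) = t * (y * ε) := fun y => by ring
  constructor
  · intro h
    refine isGen_of (fun y => ?_) fun x => ?_
    · rw [← h.1 y, e, mul_mem_smul_lat ht]
    · rw [← mul_mem_smul_lat ht, h.mem_iff]
      simp only [e, ← mul_sub, mul_mem_smul_lat ht]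
  · intro h
    refine isGen_of (fun y => ?_) fun x => ?_
    · rw [← h.1 y, e, mul_mem_smul_lat ht]
    · have : x = t * (t⁻¹ * x) := by field_simp
      rw [this, mul_mem_smul_lat ht, h.mem_iff]
      simp only [e, ← mul_sub, mul_mem_smul_lat ht]

section
variable [hK : Fact (Module.finrank ℚ K = 2)]

lemma IsGen.dual {Δ L : Submodule ℤ K} (hΔ : IsLat K Δ) {N : ℕ} (hN : 0 < N) {ε : K}
    (h : IsGen Δ L N ε) : ∃ η, IsGen L ((N : K) • Δ) N η := by
  have hN0 : (N : K) ≠ 0 := by exact_mod_cast hN.ne'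
  obtain ⟨d₁, d₂, hd⟩ := hΔ.exists_isBas
  obtain ⟨p, hp⟩ := (h.mem_iff _).1 hd.left_mem
  obtain ⟨q, hq⟩ := (h.mem_iff _).1 hd.right_mem
  obtain ⟨u, v, huv⟩ := (hd.mem _).1 h.mem
  have hL : ∀ x y : ℤ, (x : K) * d₁ + y * d₂ ∈ L ↔ (N : ℤ) ∣ x * p + y * q := by
    intro x y
    have h1 := add_mem (L.smul_mem x hp) (L.smul_mem y hq)
    have e : (x : K) * d₁ + y * d₂ =
        x • (d₁ - p * ε) + y • (d₂ - q * ε) + ((x * p + y * q : ℤ) : K) * ε := by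
      rw [zsmul_eq_mul, zsmul_eq_mul]; push_cast; ring
    rw [← h.1, e, add_mem_cancel_left h1]
  have hNΔ : ∀ x y : ℤ, (x : K) * d₁ + y * d₂ ∈ (N : K) • Δ ↔ (N : ℤ) ∣ x ∧ (N : ℤ) ∣ y := by
    intro x y
    rw [mem_smul_lat]
    constructor
    · rintro ⟨z, hz, e⟩
      obtain ⟨a, b, rfl⟩ := (hd.mem _).1 hz
      have := hd.ext_coeff (a := x) (b := y) (a' := N * a) (b' := N * b) (by
        push_cast; rw [← e]; ring)
      exact ⟨⟨a, this.1⟩, ⟨b, this.2⟩⟩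
    · rintro ⟨⟨a, rfl⟩, ⟨b, rfl⟩⟩
      exact ⟨a * d₁ + b * d₂, (hd.mem _).2 ⟨a, b, rfl⟩, by push_cast; ring⟩
  have hone : (N : ℤ) ∣ u * p + v * q - 1 := by
    have h1 := add_mem (L.smul_mem u hp) (L.smul_mem v hq)
    rw [← dvd_neg, ← h.1]
    convert h1 using 1
    rw [zsmul_eq_mul, zsmul_eq_mul]; push_cast; linear_combination huv
  obtain ⟨j, hj⟩ := hone
  refine ⟨q * d₁ - p * d₂, isGen_of (fun k => ?_) fun x => ?_⟩
  · have e : (k : K) * (q * d₁ - p * d₂) = (k * q : ℤ) * d₁ + (-(k * p) : ℤ) * d₂ := by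
      push_cast; ring
    rw [e, hNΔ]
    constructor
    · rintro ⟨⟨a, ha⟩, ⟨b, hb⟩⟩
      exact ⟨v * a - u * b - k * j, by linear_combination (-k) * hj + v * ha - u * hb⟩
    · rintro ⟨a, rfl⟩
      exact ⟨⟨a * q, by ring⟩, ⟨-(a * p), by ring⟩⟩
  · constructor
    · intro hx
      obtain ⟨a, b, rfl⟩ := (hd.mem _).1 (h.le hx)
      obtain ⟨i, hi⟩ := (hL a b).1 hx
      refine ⟨a * v - b * u, ?_⟩
      have e : (a : K) * d₁ + b * d₂ - ((a * v - b * u : ℤ) : K) * (q * d₁ - p * d₂) =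
        (a - (a * v - b * u) * q : ℤ) * d₁ + (b + (a * v - b * u) * p : ℤ) * d₂ := by
        push_cast; ring
      rw [e, hNΔ]
      exact ⟨⟨u * i - a * j, by linear_combination (-a) * hj + u * hi⟩,
        ⟨v * i - b * j, by linear_combination (-b) * hj + v * hi⟩⟩
    · rintro ⟨k, hk⟩
      have h1 : (q : K) * d₁ - p * d₂ ∈ L := by
        have := (hL q (-p)).2 ⟨0, by ring⟩
        convert this using 1
        push_cast; ring
      have := add_mem (h.natCast_smul_le hk) (L.smul_mem k h1)
      rwa [zsmul_eq_mul, sub_add_cancel] at this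

lemma exists_isGen_iff {Δ L : Submodule ℤ K} (hΔ : IsLat K Δ) (hL : IsLat K L) {N : ℕ}
    (hN : 0 < N) : (∃ ε, IsGen Δ L N ε) ↔ ∃ η, IsGen L ((N : K) • Δ) N η := by
  have hN0 : (N : K) ≠ 0 := by exact_mod_cast hN.ne'
  constructor
  · rintro ⟨ε, h⟩
    exact h.dual hΔ hN
  · rintro ⟨η, h⟩
    obtain ⟨ζ, hζ⟩ := h.dual hL hN
    obtain ⟨ε, hε, rfl⟩ := mem_smul_lat.1 hζ.mem
    exact ⟨ε, (isGen_smul_iff hN0).1 hζ⟩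

end

lemma isAddCyclic_quotLat_iff {L L' : Submodule ℤ K} {N : ℕ} :
    (L ≤ L' ∧ IsAddCyclic (quotLat K L L') ∧ Nat.card (quotLat K L L') = N) ↔
      ∃ ε, IsGen L' L N ε := by
  have hmk : ∀ x : L', (Submodule.Quotient.mk x : L' ⧸ L.comap L'.subtype) = 0 ↔ (x : K) ∈ L :=
    fun x => Submodule.Quotient.mk_eq_zero _
  constructor
  · rintro ⟨hle, ⟨g, hg⟩, hcard⟩
    change L' ⧸ L.comap L'.subtype at g
    obtain ⟨⟨ε, hε⟩, rfl⟩ := Submodule.Quotient.mk_surjective _ g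
    have hg : ∀ x : L' ⧸ L.comap L'.subtype,
      x ∈ AddSubgroup.zmultiples (Submodule.Quotient.mk ⟨ε, hε⟩) := hg
    have ho : addOrderOf (Submodule.Quotient.mk ⟨ε, hε⟩ : L' ⧸ L.comap L'.subtype) = N :=
      (addOrderOf_eq_card_of_forall_mem_zmultiples hg).trans hcard
    refine ⟨ε, isGen_of (fun y => ?_) fun x => ⟨fun hx => ?_, ?_⟩⟩
    · rw [← ho, addOrderOf_dvd_iff_zsmul_eq_zero]
      refine Iff.trans ?_ (hmk (y • ⟨ε, hε⟩)).symm
      simp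
    · obtain ⟨k, hk⟩ := AddSubgroup.mem_zmultiples_iff.1
        (hg (Submodule.Quotient.mk ⟨x, hx⟩ : L' ⧸ L.comap L'.subtype))
      refine ⟨k, ?_⟩
      have : (Submodule.Quotient.mk (⟨x, hx⟩ - k • ⟨ε, hε⟩) : L' ⧸ L.comap L'.subtype) = 0 := by
        rw [Submodule.Quotient.mk_sub, sub_eq_zero]; exact hk.symm
      simpa using (hmk _).1 this
    · rintro ⟨k, hk⟩
      have := add_mem (hle hk) (L'.smul_mem k hε)
      rwa [zsmul_eq_mul, sub_add_cancel] at this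
  · rintro ⟨ε, h⟩
    let g : L' ⧸ L.comap L'.subtype := Submodule.Quotient.mk ⟨ε, h.mem⟩
    have hg : ∀ x : L' ⧸ L.comap L'.subtype, x ∈ AddSubgroup.zmultiples g := by
      intro x
      obtain ⟨⟨x, hx⟩, rfl⟩ := Submodule.Quotient.mk_surjective _ x
      obtain ⟨k, hk⟩ := (h.mem_iff x).1 hx
      refine AddSubgroup.mem_zmultiples_iff.2 ⟨k, ?_⟩
      have : (Submodule.Quotient.mk (⟨x, hx⟩ - k • ⟨ε, h.mem⟩) : L' ⧸ L.comap L'.subtype) = 0 := by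
        rw [hmk]; simpa using hk
      rw [Submodule.Quotient.mk_sub, sub_eq_zero] at this
      exact this.symm
    refine ⟨h.le, ⟨g, hg⟩, ?_⟩
    have ho : addOrderOf g = Nat.card (quotLat K L L') :=
      addOrderOf_eq_card_of_forall_mem_zmultiples hg
    rw [← ho]
    apply Nat.dvd_antisymm
    · apply addOrderOf_dvd_of_nsmul_eq_zero
      have : (Submodule.Quotient.mk (N • ⟨ε, h.mem⟩) : L' ⧸ L.comap L'.subtype) = 0 := by
        rw [hmk]
        simpa using (h.1 N).2 dvd_rfl
      exact this
    · rw [← Int.natCast_dvd_natCast, ← h.1]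
      have h0 : (Submodule.Quotient.mk (addOrderOf g • ⟨ε, h.mem⟩) : L' ⧸ L.comap L'.subtype) = 0 :=
        addOrderOf_nsmul_eq_zero g
      simpa using (hmk _).1 h0

/-- Equality up to sign of generators modulo `L`. -/
def GenRel (Δ L : Submodule ℤ K) (N : ℕ) (ε ε' : {ε : K // IsGen Δ L N ε}) : Prop :=
  ∃ σ : K, (σ = 1 ∨ σ = -1) ∧ ε'.1 - σ * ε.1 ∈ L

lemma genRel_equivalence (Δ L : Submodule ℤ K) (N : ℕ) : Equivalence (GenRel Δ L N) where
  refl ε := ⟨1, Or.inl rfl, by simp⟩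
  symm := by
    rintro ε ε' ⟨σ, hσ, h⟩
    refine ⟨σ, hσ, ?_⟩
    have := L.neg_mem (sign_mul_mem hσ h)
    convert this using 1
    linear_combination (-ε.1) * mul_self_of_sign hσ
  trans := by
    rintro ε ε' ε'' ⟨σ, hσ, h⟩ ⟨τ, hτ, h'⟩
    refine ⟨τ * σ, by rcases hσ with rfl | rfl <;> rcases hτ with rfl | rfl <;> simp, ?_⟩
    convert add_mem h' (sign_mul_mem hτ h) using 1
    ring

lemma mem_zpowers_neg_one {N : ℕ} {u : (ZMod N)ˣ} :
    u ∈ Subgroup.zpowers (-1 : (ZMod N)ˣ) ↔ u = 1 ∨ u = -1 := by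
  rw [Subgroup.mem_zpowers_iff]
  constructor
  · rintro ⟨k, rfl⟩
    rcases Int.even_or_odd k with h | h
    · exact Or.inl h.neg_one_zpow
    · exact Or.inr h.neg_one_zpow
  · rintro (rfl | rfl)
    · exact ⟨0, zpow_zero _⟩
    · exact ⟨1, zpow_one _⟩

lemma IsOrd.sub_mul_mem_iff {L : Submodule ℤ K} {N : ℕ} {ε₀ ε ε' : K} (h : IsOrd L ε₀ N) {k k' : ℤ}
    (hk : ε - k * ε₀ ∈ L) (hk' : ε' - k' * ε₀ ∈ L) (s : ℤ) :
    ε' - s * ε ∈ L ↔ (k' : ZMod N) = s * k := by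
  have h1 := sub_mem hk' (L.smul_mem s hk)
  have e : ε' - s * ε = ε' - k' * ε₀ - s • (ε - k * ε₀) + ((k' - s * k : ℤ) : K) * ε₀ := by
    rw [zsmul_eq_mul]; push_cast; ring
  rw [e, add_mem_cancel_left h1, h, ← ZMod.intCast_zmod_eq_zero_iff_dvd]
  push_cast
  exact sub_eq_zero

lemma IsGen.nonempty_equiv {Δ L : Submodule ℤ K} {N : ℕ} {ε₀ : K} (h : IsGen Δ L N ε₀) :
    Nonempty (Quot (GenRel Δ L N) ≃ (ZMod N)ˣ ⧸ Subgroup.zpowers (-1 : (ZMod N)ˣ)) := by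
  have hq : Nonempty (Quot (GenRel Δ L N) ≃ Quot fun u u' : (ZMod N)ˣ => u' = u ∨ u' = -u) := by
    refine nonempty_quot_equiv ⟨fun u => Or.inl rfl, ?_, ?_⟩
      (fun ε (u : (ZMod N)ˣ) => ∃ k : ℤ, (u : ZMod N) = k ∧ ε.1 - k * ε₀ ∈ L) ?_ ?_ ?_
    · rintro u u' (rfl | rfl) <;> simp
    · rintro u u' u'' (rfl | rfl) (rfl | rfl) <;> simp
    · rintro ⟨ε, hε⟩
      obtain ⟨k, hk⟩ := (h.mem_iff ε).1 hε.mem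
      obtain ⟨j, hj⟩ := (hε.mem_iff ε₀).1 h.mem
      have h1 : (1 : ZMod N) = j * k := by
        have := (h.1.sub_mul_mem_iff (ε' := ε₀) (k' := 1) hk (by simp) j).1 hj
        simpa using this
      exact ⟨⟨k, j, by rw [mul_comm, ← h1], h1.symm⟩, k, rfl, hk⟩
    · intro u
      obtain ⟨k, hk⟩ := ZMod.intCast_surjective (u : ZMod N)
      obtain ⟨j, hj⟩ := ZMod.intCast_surjective ((u⁻¹ : (ZMod N)ˣ) : ZMod N)
      have hjk : ((j : ℤ) : ZMod N) * k = 1 := by rw [hk, hj]; exact u.inv_mul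
      have hd : (N : ℤ) ∣ 1 - j * k := by
        rw [← ZMod.intCast_zmod_eq_zero_iff_dvd]; push_cast; rw [hjk, sub_self]
      refine ⟨⟨k * ε₀, isGen_of (fun y => ?_) fun x => ?_⟩, k, hk.symm, by simp⟩
      · have e : (y : K) * (k * ε₀) = (y * k : ℤ) * ε₀ := by push_cast; ring
        rw [e, h.1]
        constructor
        · intro h2
          have := dvd_add (h2.mul_right j) (hd.mul_left y)
          rwa [show y * k * j + y * (1 - j * k) = y by ring] at this
        · exact fun h2 => h2.mul_right k
      · rw [h.mem_iff]
        constructor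
        · rintro ⟨i, hi⟩
          refine ⟨i * j, ?_⟩
          have := add_mem hi ((h.1 (i * (1 - j * k))).2 (hd.mul_left i))
          convert this using 1
          push_cast; ring
        · rintro ⟨i, hi⟩
          refine ⟨i * k, ?_⟩
          convert hi using 1
          push_cast; ring
    · rintro ε ε' u u' ⟨k, hu, hk⟩ ⟨k', hu', hk'⟩
      have h1 := h.1.sub_mul_mem_iff hk hk' 1
      have h2 := h.1.sub_mul_mem_iff hk hk' (-1)
      rw [← hu, ← hu'] at h1 h2
      simp only [Int.cast_one, Int.cast_neg, one_mul, neg_mul] at h1 h2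
      constructor
      · rintro ⟨σ, rfl | rfl, hσ⟩
        · exact Or.inl (Units.ext (h1.1 (by simpa using hσ)))
        · exact Or.inr (Units.ext (by rw [Units.val_neg]; exact h2.1 (by simpa using hσ)))
      · rintro (rfl | rfl)
        · exact ⟨1, Or.inl rfl, by simpa using h1.2 rfl⟩
        · exact ⟨-1, Or.inr rfl, by simpa using h2.2 (Units.val_neg _)⟩
  refine hq.map fun e => e.trans (Quot.congrRight fun u u' => ?_)
  rw [QuotientGroup.leftRel_apply, mem_zpowers_neg_one, inv_mul_eq_one, inv_mul_eq_iff_eq_mul,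
    mul_neg, mul_one, eq_comm]

lemma IsGen.card_quot {Δ L : Submodule ℤ K} {N : ℕ} {ε₀ : K} (h : IsGen Δ L N ε₀) :
    Nat.card (Quot (GenRel Δ L N)) = phiU N :=
  Nat.card_congr h.nonempty_equiv.some

/-- The sublattices `L` of conductor `g` of `Δ` with `Δ / L` cyclic of order `N`. -/
def CycSub (Δ : Submodule ℤ K) (g N : ℕ) : Type :=
  {L : Submodule ℤ K // IsLC L g ∧ ∃ ε, IsGen Δ L N ε}

section
variable [hK : Fact (Module.finrank ℚ K = 2)]

lemma finite_cycSub {Δ : Submodule ℤ K} (hΔ : IsLat K Δ) {N : ℕ} (hN : 0 < N) (g : ℕ) :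
    Finite (CycSub Δ g N) := by
  have := hΔ.finite_between hN.ne'
  exact Finite.of_injective
    (fun L : CycSub Δ g N => (⟨L.1, L.2.2.choose_spec.natCast_smul_le, L.2.2.choose_spec.le⟩ :
      {L' : Submodule ℤ K // (N : K) • Δ ≤ L' ∧ L' ≤ Δ}))
    fun L L' h => Subtype.ext (congrArg (fun z => z.1) h)

lemma card_cycSub {Δ : Submodule ℤ K} (hΔ : IsLat K Δ) {N : ℕ} (hN : 0 < N) (g : ℕ) :
    Nat.card (CycSub Δ g N) = cnt K ((N : K) • Δ) g N := by
  refine Nat.card_congr (Equiv.subtypeEquivRight fun L => ?_)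
  constructor
  · rintro ⟨hL, h⟩
    obtain ⟨h1, h2, h3⟩ := isAddCyclic_quotLat_iff.2 ((exists_isGen_iff hΔ hL.lat hN).1 h)
    exact ⟨h1, hL.lat, h2, h3, hL.cond⟩
  · rintro ⟨h1, hL, h2, h3, hc⟩
    exact ⟨⟨hL, hc⟩, (exists_isGen_iff hΔ hL hN).2 (isAddCyclic_quotLat_iff.1 ⟨h1, h2, h3⟩)⟩

end

section
variable [hK : Fact (Module.finrank ℚ K = 2)]

/-- The classes of triples `(𝔟, 𝔟', ε)`, sorted by the conductors of `𝔟`, `𝔟'` and by `𝔟𝔟'`. -/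
abbrev OrbClass (Δ : Submodule ℤ K) (f : ℕ) : Type :=
  Σ i : ↥(f.divisors ×ˢ f.divisors),
    Σ L : CycSub Δ (i.1.1.gcd i.1.2) (f / i.1.1.lcm i.1.2),
      Quot (PairRel i.1.1 i.1.2 L.1) × Quot (GenRel Δ L.1 (f / i.1.1.lcm i.1.2))

lemma nonempty_orbClass_equiv (Δ : Submodule ℤ K) {f : ℕ} (hf : 0 < f) :
    Nonempty (Quot (OrbRel Δ f) ≃ OrbClass Δ f) := by
  have hlcm : ∀ i : ↥(f.divisors ×ˢ f.divisors), i.1.1.lcm i.1.2 ∣ f := fun i =>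
    Nat.lcm_dvd (Nat.dvd_of_mem_divisors (Finset.mem_product.1 i.2).1)
      (Nat.dvd_of_mem_divisors (Finset.mem_product.1 i.2).2)
  have hq : Nonempty (Quot (OrbRel Δ f) ≃ Quot fun a a' : OrbClass Δ f => a = a') := by
    refine nonempty_quot_equiv eq_equivalence
      (fun p a => ∃ (h : IsLC p.1.1.1 a.1.1.1 ∧ IsLC p.1.1.2 a.1.1.2 ∧ p.1.1.1 * p.1.1.2 = a.2.1.1)
        (h' : IsGen Δ a.2.1.1 (f / a.1.1.1.lcm a.1.1.2) p.1.2),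
          a.2.2 = (Quot.mk _ ⟨p.1.1, h⟩, Quot.mk _ ⟨p.1.2, h'⟩)) ?_ ?_ ?_
    · rintro ⟨⟨⟨B, B'⟩, ε⟩, b, b', N, hb, hb', hN, ho, hΔ⟩
      have hbf : b ∣ f := (Nat.dvd_lcm_left b b').trans ⟨N, hN.symm⟩
      have hbf' : b' ∣ f := (Nat.dvd_lcm_right b b').trans ⟨N, hN.symm⟩
      have e : f / b.lcm b' = N := by
        rw [← hN, Nat.mul_div_cancel_left _ (Nat.lcm_pos hb.pos hb'.pos)]
      subst e
      exact ⟨⟨⟨(b, b'), Finset.mem_product.2 ⟨Nat.mem_divisors.2 ⟨hbf, hf.ne'⟩,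
        Nat.mem_divisors.2 ⟨hbf', hf.ne'⟩⟩⟩, ⟨B * B', hb.mul hb', ε, ho, hΔ⟩,
          Quot.mk _ ⟨(B, B'), hb, hb', rfl⟩, Quot.mk _ ⟨ε, ho, hΔ⟩⟩, ⟨hb, hb', rfl⟩, ⟨ho, hΔ⟩, rfl⟩
    · rintro ⟨⟨⟨b, b'⟩, hi⟩, ⟨L, hL⟩, ⟨⟨⟨B, B'⟩, hb, hb', hBL⟩⟩, ⟨⟨ε, hε⟩⟩⟩
      dsimp only at hb hb' hBL hε
      exact ⟨⟨((B, B'), ε), b, b', _, hb, hb', Nat.mul_div_cancel' (hlcm ⟨_, hi⟩),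
        (hBL ▸ hε : IsGen Δ (B * B') _ ε)⟩, ⟨hb, hb', hBL⟩, hε, rfl⟩
    · rintro ⟨⟨⟨B, B'⟩, ε⟩, hp⟩ ⟨⟨⟨C, C'⟩, η⟩, hq⟩ ⟨⟨⟨b, b'⟩, hi⟩, ⟨L, hL⟩, x⟩
        ⟨⟨⟨d, d'⟩, hj⟩, ⟨M, hM⟩, y⟩ ⟨⟨hb, hb', hBL⟩, hε, e⟩ ⟨⟨hd, hd', hCM⟩, hη, e'⟩
      dsimp only at hb hb' hBL hε hd hd' hCM hη e e'
      replace e : x = (Quot.mk _ ⟨(B, B'), hb, hb', hBL⟩, Quot.mk _ ⟨ε, hε⟩) := e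
      replace e' : y = (Quot.mk _ ⟨(C, C'), hd, hd', hCM⟩, Quot.mk _ ⟨η, hη⟩) := e'
      subst e e'
      constructor
      · rintro ⟨t, ht, σ, hσ, h1, h2, h3⟩
        dsimp only at h1 h2 h3
        obtain rfl : b = d := (hb.smul ht).unique (h1 ▸ hd)
        obtain rfl : b' = d' := (hb'.smul (inv_ne_zero ht)).unique (h2 ▸ hd')
        obtain rfl : L = M := by rw [← hBL, ← hCM, h1, h2, smul_mul_inv_smul ht]
        have e1 : (Quot.mk (PairRel b b' L) ⟨(B, B'), hb, hb', hBL⟩) =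
          Quot.mk _ ⟨(C, C'), hd, hd', hCM⟩ := Quot.sound ⟨t, ht, h1, h2⟩
        have e2 : (Quot.mk (GenRel Δ L (f / b.lcm b')) ⟨ε, hε⟩) = Quot.mk _ ⟨η, hη⟩ :=
          Quot.sound ⟨σ, hσ, by rw [hBL] at h3; exact h3⟩
        exact congrArg (Sigma.mk _) (congrArg (Sigma.mk _) (Prod.ext e1 e2))
      · intro h
        obtain ⟨h1, h2⟩ := Sigma.mk.inj h
        obtain ⟨rfl, rfl⟩ := Prod.mk.inj (Subtype.mk.inj h1)
        obtain ⟨h3, h4⟩ := Sigma.mk.inj (eq_of_heq h2)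
        obtain rfl := Subtype.mk.inj h3
        obtain ⟨h5, h6⟩ := Prod.mk.inj (eq_of_heq h4)
        obtain ⟨t, ht, e1, e2⟩ := ((pairRel_equivalence b b' L).quot_mk_eq_iff _ _).1 h5
        obtain ⟨σ, hσ, e3⟩ := ((genRel_equivalence Δ L _).quot_mk_eq_iff _ _).1 h6
        exact ⟨t, ht, σ, hσ, e1, e2, by rw [hBL]; exact e3⟩
  refine hq.map fun e => e.trans ⟨Quot.lift id fun _ _ h => h, Quot.mk _, ?_, fun _ => rfl⟩
  rintro ⟨a⟩
  rfl

lemma card_quot_orbRel {Δ : Submodule ℤ K} (hΔ : IsLat K Δ) {f : ℕ} (hf : 0 < f) :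
    Nat.card (Quot (OrbRel Δ f)) = ∑ i ∈ f.divisors ×ˢ f.divisors,
      Nat.card (CycSub Δ (i.1.gcd i.2) (f / i.1.lcm i.2)) *
        (Nat.card (LatClass K (i.1.lcm i.2)) * phiU (f / i.1.lcm i.2)) := by
  have hpos : ∀ i : ↥(f.divisors ×ˢ f.divisors), 0 < i.1.1 ∧ 0 < i.1.2 := fun i =>
    ⟨Nat.pos_of_mem_divisors (Finset.mem_product.1 i.2).1,
      Nat.pos_of_mem_divisors (Finset.mem_product.1 i.2).2⟩
  have hN : ∀ i : ↥(f.divisors ×ˢ f.divisors), 0 < f / i.1.1.lcm i.1.2 := fun i =>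
    Nat.div_pos (Nat.le_of_dvd hf
      (Nat.lcm_dvd (Nat.dvd_of_mem_divisors (Finset.mem_product.1 i.2).1)
      (Nat.dvd_of_mem_divisors (Finset.mem_product.1 i.2).2)))
      (Nat.lcm_pos (hpos i).1 (hpos i).2)
  have (i : ↥(f.divisors ×ˢ f.divisors)) :
      Finite (CycSub Δ (i.1.1.gcd i.1.2) (f / i.1.1.lcm i.1.2)) := finite_cycSub hΔ (hN i) _
  have (i : ↥(f.divisors ×ˢ f.divisors)) (L : CycSub Δ (i.1.1.gcd i.1.2) (f / i.1.1.lcm i.1.2)) :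
      Finite (Quot (PairRel i.1.1 i.1.2 L.1) × Quot (GenRel Δ L.1 (f / i.1.1.lcm i.1.2))) := by
    obtain ⟨e⟩ := nonempty_pairLat_quot_equiv (hpos i).1 (hpos i).2 L.2.1
    obtain ⟨e'⟩ := L.2.2.choose_spec.nonempty_equiv
    have := finite_latClass (K := K) (Nat.lcm_pos (hpos i).1 (hpos i).2)
    have : NeZero (f / i.1.1.lcm i.1.2) := ⟨(hN i).ne'⟩
    have := Finite.of_equiv _ e.symm
    have := Finite.of_equiv _ e'.symm
    infer_instance
  rw [Nat.card_congr (nonempty_orbClass_equiv Δ hf).some, Nat.card_sigma]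
  refine Eq.trans ?_ (Finset.sum_coe_sort _ fun i : ℕ × ℕ =>
    Nat.card (CycSub Δ (i.1.gcd i.2) (f / i.1.lcm i.2)) *
        (Nat.card (LatClass K (i.1.lcm i.2)) * phiU (f / i.1.lcm i.2)))
  refine Finset.sum_congr rfl fun i _ => ?_
  have := Fintype.ofFinite (CycSub Δ (i.1.1.gcd i.1.2) (f / i.1.1.lcm i.1.2))
  rw [Nat.card_sigma, Finset.sum_congr rfl (g := fun _ =>
    Nat.card (LatClass K (i.1.1.lcm i.1.2)) * phiU (f / i.1.1.lcm i.1.2)) fun L _ => ?_]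
  · rw [Finset.sum_const, Finset.card_univ, smul_eq_mul,
      Nat.card_eq_fintype_card (α := CycSub Δ (i.1.1.gcd i.1.2) (f / i.1.1.lcm i.1.2))]
  · rw [Nat.card_prod, L.2.2.choose_spec.card_quot,
      Nat.card_congr (nonempty_pairLat_quot_equiv (hpos i).1 (hpos i).2 L.2.1).some]

end

lemma card_filter_coprime_div {n : ℕ} (hn : n ≠ 0) :
    (n.divisors.filter fun x => x.Coprime (n / x)).card = 2 ^ n.primeFactors.card := by
  rw [← Finset.card_powerset]
  have hfac : ∀ {x}, x ∈ n.divisors → x.Coprime (n / x) → ∀ p ∈ x.primeFactors,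
      n.factorization p = x.factorization p := by
    intro x hx hc p hp
    have := Nat.factorization_eq_of_coprime_left hc
      (List.mem_toFinset.1 hp)
    rwa [Nat.mul_div_cancel' (Nat.dvd_of_mem_divisors hx)] at this
  refine Finset.card_bij' (fun x _ => x.primeFactors)
    (fun S _ => ∏ p ∈ S, p ^ n.factorization p) ?_ ?_ ?_ ?_
  · intro x hx
    rw [Finset.mem_filter] at hx
    exact Finset.mem_powerset.2 (Nat.primeFactors_mono (Nat.dvd_of_mem_divisors hx.1) hn)
  · intro S hS
    rw [Finset.mem_powerset] at hS
    have e : (∏ p ∈ S, p ^ n.factorization p) *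
        ∏ p ∈ n.primeFactors \ S, p ^ n.factorization p = n := by
      rw [mul_comm, Finset.prod_sdiff hS]
      exact Nat.prod_factorization_pow_eq_self hn
    have hpos : 0 < ∏ p ∈ S, p ^ n.factorization p :=
      Nat.pos_of_ne_zero fun h => hn (by rw [← e, h, zero_mul])
    rw [Finset.mem_filter, Nat.mem_divisors]
    refine ⟨⟨⟨_, e.symm⟩, hn⟩, ?_⟩
    rw [Nat.div_eq_of_eq_mul_right hpos e.symm]
    refine Nat.Coprime.prod_left fun p hp => Nat.Coprime.prod_right fun q hq => ?_
    refine Nat.Coprime.pow _ _ ((Nat.coprime_primes (Nat.prime_of_mem_primeFactors (hS hp))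
      (Nat.prime_of_mem_primeFactors (Finset.mem_sdiff.1 hq).1)).2 ?_)
    rintro rfl
    exact (Finset.mem_sdiff.1 hq).2 hp
  · intro x hx
    rw [Finset.mem_filter] at hx
    rw [Finset.prod_congr rfl fun p hp => by rw [hfac hx.1 hx.2 p hp]]
    exact Nat.prod_factorization_pow_eq_self (Nat.pos_of_mem_divisors hx.1).ne'
  · intro S hS
    rw [Finset.mem_powerset] at hS
    ext p
    have hpr : ∀ p ∈ S, p.Prime := fun p hp => Nat.prime_of_mem_primeFactors (hS hp)
    rw [Nat.mem_primeFactors]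
    constructor
    · rintro ⟨hp, hd, -⟩
      obtain ⟨q, hq, hd⟩ := (hp.prime.dvd_finsetProd_iff _).1 hd
      rwa [(Nat.prime_dvd_prime_iff_eq hp (hpr q hq)).1 (hp.dvd_of_dvd_pow hd)]
    · intro hp
      refine ⟨hpr p hp, (dvd_pow_self p ?_).trans (Finset.dvd_prod_of_mem _ hp),
        Finset.prod_ne_zero_iff.2 fun q hq => pow_ne_zero _ (hpr q hq).ne_zero⟩
      exact ((hpr p hp).factorization_pos_of_dvd hn (Nat.dvd_of_mem_primeFactors (hS hp))).ne'

lemma card_filter_lcm_gcd {f ℓ g : ℕ} (hℓ : ℓ ∈ f.divisors) (hg : g ∈ ℓ.divisors) :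
    ((f.divisors ×ˢ f.divisors).filter fun i => i.1.lcm i.2 = ℓ ∧ i.1.gcd i.2 = g).card =
      2 ^ (ℓ / g).primeFactors.card := by
  obtain ⟨n, rfl⟩ := Nat.dvd_of_mem_divisors hg
  have hℓ0 : g * n ≠ 0 := (Nat.mem_divisors.1 hg).2
  have hg0 : 0 < g := Nat.pos_of_mem_divisors hg
  have hn0 : n ≠ 0 := right_ne_zero_of_mul hℓ0
  have hdf := Nat.dvd_of_mem_divisors hℓ
  have hf0 := (Nat.mem_divisors.1 hℓ).2
  rw [Nat.mul_div_cancel_left _ hg0, ← card_filter_coprime_div hn0]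
  refine Finset.card_bij' (fun i _ => i.1 / g) (fun x _ => (g * x, g * (n / x))) ?_ ?_ ?_ ?_
  · rintro ⟨b, b'⟩ hi
    obtain ⟨-, e1, e2⟩ := Finset.mem_filter.1 hi
    dsimp only at e1 e2 ⊢
    obtain ⟨x, rfl⟩ : g ∣ b := e2 ▸ Nat.gcd_dvd_left _ _
    obtain ⟨y, rfl⟩ : g ∣ b' := e2 ▸ Nat.gcd_dvd_right _ _
    rw [Nat.gcd_mul_left] at e2
    have hc : x.gcd y = 1 := Nat.eq_of_mul_eq_mul_left hg0 (by rw [e2, mul_one])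
    rw [Nat.lcm_mul_left, Nat.Coprime.lcm_eq_mul hc] at e1
    obtain rfl : x * y = n := Nat.eq_of_mul_eq_mul_left hg0 e1
    have hx : 0 < x := Nat.pos_of_ne_zero (left_ne_zero_of_mul hn0)
    rw [Nat.mul_div_cancel_left _ hg0, Finset.mem_filter, Nat.mul_div_cancel_left _ hx]
    exact ⟨Nat.mem_divisors.2 ⟨dvd_mul_right _ _, hn0⟩, hc⟩
  · intro x hx
    obtain ⟨hx, hc⟩ := Finset.mem_filter.1 hx
    obtain ⟨y, rfl⟩ := Nat.dvd_of_mem_divisors hx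
    have hx0 : 0 < x := Nat.pos_of_ne_zero (left_ne_zero_of_mul hn0)
    rw [Nat.mul_div_cancel_left _ hx0] at hc ⊢
    rw [Finset.mem_filter, Finset.mem_product, Nat.mem_divisors, Nat.mem_divisors]
    refine ⟨⟨⟨(mul_dvd_mul_left g (dvd_mul_right x y)).trans hdf, hf0⟩,
      ⟨(mul_dvd_mul_left g (dvd_mul_left y x)).trans hdf, hf0⟩⟩, ?_, ?_⟩
    · dsimp only
      rw [Nat.lcm_mul_left, hc.lcm_eq_mul]
    · dsimp only
      rw [Nat.gcd_mul_left, hc, mul_one]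
  · rintro ⟨b, b'⟩ hi
    obtain ⟨-, e1, e2⟩ := Finset.mem_filter.1 hi
    dsimp only at e1 e2 ⊢
    obtain ⟨x, rfl⟩ : g ∣ b := e2 ▸ Nat.gcd_dvd_left _ _
    obtain ⟨y, rfl⟩ : g ∣ b' := e2 ▸ Nat.gcd_dvd_right _ _
    rw [Nat.gcd_mul_left] at e2
    have hc : x.gcd y = 1 := Nat.eq_of_mul_eq_mul_left hg0 (by rw [e2, mul_one])
    rw [Nat.lcm_mul_left, Nat.Coprime.lcm_eq_mul hc] at e1
    obtain rfl : x * y = n := Nat.eq_of_mul_eq_mul_left hg0 e1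
    have hx : 0 < x := Nat.pos_of_ne_zero (left_ne_zero_of_mul hn0)
    rw [Nat.mul_div_cancel_left _ hg0, Nat.mul_div_cancel_left _ hx]
  · intro x hx
    exact Nat.mul_div_cancel_left _ hg0

lemma sum_divisors_product_lcm_gcd (f : ℕ) (F : ℕ → ℕ → ℕ) :
    ∑ i ∈ f.divisors ×ˢ f.divisors, F (i.1.lcm i.2) (i.1.gcd i.2) =
      ∑ ℓ ∈ f.divisors, ∑ g ∈ ℓ.divisors, 2 ^ (ℓ / g).primeFactors.card * F ℓ g := by
  rw [Finset.sum_sigma', ← Finset.sum_fiberwise_of_maps_to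
    (t := f.divisors.sigma fun ℓ => ℓ.divisors)
    (g := fun i : ℕ × ℕ => (⟨i.1.lcm i.2, i.1.gcd i.2⟩ : Σ _ : ℕ, ℕ))]
  · refine Finset.sum_congr rfl fun ⟨ℓ, g⟩ h => ?_
    rw [Finset.mem_sigma] at h
    rw [← card_filter_lcm_gcd h.1 h.2, ← smul_eq_mul, ← Finset.sum_const]
    refine Finset.sum_congr (Finset.filter_congr fun i _ => by simp) fun i hi => ?_
    obtain ⟨rfl, rfl⟩ := (Finset.mem_filter.1 hi).2
    rfl
  · rintro ⟨b, b'⟩ h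
    rw [Finset.mem_product, Nat.mem_divisors, Nat.mem_divisors] at h
    have hl := Nat.lcm_dvd h.1.1 h.2.1
    refine Finset.mem_sigma.2 ⟨Nat.mem_divisors.2 ⟨hl, h.1.2⟩, Nat.mem_divisors.2
      ⟨(Nat.gcd_dvd_left _ _).trans (Nat.dvd_lcm_left _ _), ?_⟩⟩
    exact ne_zero_of_dvd_ne_zero h.1.2 hl

end

/-- The number of orbits of `Γ(𝔞, 𝔞′)` on `ℙ¹(K)` is
`∑_{ℓ ∣ f} h_ℓ · φᵤ(f/ℓ) · ∑_{g ∣ ℓ} 2^{ω(ℓ/g)} · r_K(f′, g, f/ℓ)`. -/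
theorem gammaLat_orbit_count
    (hdeg : Module.finrank ℚ K = 2)
    (himag : IsEmpty (K →+* ℝ))
    (hroots : ∀ x : K, (∃ n : ℕ, 0 < n ∧ x ^ n = 1) → x = 1 ∨ x = -1)
    (𝔞 𝔞' : Submodule ℤ K) (h𝔞 : IsLat K 𝔞) (h𝔞' : IsLat K 𝔞')
    (c c' : ℕ) (hc : HasCond K 𝔞 c) (hc' : HasCond K 𝔞' c')
    (f f' : ℕ) (hf : f = Nat.lcm c c') (hf' : f' = Nat.gcd c c')
    (r : ℕ → ℕ → ℕ → ℕ)
    (hr : ∀ a b N : ℕ, ∀ L : Submodule ℤ K,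
      IsLat K L → HasCond K L a → cnt K L b N = r a b N) :
    Nat.card (Quot (gammaLatRel K 𝔞 𝔞' c c' f')) =
      ∑ ℓ ∈ f.divisors, Nat.card (ClassGroup (orderSubring K ℓ)) * phiU (f / ℓ) *
        ∑ g ∈ ℓ.divisors, 2 ^ (ℓ / g).primeFactors.card * r f' g (f / ℓ) := by
  have : Fact (Module.finrank ℚ K = 2) := ⟨hdeg⟩
  have hL : IsLC 𝔞 c := ⟨h𝔞, hc⟩
  have hL' : IsLC 𝔞' c' := ⟨h𝔞', hc'⟩
  have hΔ : IsLC (𝔞 * 𝔞') f' := hf' ▸ hL.mul hL'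
  have hf0 : 0 < f := hf ▸ Nat.lcm_pos hL.pos hL'.pos
  have hcard : Nat.card (Quot (gammaLatRel K 𝔞 𝔞' c c' f')) =
      Nat.card (Quot (OrbRel (𝔞 * 𝔞') f)) := by
    rw [hf, hf']
    exact Nat.card_congr (nonempty_quot_gammaLatRel hL hL').some
  rw [hcard, card_quot_orbRel hΔ.lat hf0,
    sum_divisors_product_lcm_gcd f fun ℓ g => Nat.card (CycSub (𝔞 * 𝔞') g (f / ℓ)) *
      (Nat.card (LatClass K ℓ) * phiU (f / ℓ))]
  refine Finset.sum_congr rfl fun ℓ hℓ => ?_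
  have hℓ0 := Nat.pos_of_mem_divisors hℓ
  have hN : 0 < f / ℓ := Nat.div_pos (Nat.divisor_le hℓ) hℓ0
  have hN0 : ((f / ℓ : ℕ) : K) ≠ 0 := Nat.cast_ne_zero.2 hN.ne'
  rw [Finset.mul_sum]
  refine Finset.sum_congr rfl fun g _ => ?_
  rw [card_cycSub hΔ.lat hN, hr f' g _ _ (hΔ.smul hN0).lat (hΔ.smul hN0).cond,
    card_classGroup hℓ0]
  ring

end
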